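/- The multiplication map U⁻ ⊗ U⁰ ⊗ U⁺ → U, a ⊗ b ⊗ c ↦ abc, is a bijection of ℂ-vector spaces (an isomorphism of vector superspaces); i.e., U admits the Drinfel'd-type triangular decomposition U = U⁻ U⁰ U⁺ with uniqueness of the factorization at the level of tensors. -/

import Mathlib

noncomputable section

namespace QAS

open Polynomial
open scoped TensorProduct

/-! ### Basic combinatorial data -/

/-- `l_i = 1` for `i ≤ M`, `-1` otherwise. -/
def lof (M : ℕ) (i : ℕ) : ℤ := if i ≤ M then 1 else -1

/-- the bilinear form `(ε_i, ε_j) = l_i δ_{ij}`. -/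
def innerE (M : ℕ) (i j : ℕ) : ℤ := if i = j then lof M i else 0

/-- `(ε_a − ε_b, ε_c − ε_d)`. -/
def form4 (M : ℕ) (a b c d : ℕ) : ℤ :=
  innerE M a c - innerE M a d - innerE M b c + innerE M b d

/-- the Cartan pairing `c_{ij} = (ε_i − ε_{i+1}, ε_j − ε_{j+1})`. -/
def cc (M : ℕ) (i j : ℕ) : ℤ := form4 M i (i + 1) j (j + 1)

/-- `q_i = q^{l_i}`. -/
def qpar (q : ℂ) (M : ℕ) (i : ℕ) : ℂ := q ^ lof M i

/-- the quantum integer `[m]_v`. -/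
def qint (v : ℂ) (m : ℤ) : ℂ := (v ^ m - v ^ (-m)) / (v - v⁻¹)

/-- the sign `(−1)^{|X_i||X_j|}` for the generators `X_i`, `X_j`. -/
def sgn (M : ℕ) (i j : ℕ) : ℂ := if i = M ∧ j = M then -1 else 1

/-- index set `1 ≤ i ≤ M+N−1`. -/
abbrev Idx (M N : ℕ) := {i : ℕ // 1 ≤ i ∧ i ≤ M + N - 1}

/-! ### Generators and the free superalgebra -/

/-- Drinfel'd generators; when `ext = true` we also have `K₀^{±1}`. -/
inductive Gen (M N : ℕ) (ext : Bool) : Type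
  | Xp : Idx M N → ℤ → Gen M N ext
  | Xm : Idx M N → ℤ → Gen M N ext
  | K : Idx M N → Gen M N ext
  | Ki : Idx M N → Gen M N ext
  | H : Idx M N → {s : ℤ // s ≠ 0} → Gen M N ext
  | K0 : ext = true → Gen M N ext
  | K0i : ext = true → Gen M N ext

abbrev FA (M N : ℕ) (ext : Bool) := FreeAlgebra ℂ (Gen M N ext)

def gi {M N : ℕ} {ext : Bool} (g : Gen M N ext) : FA M N ext := FreeAlgebra.ι ℂ g

def XpF (M N : ℕ) (ext : Bool) (i : ℕ) (n : ℤ) : FA M N ext :=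
  if h : 1 ≤ i ∧ i ≤ M + N - 1 then gi (Gen.Xp ⟨i, h⟩ n) else 0

def XmF (M N : ℕ) (ext : Bool) (i : ℕ) (n : ℤ) : FA M N ext :=
  if h : 1 ≤ i ∧ i ≤ M + N - 1 then gi (Gen.Xm ⟨i, h⟩ n) else 0

def KF (M N : ℕ) (ext : Bool) (i : ℕ) : FA M N ext :=
  if h : 1 ≤ i ∧ i ≤ M + N - 1 then gi (Gen.K ⟨i, h⟩) else 0

def KiF (M N : ℕ) (ext : Bool) (i : ℕ) : FA M N ext :=
  if h : 1 ≤ i ∧ i ≤ M + N - 1 then gi (Gen.Ki ⟨i, h⟩) else 0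

def HF (M N : ℕ) (ext : Bool) (i : ℕ) (s : ℤ) : FA M N ext :=
  if h : (1 ≤ i ∧ i ≤ M + N - 1) ∧ s ≠ 0 then gi (Gen.H ⟨i, h.1⟩ ⟨s, h.2⟩) else 0

def K0F (M N : ℕ) (ext : Bool) : FA M N ext :=
  if h : ext = true then gi (Gen.K0 h) else 0

def K0iF (M N : ℕ) (ext : Bool) : FA M N ext :=
  if h : ext = true then gi (Gen.K0i h) else 0

/-- coefficients of `exp (t · Σ_{s ≥ 1} a_s z^s)`. -/
def expC {A : Type} [Ring A] [Algebra ℂ A] (t : ℂ) (a : ℕ → A) : ℕ → A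
  | 0 => 1
  | n + 1 =>
      ((n : ℂ) + 1)⁻¹ •
        (t • ∑ s ∈ Finset.range (n + 1), ((s : ℂ) + 1) • (a (s + 1) * expC t a (n - s)))
termination_by n => n
decreasing_by omega

/-- `φ⁺_{i,n}`, the coefficient of `z^n` in
`K_i exp((q_i − q_i⁻¹) Σ_{s>0} h_{i,s} z^s)`. -/
def phiPF (q : ℂ) (M N : ℕ) (ext : Bool) (i : ℕ) (n : ℤ) : FA M N ext :=
  if 0 ≤ n then
    KF M N ext i *
      expC (qpar q M i - (qpar q M i)⁻¹) (fun s => HF M N ext i (s : ℤ)) n.toNat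
  else 0

/-- `φ⁻_{i,n}`, the coefficient of `z^n` (`n ≤ 0`) in
`K_i⁻¹ exp(−(q_i − q_i⁻¹) Σ_{s>0} h_{i,−s} z^{−s})`. -/
def phiMF (q : ℂ) (M N : ℕ) (ext : Bool) (i : ℕ) (n : ℤ) : FA M N ext :=
  if n ≤ 0 then
    KiF M N ext i *
      expC (-(qpar q M i - (qpar q M i)⁻¹)) (fun s => HF M N ext i (-(s : ℤ))) (-n).toNat
  else 0

/-- the `u`-bracket `[x,y]_u = xy − u·yx` (for `x` or `y` of even parity). -/
def brF {A : Type} [Ring A] [Module ℂ A] (u : ℂ) (x y : A) : A := x * y - u • (y * x)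

/-- the quartic oscillation expression
`[[[X_{M−1,m}, X_{M,n}]_{q⁻¹}, X_{M+1,k}]_q, X_{M,u}]` (a graded anticommutator in the
outermost bracket, both entries being odd). -/
def oscOf {A : Type} [Ring A] [Module ℂ A] (q : ℂ) (M : ℕ) (X : ℕ → ℤ → A) (m n k u : ℤ) : A :=
  brF q (brF q⁻¹ (X (M - 1) m) (X M n)) (X (M + 1) k) * X M u +
    X M u * brF q (brF q⁻¹ (X (M - 1) m) (X M n)) (X (M + 1) k)

/-! ### The defining relations.
`lvl = 1`: only (R1)–(R3);  `lvl = 2`: (R1)–(R5);  `lvl = 3`: all of (R1)–(R7).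
`ext = true` adds `K₀^{±1}` together with its relations. -/

inductive rel (q : ℂ) (M N : ℕ) (ext : Bool) (lvl : ℕ) : FA M N ext → FA M N ext → Prop
  | KKi (i : Idx M N) : rel q M N ext lvl (gi (Gen.K i) * gi (Gen.Ki i)) 1
  | KiK (i : Idx M N) : rel q M N ext lvl (gi (Gen.Ki i) * gi (Gen.K i)) 1
  | KK (i j : Idx M N) :
      rel q M N ext lvl (gi (Gen.K i) * gi (Gen.K j)) (gi (Gen.K j) * gi (Gen.K i))
  | KKi2 (i j : Idx M N) :
      rel q M N ext lvl (gi (Gen.K i) * gi (Gen.Ki j)) (gi (Gen.Ki j) * gi (Gen.K i))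
  | KiKi (i j : Idx M N) :
      rel q M N ext lvl (gi (Gen.Ki i) * gi (Gen.Ki j)) (gi (Gen.Ki j) * gi (Gen.Ki i))
  | KH (i j : Idx M N) (s : {s : ℤ // s ≠ 0}) :
      rel q M N ext lvl (gi (Gen.K i) * gi (Gen.H j s)) (gi (Gen.H j s) * gi (Gen.K i))
  | KiH (i j : Idx M N) (s : {s : ℤ // s ≠ 0}) :
      rel q M N ext lvl (gi (Gen.Ki i) * gi (Gen.H j s)) (gi (Gen.H j s) * gi (Gen.Ki i))
  | HH (i j : Idx M N) (s t : {s : ℤ // s ≠ 0}) :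
      rel q M N ext lvl (gi (Gen.H i s) * gi (Gen.H j t)) (gi (Gen.H j t) * gi (Gen.H i s))
  | KXp (i j : Idx M N) (n : ℤ) :
      rel q M N ext lvl (gi (Gen.K i) * gi (Gen.Xp j n))
        ((q ^ cc M i.1 j.1) • (gi (Gen.Xp j n) * gi (Gen.K i)))
  | KXm (i j : Idx M N) (n : ℤ) :
      rel q M N ext lvl (gi (Gen.K i) * gi (Gen.Xm j n))
        ((q ^ (-cc M i.1 j.1)) • (gi (Gen.Xm j n) * gi (Gen.K i)))
  | HXp (i j : Idx M N) (s : {s : ℤ // s ≠ 0}) (n : ℤ) :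
      rel q M N ext lvl
        (gi (Gen.H i s) * gi (Gen.Xp j n) - gi (Gen.Xp j n) * gi (Gen.H i s))
        ((qint (qpar q M i.1) (s.1 * lof M i.1 * cc M i.1 j.1) / (s.1 : ℂ)) •
          gi (Gen.Xp j (n + s.1)))
  | HXm (i j : Idx M N) (s : {s : ℤ // s ≠ 0}) (n : ℤ) :
      rel q M N ext lvl
        (gi (Gen.H i s) * gi (Gen.Xm j n) - gi (Gen.Xm j n) * gi (Gen.H i s))
        (-((qint (qpar q M i.1) (s.1 * lof M i.1 * cc M i.1 j.1) / (s.1 : ℂ)) •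
          gi (Gen.Xm j (n + s.1))))
  | XpXm (i j : Idx M N) (m n : ℤ) :
      rel q M N ext lvl
        (gi (Gen.Xp i m) * gi (Gen.Xm j n) -
          sgn M i.1 j.1 • (gi (Gen.Xm j n) * gi (Gen.Xp i m)))
        (if i = j then
            (qpar q M i.1 - (qpar q M i.1)⁻¹)⁻¹ •
              (phiPF q M N ext i.1 (m + n) - phiMF q M N ext i.1 (m + n))
          else 0)
  | XX0p (i j : Idx M N) (m n : ℤ) (h2 : 2 ≤ lvl) (h : cc M i.1 j.1 = 0) :
      rel q M N ext lvl
        (gi (Gen.Xp i m) * gi (Gen.Xp j n) -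
          sgn M i.1 j.1 • (gi (Gen.Xp j n) * gi (Gen.Xp i m))) 0
  | XX0m (i j : Idx M N) (m n : ℤ) (h2 : 2 ≤ lvl) (h : cc M i.1 j.1 = 0) :
      rel q M N ext lvl
        (gi (Gen.Xm i m) * gi (Gen.Xm j n) -
          sgn M i.1 j.1 • (gi (Gen.Xm j n) * gi (Gen.Xm i m))) 0
  | XXp (i j : Idx M N) (m n : ℤ) (h2 : 2 ≤ lvl) (h : cc M i.1 j.1 ≠ 0) :
      rel q M N ext lvl
        (gi (Gen.Xp i (m + 1)) * gi (Gen.Xp j n) -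
          (q ^ cc M i.1 j.1) • (gi (Gen.Xp j n) * gi (Gen.Xp i (m + 1))))
        ((q ^ cc M i.1 j.1) • (gi (Gen.Xp i m) * gi (Gen.Xp j (n + 1))) -
          gi (Gen.Xp j (n + 1)) * gi (Gen.Xp i m))
  | XXm (i j : Idx M N) (m n : ℤ) (h2 : 2 ≤ lvl) (h : cc M i.1 j.1 ≠ 0) :
      rel q M N ext lvl
        (gi (Gen.Xm i (m + 1)) * gi (Gen.Xm j n) -
          (q ^ (-cc M i.1 j.1)) • (gi (Gen.Xm j n) * gi (Gen.Xm i (m + 1))))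
        ((q ^ (-cc M i.1 j.1)) • (gi (Gen.Xm i m) * gi (Gen.Xm j (n + 1))) -
          gi (Gen.Xm j (n + 1)) * gi (Gen.Xm i m))
  | serreP (i j : Idx M N) (m n k : ℤ) (h3 : 3 ≤ lvl)
      (h : cc M i.1 j.1 = 1 ∨ cc M i.1 j.1 = -1) (hi : i.1 ≠ M) :
      rel q M N ext lvl
        (brF q (gi (Gen.Xp i m)) (brF q⁻¹ (gi (Gen.Xp i n)) (gi (Gen.Xp j k))) +
          brF q (gi (Gen.Xp i n)) (brF q⁻¹ (gi (Gen.Xp i m)) (gi (Gen.Xp j k)))) 0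
  | serreM (i j : Idx M N) (m n k : ℤ) (h3 : 3 ≤ lvl)
      (h : cc M i.1 j.1 = 1 ∨ cc M i.1 j.1 = -1) (hi : i.1 ≠ M) :
      rel q M N ext lvl
        (brF q (gi (Gen.Xm i m)) (brF q⁻¹ (gi (Gen.Xm i n)) (gi (Gen.Xm j k))) +
          brF q (gi (Gen.Xm i n)) (brF q⁻¹ (gi (Gen.Xm i m)) (gi (Gen.Xm j k)))) 0
  | oscP (m n k u : ℤ) (h3 : 3 ≤ lvl) (hM : 1 < M) (hN : 1 < N) :
      rel q M N ext lvl
        (oscOf q M (XpF M N ext) m n k u + oscOf q M (XpF M N ext) m u k n) 0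
  | oscM (m n k u : ℤ) (h3 : 3 ≤ lvl) (hM : 1 < M) (hN : 1 < N) :
      rel q M N ext lvl
        (oscOf q M (XmF M N ext) m n k u + oscOf q M (XmF M N ext) m u k n) 0
  | K0K0i (he : ext = true) : rel q M N ext lvl (gi (Gen.K0 he) * gi (Gen.K0i he)) 1
  | K0iK0 (he : ext = true) : rel q M N ext lvl (gi (Gen.K0i he) * gi (Gen.K0 he)) 1
  | K0K (he : ext = true) (i : Idx M N) :
      rel q M N ext lvl (gi (Gen.K0 he) * gi (Gen.K i)) (gi (Gen.K i) * gi (Gen.K0 he))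
  | K0Ki (he : ext = true) (i : Idx M N) :
      rel q M N ext lvl (gi (Gen.K0 he) * gi (Gen.Ki i)) (gi (Gen.Ki i) * gi (Gen.K0 he))
  | K0H (he : ext = true) (i : Idx M N) (s : {s : ℤ // s ≠ 0}) :
      rel q M N ext lvl (gi (Gen.K0 he) * gi (Gen.H i s)) (gi (Gen.H i s) * gi (Gen.K0 he))
  | K0Xp (he : ext = true) (i : Idx M N) (n : ℤ) :
      rel q M N ext lvl (gi (Gen.K0 he) * gi (Gen.Xp i n))
        ((q ^ (if i.1 = 1 then (1 : ℤ) else 0)) • (gi (Gen.Xp i n) * gi (Gen.K0 he)))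
  | K0Xm (he : ext = true) (i : Idx M N) (n : ℤ) :
      rel q M N ext lvl (gi (Gen.K0 he) * gi (Gen.Xm i n))
        ((q ^ (if i.1 = 1 then (-1 : ℤ) else 0)) • (gi (Gen.Xm i n) * gi (Gen.K0 he)))

/-! ### The quantum affine superalgebras -/

abbrev ALG (q : ℂ) (M N : ℕ) (ext : Bool) (lvl : ℕ) := RingQuot (rel q M N ext lvl)

def mkA (q : ℂ) (M N : ℕ) (ext : Bool) (lvl : ℕ) : FA M N ext →ₐ[ℂ] ALG q M N ext lvl :=
  RingQuot.mkAlgHom ℂ (rel q M N ext lvl)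

def XpA (q : ℂ) (M N : ℕ) (ext : Bool) (lvl : ℕ) (i : ℕ) (n : ℤ) : ALG q M N ext lvl :=
  mkA q M N ext lvl (XpF M N ext i n)

def XmA (q : ℂ) (M N : ℕ) (ext : Bool) (lvl : ℕ) (i : ℕ) (n : ℤ) : ALG q M N ext lvl :=
  mkA q M N ext lvl (XmF M N ext i n)

def KA (q : ℂ) (M N : ℕ) (ext : Bool) (lvl : ℕ) (i : ℕ) : ALG q M N ext lvl :=
  mkA q M N ext lvl (KF M N ext i)

def KiA (q : ℂ) (M N : ℕ) (ext : Bool) (lvl : ℕ) (i : ℕ) : ALG q M N ext lvl :=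
  mkA q M N ext lvl (KiF M N ext i)

def HA (q : ℂ) (M N : ℕ) (ext : Bool) (lvl : ℕ) (i : ℕ) (s : ℤ) : ALG q M N ext lvl :=
  mkA q M N ext lvl (HF M N ext i s)

def K0A (q : ℂ) (M N : ℕ) (ext : Bool) (lvl : ℕ) : ALG q M N ext lvl :=
  mkA q M N ext lvl (K0F M N ext)

def K0iA (q : ℂ) (M N : ℕ) (ext : Bool) (lvl : ℕ) : ALG q M N ext lvl :=
  mkA q M N ext lvl (K0iF M N ext)

def phiPA (q : ℂ) (M N : ℕ) (ext : Bool) (lvl : ℕ) (i : ℕ) (n : ℤ) : ALG q M N ext lvl :=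
  mkA q M N ext lvl (phiPF q M N ext i n)

def phiMA (q : ℂ) (M N : ℕ) (ext : Bool) (lvl : ℕ) (i : ℕ) (n : ℤ) : ALG q M N ext lvl :=
  mkA q M N ext lvl (phiMF q M N ext i n)

/-- `U⁺`: the subalgebra generated by the `X⁺_{i,n}`. -/
def Aplus (q : ℂ) (M N : ℕ) (ext : Bool) (lvl : ℕ) : Subalgebra ℂ (ALG q M N ext lvl) :=
  Algebra.adjoin ℂ {x | ∃ i : ℕ, ∃ n : ℤ, x = XpA q M N ext lvl i n}

/-- `U⁻`: the subalgebra generated by the `X⁻_{i,n}`. -/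
def Aminus (q : ℂ) (M N : ℕ) (ext : Bool) (lvl : ℕ) : Subalgebra ℂ (ALG q M N ext lvl) :=
  Algebra.adjoin ℂ {x | ∃ i : ℕ, ∃ n : ℤ, x = XmA q M N ext lvl i n}

/-- `U⁰`: the subalgebra generated by the `K_i^{±1}` and `h_{i,s}`. -/
def Azero (q : ℂ) (M N : ℕ) (ext : Bool) (lvl : ℕ) : Subalgebra ℂ (ALG q M N ext lvl) :=
  Algebra.adjoin ℂ {x | (∃ i : ℕ, x = KA q M N ext lvl i) ∨ (∃ i : ℕ, x = KiA q M N ext lvl i) ∨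
    ∃ i : ℕ, ∃ s : ℤ, x = HA q M N ext lvl i s}

/-- `U'⁰`: the subalgebra generated by `U⁰` and `K₀^{±1}`. -/
def AzeroE (q : ℂ) (M N : ℕ) (ext : Bool) (lvl : ℕ) : Subalgebra ℂ (ALG q M N ext lvl) :=
  Algebra.adjoin ℂ {x | (∃ i : ℕ, x = KA q M N ext lvl i) ∨ (∃ i : ℕ, x = KiA q M N ext lvl i) ∨
    (∃ i : ℕ, ∃ s : ℤ, x = HA q M N ext lvl i s) ∨ x = K0A q M N ext lvl ∨
      x = K0iA q M N ext lvl}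

/-! ### The multiplication map on the triple tensor product -/

def triMul (q : ℂ) (M N : ℕ) (ext : Bool) (lvl : ℕ)
    (S T R : Subalgebra ℂ (ALG q M N ext lvl)) :
    (↥S ⊗[ℂ] (↥T ⊗[ℂ] ↥R)) →ₗ[ℂ] ALG q M N ext lvl :=
  TensorProduct.lift
    (((LinearMap.mul ℂ (ALG q M N ext lvl)).comp S.val.toLinearMap).compl₂
      (TensorProduct.lift
        (((LinearMap.mul ℂ (ALG q M N ext lvl)).comp T.val.toLinearMap).compl₂
          R.val.toLinearMap)))

/-! ### Root vectors and PBW monomials -/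

def Xroot (q : ℂ) (M N : ℕ) (ext : Bool) (lvl : ℕ) (i : ℕ) : ℕ → ℤ → ALG q M N ext lvl
  | 0, n => XpA q M N ext lvl i n
  | k + 1, n =>
      brF (qpar q M (i + k + 1)) (Xroot q M N ext lvl i k n) (XpA q M N ext lvl (i + k + 1) 0)

/-- the root vector `X_{α_i + ⋯ + α_j}(n)`. -/
def XrootIJ (q : ℂ) (M N : ℕ) (ext : Bool) (lvl : ℕ) (i j : ℕ) (n : ℤ) : ALG q M N ext lvl :=
  Xroot q M N ext lvl i (j - i) n

def rootLE (a b : ℕ × ℕ) : Prop := a.1 < b.1 ∨ (a.1 = b.1 ∧ a.2 ≤ b.2)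

/-- the set of PBW ordered monomials in the root vectors. -/
def pbwSet (q : ℂ) (M N : ℕ) (ext : Bool) (lvl : ℕ) : Set (ALG q M N ext lvl) :=
  {x | ∃ L : List ((ℕ × ℕ) × ℤ),
      (∀ p ∈ L, 1 ≤ p.1.1 ∧ p.1.1 ≤ p.1.2 ∧ p.1.2 ≤ M + N - 1) ∧
      L.Chain' (fun a b => rootLE a.1 b.1) ∧
      x = (L.map fun p => XrootIJ q M N ext lvl p.1.1 p.1.2 p.2).prod}

/-- PBW ordered monomials of total degree `d` (`d i` counts the multiplicity of `α_i`). -/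
def pbwDegSet (q : ℂ) (M N : ℕ) (ext : Bool) (lvl : ℕ) (d : ℕ → ℕ) : Set (ALG q M N ext lvl) :=
  {x | ∃ L : List ((ℕ × ℕ) × ℤ),
      (∀ p ∈ L, 1 ≤ p.1.1 ∧ p.1.1 ≤ p.1.2 ∧ p.1.2 ≤ M + N - 1) ∧
      L.Chain' (fun a b => rootLE a.1 b.1) ∧
      (∀ i : ℕ, ((L.map fun p => if p.1.1 ≤ i ∧ i ≤ p.1.2 then 1 else 0).sum) = d i) ∧
      x = (L.map fun p => XrootIJ q M N ext lvl p.1.1 p.1.2 p.2).prod}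

/-- words in the generators `X⁺_{i,n}` of degree `d`. -/
def wordDegSet (q : ℂ) (M N : ℕ) (ext : Bool) (lvl : ℕ) (d : ℕ → ℕ) :
    Set (ALG q M N ext lvl) :=
  {x | ∃ w : List (ℕ × ℤ), (∀ p ∈ w, 1 ≤ p.1 ∧ p.1 ≤ M + N - 1) ∧
      (∀ i : ℕ, (w.map Prod.fst).count i = d i) ∧
      x = (w.map fun p => XpA q M N ext lvl p.1 p.2).prod}

/-! ### The subspaces `I^±_{i,j}` and `O^±` -/

def IElt (q : ℂ) (M N : ℕ) (ext : Bool) (lvl : ℕ) (pl : Bool) (i j : ℕ) (m n : ℤ) :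
    ALG q M N ext lvl :=
  let X : ℕ → ℤ → ALG q M N ext lvl := if pl then XpA q M N ext lvl else XmA q M N ext lvl
  let e : ℤ := if pl then cc M i j else -cc M i j
  if cc M i j = 0 then X i m * X j n - sgn M i j • (X j n * X i m)
  else
    X i (m + 1) * X j n - (q ^ e) • (X j n * X i (m + 1)) -
      (q ^ e) • (X i m * X j (n + 1)) + X j (n + 1) * X i m

def Isub (q : ℂ) (M N : ℕ) (ext : Bool) (lvl : ℕ) (pl : Bool) (i j : ℕ) :
    Submodule ℂ (ALG q M N ext lvl) :=
  Submodule.span ℂ (Set.range fun p : ℤ × ℤ => IElt q M N ext lvl pl i j p.1 p.2)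

def IsubAll (q : ℂ) (M N : ℕ) (ext : Bool) (lvl : ℕ) (pl : Bool) :
    Submodule ℂ (ALG q M N ext lvl) :=
  ⨆ p : ℕ × ℕ, ⨆ _ : 1 ≤ p.1 ∧ p.1 ≤ p.2 ∧ p.2 ≤ M + N - 1,
    Isub q M N ext lvl pl p.1 p.2

def OscElt (q : ℂ) (M N : ℕ) (ext : Bool) (lvl : ℕ) (pl : Bool) (m n k u : ℤ) :
    ALG q M N ext lvl :=
  let X : ℕ → ℤ → ALG q M N ext lvl := if pl then XpA q M N ext lvl else XmA q M N ext lvl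
  oscOf q M X m n k u + oscOf q M X m u k n

def Osub (q : ℂ) (M N : ℕ) (ext : Bool) (lvl : ℕ) (pl : Bool) :
    Submodule ℂ (ALG q M N ext lvl) :=
  Submodule.span ℂ
    (Set.range fun p : ℤ × ℤ × ℤ × ℤ => OscElt q M N ext lvl pl p.1 p.2.1 p.2.2.1 p.2.2.2)

/-- the sign `(−1)^{(p(α_k)+p(α_u))·p(α_i)}`. -/
def gsgn (M : ℕ) (k u i : ℕ) : ℂ :=
  if ((k = M ∧ ¬u = M) ∨ (¬k = M ∧ u = M)) ∧ i = M then -1 else 1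

/-! ### Highest weights and the associated eigenvalue sequences -/

/-- `Q·f = 0` for a bilateral formal series `f`. -/
def annih (Q : Polynomial ℂ) (f : ℤ → ℂ) : Prop :=
  ∀ n : ℤ, ∑ s ∈ Finset.range (Q.natDegree + 1), Q.coeff s * f (n - s) = 0

/-- an element of `R_{M,N}`: a highest weight `(P̲, f, c)`. -/
structure HW (q : ℂ) (M N : ℕ) : Type where
  P : ℕ → Polynomial ℂ
  f : ℤ → ℂ
  c : ℂ
  P_const : ∀ i, (P i).coeff 0 = 1
  c_ne : c ≠ 0
  torsion : ∃ Q : Polynomial ℂ, Q ≠ 0 ∧ annih Q f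
  f_zero : f 0 = (c - c⁻¹) / (q - q⁻¹)

def toPS (p : Polynomial ℂ) : PowerSeries ℂ := PowerSeries.mk fun n => p.coeff n

/-- `P(z·u)`. -/
def pscale (u : ℂ) (P : Polynomial ℂ) : Polynomial ℂ := P.comp (Polynomial.C u * Polynomial.X)

/-- the coefficient of `z^n` (`n ≥ 0`) in `q_i^{deg P} P(z q_i⁻¹)/P(z q_i)`,
expanded at `z = 0`. -/
def gammaP (q : ℂ) (M : ℕ) (i : ℕ) (P : Polynomial ℂ) (n : ℤ) : ℂ :=
  if 0 ≤ n then
    qpar q M i ^ P.natDegree *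
      PowerSeries.coeff n.toNat
        (toPS (pscale (qpar q M i)⁻¹ P) * (toPS (pscale (qpar q M i) P))⁻¹)
  else 0

/-- the coefficient of `z^n` (`n ≤ 0`) in `q_i^{deg P} P(z q_i⁻¹)/P(z q_i)`,
expanded at `z = ∞`. -/
def gammaM (q : ℂ) (M : ℕ) (i : ℕ) (P : Polynomial ℂ) (n : ℤ) : ℂ :=
  if n ≤ 0 then
    qpar q M i ^ P.natDegree *
      PowerSeries.coeff (-n).toNat
        (toPS ((pscale (qpar q M i)⁻¹ P).reflect P.natDegree) *
          (toPS ((pscale (qpar q M i) P).reflect P.natDegree))⁻¹)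
  else 0

/-! ### Verma, Weyl and simple modules -/

def vermaRels (q : ℂ) (M N : ℕ) (ext : Bool) (Λ : HW q M N) : Set (ALG q M N ext 3) :=
  {x | ∃ i : ℕ, ∃ n : ℤ, x = XpA q M N ext 3 i n} ∪
  {x | ∃ i : ℕ, ∃ n : ℤ, 1 ≤ i ∧ i ≤ M + N - 1 ∧ i ≠ M ∧
      (x = phiPA q M N ext 3 i n - algebraMap ℂ _ (gammaP q M i (Λ.P i) n) ∨
       x = phiMA q M N ext 3 i n - algebraMap ℂ _ (gammaM q M i (Λ.P i) n))} ∪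
  {x | x = KA q M N ext 3 M - algebraMap ℂ _ Λ.c} ∪
  {x | ∃ n : ℤ, x = phiPA q M N ext 3 M n - phiMA q M N ext 3 M n -
      algebraMap ℂ _ ((q - q⁻¹) * Λ.f n)} ∪
  {x | ext = true ∧ x = K0A q M N ext 3 - 1}

def evenRels (q : ℂ) (M N : ℕ) (ext : Bool) (Λ : HW q M N) : Set (ALG q M N ext 3) :=
  {x | ∃ i : ℕ, 1 ≤ i ∧ i ≤ M + N - 1 ∧ i ≠ M ∧
      x = XmA q M N ext 3 i 0 ^ (1 + (Λ.P i).natDegree)}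

def oddElt (q : ℂ) (M N : ℕ) (ext : Bool) (Q : Polynomial ℂ) (n : ℤ) : ALG q M N ext 3 :=
  ∑ s ∈ Finset.range (Q.natDegree + 1),
    Q.coeff (Q.natDegree - s) • XmA q M N ext 3 M ((s : ℤ) + n)

def oddRels (q : ℂ) (M N : ℕ) (ext : Bool) (Q : Polynomial ℂ) : Set (ALG q M N ext 3) :=
  if M = 1 ∧ N = 1 then {x | ∃ n : ℤ, x = oddElt q M N ext Q n}
  else {oddElt q M N ext Q 0}

def vermaIdeal (q : ℂ) (M N : ℕ) (ext : Bool) (Λ : HW q M N) : Ideal (ALG q M N ext 3) :=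
  Ideal.span (vermaRels q M N ext Λ)

def weylIdeal (q : ℂ) (M N : ℕ) (ext : Bool) (Λ : HW q M N) (Q : Polynomial ℂ) :
    Ideal (ALG q M N ext 3) :=
  Ideal.span (vermaRels q M N ext Λ ∪ evenRels q M N ext Λ ∪ oddRels q M N ext Q)

def uweylIdeal (q : ℂ) (M N : ℕ) (ext : Bool) (Λ : HW q M N) : Ideal (ALG q M N ext 3) :=
  Ideal.span (vermaRels q M N ext Λ ∪ evenRels q M N ext Λ)

/-- the Verma module `M(Λ)`. -/
def VermaMod (q : ℂ) (M N : ℕ) (ext : Bool) (Λ : HW q M N) : Type :=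
  ALG q M N ext 3 ⧸ vermaIdeal q M N ext Λ

/-- the Weyl module `W(Λ; Q)`. -/
def WeylMod (q : ℂ) (M N : ℕ) (ext : Bool) (Λ : HW q M N) (Q : Polynomial ℂ) : Type :=
  ALG q M N ext 3 ⧸ weylIdeal q M N ext Λ Q

/-- the universal Weyl module `W(Λ)`. -/
def UWeylMod (q : ℂ) (M N : ℕ) (ext : Bool) (Λ : HW q M N) : Type :=
  ALG q M N ext 3 ⧸ uweylIdeal q M N ext Λ

instance (q : ℂ) (M N : ℕ) (ext : Bool) (Λ : HW q M N) : AddCommGroup (VermaMod q M N ext Λ) :=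
  inferInstanceAs (AddCommGroup (ALG q M N ext 3 ⧸ vermaIdeal q M N ext Λ))
instance (q : ℂ) (M N : ℕ) (ext : Bool) (Λ : HW q M N) :
    Module (ALG q M N ext 3) (VermaMod q M N ext Λ) :=
  inferInstanceAs (Module (ALG q M N ext 3) (ALG q M N ext 3 ⧸ vermaIdeal q M N ext Λ))
instance (q : ℂ) (M N : ℕ) (ext : Bool) (Λ : HW q M N) : Module ℂ (VermaMod q M N ext Λ) :=
  inferInstanceAs (Module ℂ (ALG q M N ext 3 ⧸ vermaIdeal q M N ext Λ))
instance (q : ℂ) (M N : ℕ) (ext : Bool) (Λ : HW q M N) :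
    IsScalarTower ℂ (ALG q M N ext 3) (VermaMod q M N ext Λ) :=
  inferInstanceAs (IsScalarTower ℂ (ALG q M N ext 3) (ALG q M N ext 3 ⧸ vermaIdeal q M N ext Λ))

instance (q : ℂ) (M N : ℕ) (ext : Bool) (Λ : HW q M N) (Q : Polynomial ℂ) :
    AddCommGroup (WeylMod q M N ext Λ Q) :=
  inferInstanceAs (AddCommGroup (ALG q M N ext 3 ⧸ weylIdeal q M N ext Λ Q))
instance (q : ℂ) (M N : ℕ) (ext : Bool) (Λ : HW q M N) (Q : Polynomial ℂ) :
    Module (ALG q M N ext 3) (WeylMod q M N ext Λ Q) :=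
  inferInstanceAs (Module (ALG q M N ext 3) (ALG q M N ext 3 ⧸ weylIdeal q M N ext Λ Q))
instance (q : ℂ) (M N : ℕ) (ext : Bool) (Λ : HW q M N) (Q : Polynomial ℂ) :
    Module ℂ (WeylMod q M N ext Λ Q) :=
  inferInstanceAs (Module ℂ (ALG q M N ext 3 ⧸ weylIdeal q M N ext Λ Q))
instance (q : ℂ) (M N : ℕ) (ext : Bool) (Λ : HW q M N) (Q : Polynomial ℂ) :
    IsScalarTower ℂ (ALG q M N ext 3) (WeylMod q M N ext Λ Q) :=
  inferInstanceAs
    (IsScalarTower ℂ (ALG q M N ext 3) (ALG q M N ext 3 ⧸ weylIdeal q M N ext Λ Q))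

instance (q : ℂ) (M N : ℕ) (ext : Bool) (Λ : HW q M N) : AddCommGroup (UWeylMod q M N ext Λ) :=
  inferInstanceAs (AddCommGroup (ALG q M N ext 3 ⧸ uweylIdeal q M N ext Λ))
instance (q : ℂ) (M N : ℕ) (ext : Bool) (Λ : HW q M N) :
    Module (ALG q M N ext 3) (UWeylMod q M N ext Λ) :=
  inferInstanceAs (Module (ALG q M N ext 3) (ALG q M N ext 3 ⧸ uweylIdeal q M N ext Λ))
instance (q : ℂ) (M N : ℕ) (ext : Bool) (Λ : HW q M N) : Module ℂ (UWeylMod q M N ext Λ) :=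
  inferInstanceAs (Module ℂ (ALG q M N ext 3 ⧸ uweylIdeal q M N ext Λ))
instance (q : ℂ) (M N : ℕ) (ext : Bool) (Λ : HW q M N) :
    IsScalarTower ℂ (ALG q M N ext 3) (UWeylMod q M N ext Λ) :=
  inferInstanceAs (IsScalarTower ℂ (ALG q M N ext 3) (ALG q M N ext 3 ⧸ uweylIdeal q M N ext Λ))

/-- the highest weight vector (image of `1`). -/
def vgen (q : ℂ) (M N : ℕ) (Λ : HW q M N) : VermaMod q M N true Λ :=
  Submodule.Quotient.mk 1

/-- the sum of all submodules not containing the highest weight vector (the unique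
maximal submodule of the Verma module). -/
def radV (q : ℂ) (M N : ℕ) (Λ : HW q M N) :
    Submodule (ALG q M N true 3) (VermaMod q M N true Λ) :=
  sSup {p | vgen q M N Λ ∉ p}

/-- the simple quotient `S'(Λ)`. -/
def SimpMod (q : ℂ) (M N : ℕ) (Λ : HW q M N) : Type :=
  VermaMod q M N true Λ ⧸ radV q M N Λ

instance (q : ℂ) (M N : ℕ) (Λ : HW q M N) : AddCommGroup (SimpMod q M N Λ) :=
  inferInstanceAs (AddCommGroup (VermaMod q M N true Λ ⧸ radV q M N Λ))
instance (q : ℂ) (M N : ℕ) (Λ : HW q M N) :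
    Module (ALG q M N true 3) (SimpMod q M N Λ) :=
  inferInstanceAs (Module (ALG q M N true 3) (VermaMod q M N true Λ ⧸ radV q M N Λ))
instance (q : ℂ) (M N : ℕ) (Λ : HW q M N) : Module ℂ (SimpMod q M N Λ) :=
  inferInstanceAs (Module ℂ (VermaMod q M N true Λ ⧸ radV q M N Λ))
instance (q : ℂ) (M N : ℕ) (Λ : HW q M N) :
    IsScalarTower ℂ (ALG q M N true 3) (SimpMod q M N Λ) :=
  inferInstanceAs (IsScalarTower ℂ (ALG q M N true 3) (VermaMod q M N true Λ ⧸ radV q M N Λ))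

/-! ### Weight spaces -/

/-- `K_i` for `0 ≤ i`, with `K₀` at `i = 0`. -/
def Kgen (q : ℂ) (M N : ℕ) (ext : Bool) (lvl : ℕ) (i : ℕ) : ALG q M N ext lvl :=
  if i = 0 then K0A q M N ext lvl else KA q M N ext lvl i

/-- the `μ`-weight space of a module. -/
def wtSp (q : ℂ) (M N : ℕ) (ext : Bool) {W : Type} [AddCommGroup W] [Module ℂ W]
    [Module (ALG q M N ext 3) W] [IsScalarTower ℂ (ALG q M N ext 3) W] (μ : ℕ → ℂ) :
    Submodule ℂ W where
  carrier := {w | ∀ i < M + N, Kgen q M N ext 3 i • w = μ i • w}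
  add_mem' := by
    intro a b ha hb i hi
    rw [smul_add, ha i hi, hb i hi, smul_add]
  zero_mem' := by
    intro i hi
    rw [smul_zero, smul_zero]
  smul_mem' := by
    intro c w hw i hi
    have h1 : Kgen q M N ext 3 i • (c • w) = c • (Kgen q M N ext 3 i • w) := by
      rw [← algebraMap_smul (ALG q M N ext 3) c w, ← mul_smul, ← Algebra.commutes, mul_smul,
        algebraMap_smul]
    rw [h1, hw i hi, smul_comm]

/-- the character `λ_Λ`. -/
def lamF (q : ℂ) (M N : ℕ) (Λ : HW q M N) : ℕ → ℂ :=
  fun i => if i = 0 then 1 else if i = M then Λ.c else qpar q M i ^ (Λ.P i).natDegree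

/-- the character `α_j`. -/
def alF (q : ℂ) (M : ℕ) (j : ℕ) : ℕ → ℂ :=
  fun i => if i = 0 then (if j = 1 then q else 1) else q ^ cc M j i

/-! ### The generators of `U` inside `U'` -/

def UGenSet (q : ℂ) (M N : ℕ) : Set (ALG q M N true 3) :=
  {x | (∃ i : ℕ, ∃ n : ℤ, x = XpA q M N true 3 i n) ∨
    (∃ i : ℕ, ∃ n : ℤ, x = XmA q M N true 3 i n) ∨
    (∃ i : ℕ, x = KA q M N true 3 i) ∨ (∃ i : ℕ, x = KiA q M N true 3 i) ∨
    ∃ i : ℕ, ∃ s : ℤ, x = HA q M N true 3 i s}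

/-! ### One-sided presentations (for `U^±`) -/

def XgF (M N : ℕ) (i : ℕ) (n : ℤ) : FreeAlgebra ℂ (Idx M N × ℤ) :=
  if h : 1 ≤ i ∧ i ≤ M + N - 1 then FreeAlgebra.ι ℂ ((⟨i, h⟩, n) : Idx M N × ℤ) else 0

inductive rel1 (q : ℂ) (M N : ℕ) (pl : Bool) :
    FreeAlgebra ℂ (Idx M N × ℤ) → FreeAlgebra ℂ (Idx M N × ℤ) → Prop
  | comm0 (i j : Idx M N) (m n : ℤ) (h : cc M i.1 j.1 = 0) :
      rel1 q M N pl
        (FreeAlgebra.ι ℂ ((i, m) : Idx M N × ℤ) * FreeAlgebra.ι ℂ ((j, n) : Idx M N × ℤ) -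
          sgn M i.1 j.1 •
            (FreeAlgebra.ι ℂ ((j, n) : Idx M N × ℤ) * FreeAlgebra.ι ℂ ((i, m) : Idx M N × ℤ))) 0
  | deg2 (i j : Idx M N) (m n : ℤ) (h : cc M i.1 j.1 ≠ 0) :
      rel1 q M N pl
        (FreeAlgebra.ι ℂ ((i, m + 1) : Idx M N × ℤ) * FreeAlgebra.ι ℂ ((j, n) : Idx M N × ℤ) -
          (q ^ (if pl then cc M i.1 j.1 else -cc M i.1 j.1)) •
            (FreeAlgebra.ι ℂ ((j, n) : Idx M N × ℤ) *
              FreeAlgebra.ι ℂ ((i, m + 1) : Idx M N × ℤ)))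
        ((q ^ (if pl then cc M i.1 j.1 else -cc M i.1 j.1)) •
            (FreeAlgebra.ι ℂ ((i, m) : Idx M N × ℤ) *
              FreeAlgebra.ι ℂ ((j, n + 1) : Idx M N × ℤ)) -
          FreeAlgebra.ι ℂ ((j, n + 1) : Idx M N × ℤ) * FreeAlgebra.ι ℂ ((i, m) : Idx M N × ℤ))
  | serre (i j : Idx M N) (m n k : ℤ) (h : cc M i.1 j.1 = 1 ∨ cc M i.1 j.1 = -1)
      (hi : i.1 ≠ M) :
      rel1 q M N pl
        (brF q (FreeAlgebra.ι ℂ ((i, m) : Idx M N × ℤ))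
            (brF q⁻¹ (FreeAlgebra.ι ℂ ((i, n) : Idx M N × ℤ))
              (FreeAlgebra.ι ℂ ((j, k) : Idx M N × ℤ))) +
          brF q (FreeAlgebra.ι ℂ ((i, n) : Idx M N × ℤ))
            (brF q⁻¹ (FreeAlgebra.ι ℂ ((i, m) : Idx M N × ℤ))
              (FreeAlgebra.ι ℂ ((j, k) : Idx M N × ℤ)))) 0
  | osc (m n k u : ℤ) (hM : 1 < M) (hN : 1 < N) :
      rel1 q M N pl (oscOf q M (XgF M N) m n k u + oscOf q M (XgF M N) m u k n) 0

end QAS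

namespace TD
open QAS
open scoped TensorProduct

/-! ### Rational-function identities, stated in a module over a commutative ring -/

section abstractIds
variable {R D : Type} [CommRing R] [AddCommGroup D] [Module R D]

theorem serreJ_abs (p s w z1 z2 : R) (hp : p * s = 1) (T1 T2 T3 T1' T2' T3' : D)
    (h1 : (w - p * z2) • T2 = (p * w - z2) • T1)
    (h2 : (w - p * z1) • T3 = (p * w - z1) • T2)
    (h3 : (w - p * z1) • T2' = (p * w - z1) • T1')
    (h4 : (w - p * z2) • T3' = (p * w - z2) • T2')
    (h5 : (z1 - s ^ 2 * z2) • T1 = (s ^ 2 * z1 - z2) • T1') :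
    (w - p * z1) • (w - p * z2) •
      (T1 - (p + s) • T2 + T3 + (T1' - (p + s) • T2' + T3')) = 0 := by
  linear_combination (norm := skip) (w - p * z2) • h2 + (p * w - z1) • h1
    - ((p + s) * (w - p * z1)) • h1 + (w - p * z1) • h4 + (p * w - z2) • h3
    - ((p + s) * (w - p * z2)) • h3 - ((s - p) * p ^ 2 * w) • h5
  match_scalars <;> grind

theorem serreI_abs (p s z1 z2 w : R) (hp : p * s = 1) (U1 U2 U3 U4 S T : D)
    (h1 : (z1 - s ^ 2 * z2) • U1 = (s ^ 2 * z1 - z2) • U2)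
    (h2 : (z1 - p * w) • U2 = (p * z1 - w) • S)
    (h3 : (z1 - p * w) • U3 = (p * z1 - w) • U4)
    (h4 : (z1 - s ^ 2 * z2) • U4 = (s ^ 2 * z1 - z2) • T)
    (h5 : (z2 - p * w) • S = (p * z2 - w) • T) :
    (z1 - p * w) • (z1 - s ^ 2 * z2) •
      (U1 + U2 - (p + s) • (U3 + S) + U4 + T) = 0 := by
  linear_combination (norm := skip) (z1 - p * w) • h1 + (s ^ 2 * z1 - z2) • h2
    + (z1 - s ^ 2 * z2) • h2 - ((p + s) * (z1 - s ^ 2 * z2)) • h3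
    - ((p + s) * (p * z1 - w)) • h4 + (z1 - p * w) • h4
    + ((1 + s ^ 2) * (s - p) * z1) • h5
  match_scalars <;> grind

theorem oscA_abs (p s x z w y : R) (hp : p * s = 1)
    (V1 V1a V2 V2a V3 V4 V5 V6 W1 W2 W3 W4 : D)
    (h1 : (x - p * z) • V1 = (p * x - z) • V1a) (h1a : (x - p * w) • V1a = (p * x - w) • W1)
    (h2 : (x - p * w) • V2 = (p * x - w) • V2a) (h2a : (x - p * z) • V2a = (p * x - z) • W2)
    (h3 : (x - p * w) • V3 = (p * x - w) • W3)
    (h4 : (x - p * z) • V4 = -((p * x - z) • W3))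
    (h5 : (x - p * z) • V5 = -((p * x - z) • W4))
    (h6 : (x - p * w) • V6 = (p * x - w) • W4)
    (g1 : (z - s * y) • W1 = (s * z - y) • W3)
    (g2 : (w - s * y) • W4 = (s * w - y) • W1)
    (g3 : -((z - s * y) • W4) = (s * z - y) • W2)
    (g4 : (w - s * y) • W2 = -((s * w - y) • W3)) :
    (x - p * z) • (x - p * w) •
      (V1 + V2 - (p + s) • (V1a + V2a) + V3 + V4 + V5 + V6 + W2 + W1) = 0 := by
  linear_combination (norm := skip) (x - p * w) • h1 + (p * x - z) • h1a
    + (x - p * z) • h2 + (p * x - w) • h2a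
    - ((p + s) * (x - p * z)) • h1a - ((p + s) * (x - p * w)) • h2a
    + (x - p * z) • h3 + (x - p * w) • h4 + (x - p * w) • h5 + (x - p * z) • h6
    + ((p ^ 2 - 1) * x * p) • g1 + ((p ^ 2 - 1) * x) • g2 + ((p ^ 2 - 1) * x * p) • g4
    + ((p ^ 2 - 1) * x) • g3
  match_scalars <;> grind

theorem oscB_abs (p s z x y w : R) (hp : p * s = 1)
    (V1 V2 V3 V4 V5 V5a V6 V7 V7a A B C F : D)
    (h1 : (z - s * y) • V1 = (s * z - y) • A)
    (h2 : (z - p * x) • V2 = (p * z - x) • V1)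
    (h3 : (z - p * x) • V3 = (p * z - x) • A)
    (h4 : (z - s * y) • V4 = (s * z - y) • B)
    (h5 : (z - p * x) • V5 = (p * z - x) • V5a) (h5a : (z - s * y) • V5a = (s * z - y) • C)
    (h6 : (z - p * x) • V6 = (p * z - x) • B)
    (h7 : (z - s * y) • V7 = (s * z - y) • V7a) (h7a : (z - p * x) • V7a = (p * z - x) • F)
    (g1 : (x - p * w) • C = (p * x - w) • B)
    (g2 : (w - s * y) • C = (s * w - y) • A)
    (g3 : (x - p * w) • A = (p * x - w) • F)
    (g4 : (w - s * y) • B = (s * w - y) • F) :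
    (z - p * x) • (z - s * y) •
      (-V1 + C + (p + s) • (V2 - B) - V3 + F + V4 - V5 + V6 - V7) = 0 := by
  linear_combination (norm := skip) (-(z - p * x)) • h1 + ((p + s) * (z - s * y)) • h2
    + ((p + s) * (p * z - x)) • h1 - (z - s * y) • h3 + (z - p * x) • h4
    - (z - s * y) • h5 - (p * z - x) • h5a + (z - s * y) • h6 - (z - p * x) • h7
    - (s * z - y) • h7a + ((s - p) * z) • g1 + ((s - p) * z * p) • g2
    - ((s - p) * z * s) • g3 - ((s - p) * z ) • g4
  match_scalars <;> grind
end abstractIds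

/-! ### Families indexed by `ℤ⁴` and the shift action -/

abbrev G4 := Fin 4 → ℤ

def Dst (A : Type) := G4 → A

section shift
variable {A : Type} [Ring A] [Algebra ℂ A]

instance : AddCommGroup (Dst A) := inferInstanceAs (AddCommGroup (G4 → A))
instance : Module ℂ (Dst A) := inferInstanceAs (Module ℂ (G4 → A))

abbrev SR := AddMonoidAlgebra ℂ G4

def shiftHom (A : Type) [Ring A] [Algebra ℂ A] :
    Multiplicative G4 →* Module.End ℂ (Dst A) where
  toFun v :=
    { toFun := fun f g => f (g + v.toAdd)
      map_add' := fun _ _ => rfl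
      map_smul' := fun _ _ => rfl }
  map_one' := by ext f; funext g; show f (g + 0) = f g; rw [add_zero]
  map_mul' := by
    intro v w; ext f; funext g
    show f (g + (v.toAdd + w.toAdd)) = f (g + v.toAdd + w.toAdd)
    rw [add_assoc]

def shiftAlg (A : Type) [Ring A] [Algebra ℂ A] : SR →ₐ[ℂ] Module.End ℂ (Dst A) :=
  AddMonoidAlgebra.lift ℂ _ _ (shiftHom A)

instance : Module SR (Dst A) := Module.compHom (Dst A) (shiftAlg A).toRingHom

def zz (a : Fin 4) : SR := AddMonoidAlgebra.single (Pi.single a 1) 1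
def sc (d : ℂ) : SR := algebraMap ℂ SR d

theorem zz_smul (a : Fin 4) (f : Dst A) (g : G4) : (zz a • f) g = f (g + Pi.single a 1) := by
  show (shiftAlg A (zz a)) f g = _
  rw [zz, shiftAlg, AddMonoidAlgebra.lift_single]
  simp [shiftHom]
  rfl

theorem sc_smul (d : ℂ) (f : Dst A) : sc d • f = d • f := by
  show (shiftAlg A (sc d)) f = _
  rw [sc, AlgHom.commutes]; rfl

theorem Dst.add_apply (f f' : Dst A) (g : G4) : (f + f') g = f g + f' g := rfl
theorem Dst.sub_apply (f f' : Dst A) (g : G4) : (f - f') g = f g - f' g := rfl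
theorem Dst.neg_apply (f : Dst A) (g : G4) : (-f) g = - f g := rfl
theorem Dst.smul_apply (d : ℂ) (f : Dst A) (g : G4) : (d • f) g = d • f g := rfl
theorem Dst.zero_apply (g : G4) : (0 : Dst A) g = 0 := rfl

/-- exchange relation between two families -/
def Exch (d : ℂ) (P Q : ℤ → A) : Prop := ∀ m n : ℤ,
  P (m + 1) * Q n - d • (P m * Q (n + 1)) = d • (Q n * P (m + 1)) - Q (n + 1) * P m

/-- the word in four families -/
def Wd (X : Fin 4 → ℤ → A) (l : List (Fin 4)) : Dst A := fun g => (l.map fun i => X i (g i)).prod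

theorem Wd_shift (X : Fin 4 → ℤ → A) (a : Fin 4) (l : List (Fin 4)) (h : a ∉ l) (g : G4) :
    (l.map fun i => X i ((g + Pi.single a 1 : G4) i)).prod = (l.map fun i => X i (g i)).prod := by
  congr 1
  apply List.map_congr_left
  intro i hi
  have : i ≠ a := fun h' => h (h' ▸ hi)
  simp [this]

theorem Wd_ctx (X : Fin 4 → ℤ → A) (d : ℂ) (a b : Fin 4) (hab : a ≠ b)
    (h : Exch d (X a) (X b)) (l r : List (Fin 4)) (h1 : a ∉ l) (h2 : b ∉ l) (h3 : a ∉ r)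
    (h4 : b ∉ r) :
    (zz a - sc d * zz b) • Wd X (l ++ a :: b :: r) =
      (sc d * zz a - zz b) • Wd X (l ++ b :: a :: r) := by
  funext g
  simp only [sub_smul, mul_smul, sc_smul, Dst.sub_apply, Dst.smul_apply, zz_smul]
  simp only [Wd, List.map_append, List.map_cons, List.prod_append, List.prod_cons,
    Wd_shift _ _ _ h1, Wd_shift _ _ _ h2, Wd_shift _ _ _ h3, Wd_shift _ _ _ h4]
  have := h (g a) (g b)
  have e1 : (g + Pi.single a 1 : G4) a = g a + 1 := by simp
  have e2 : (g + Pi.single a 1 : G4) b = g b := by simp [hab.symm]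
  have e3 : (g + Pi.single b 1 : G4) b = g b + 1 := by simp
  have e4 : (g + Pi.single b 1 : G4) a = g a := by simp [hab]
  rw [e1, e2, e3, e4]
  set L := (l.map fun i => X i (g i)).prod
  set R := (r.map fun i => X i (g i)).prod
  have h5 := congrArg (fun x => L * x * R) this
  simpa only [mul_sub, sub_mul, mul_smul_comm, smul_mul_assoc, mul_assoc] using h5

theorem Wd_comm (X : Fin 4 → ℤ → A) (a b : Fin 4) (s : ℂ)
    (h : ∀ m n, X a m * X b n = s • (X b n * X a m)) (l r : List (Fin 4)) :
    Wd X (l ++ a :: b :: r) = s • Wd X (l ++ b :: a :: r) := by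
  funext g
  simp only [Dst.smul_apply]
  simp only [Wd, List.map_append, List.map_cons, List.prod_append, List.prod_cons]
  rw [← mul_assoc (X a _), h, ← mul_assoc (X b _), smul_mul_assoc, mul_smul_comm]

/-- bounded below / above in the zeroth coordinate -/
def Bdd (up : Bool) (f : Dst A) : Prop :=
  ∃ B : ℤ, ∀ g : G4, (if up then B < g 0 else g 0 < B) → f g = 0

theorem Bdd.add {up} {f f' : Dst A} (h : Bdd up f) (h' : Bdd up f') : Bdd up (f + f') := by
  obtain ⟨B, hB⟩ := h
  obtain ⟨B', hB'⟩ := h'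
  cases up
  · refine ⟨min B B', fun g hg => ?_⟩
    simp at hg
    rw [Dst.add_apply, hB g (by simp [hg.1]), hB' g (by simp [hg.2]), add_zero]
  · refine ⟨max B B', fun g hg => ?_⟩
    simp at hg
    rw [Dst.add_apply, hB g (by simp [hg.1]), hB' g (by simp [hg.2]), add_zero]

theorem Bdd.smul {up} {f : Dst A} (d : ℂ) (h : Bdd up f) : Bdd up (d • f) := by
  obtain ⟨B, hB⟩ := h
  exact ⟨B, fun g hg => by rw [Dst.smul_apply, hB g hg, smul_zero]⟩

theorem Bdd.neg {up} {f : Dst A} (h : Bdd up f) : Bdd up (-f) := by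
  have := h.smul (-1); simpa using this

theorem Bdd.sub {up} {f f' : Dst A} (h : Bdd up f) (h' : Bdd up f') : Bdd up (f - f') := by
  rw [sub_eq_add_neg]; exact h.add h'.neg

theorem Bdd.zz {up} {f : Dst A} (h : Bdd up f) (a : Fin 4) : Bdd up (zz a • f) := by
  obtain ⟨B, hB⟩ := h
  cases up
  · refine ⟨B - 1, fun g hg => ?_⟩
    rw [zz_smul]; apply hB
    simp at hg ⊢
    by_cases ha : a = 0
    · subst ha; simp; omega
    · simp [Pi.single_apply, Ne.symm ha]; omega
  · refine ⟨B, fun g hg => ?_⟩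
    rw [zz_smul]; apply hB
    simp at hg ⊢
    by_cases ha : a = 0
    · subst ha; simp; omega
    · simp [Pi.single_apply, Ne.symm ha]; omega

theorem Bdd.fac {up} {f : Dst A} (h : Bdd up f) (d : ℂ) (a : Fin 4) :
    Bdd up ((TD.zz 0 - sc d * TD.zz a) • f) := by
  rw [sub_smul, mul_smul, sc_smul]
  exact (h.zz 0).sub ((h.zz a).smul d)

theorem Wd_bdd (up : Bool) (X : Fin 4 → ℤ → A) (l : List (Fin 4)) (h0 : 0 ∈ l)
    (h : ∀ n : ℤ, (if up then 0 < n else n < 0) → X 0 n = 0) : Bdd up (Wd X l) := by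
  refine ⟨0, fun g hg => ?_⟩
  rw [Wd]
  apply List.prod_eq_zero
  rw [List.mem_map]
  exact ⟨0, h0, h _ hg⟩

theorem cancel_fac {up} (d : ℂ) (hd : d ≠ 0) (a : Fin 4) (ha : a ≠ 0) (f : Dst A) (hf : Bdd up f)
    (h : (zz 0 - sc d * zz a) • f = 0) : f = 0 := by
  obtain ⟨B, hB⟩ := hf
  have key : ∀ g : G4, f (g + Pi.single 0 1) = d • f (g + Pi.single a 1) := by
    intro g
    have := congrFun h g
    rw [sub_smul, mul_smul, sc_smul] at this
    rw [Dst.sub_apply, Dst.smul_apply, zz_smul, zz_smul, Dst.zero_apply] at this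
    exact sub_eq_zero.mp this
  cases up
  · have : ∀ (k : ℕ) (g : G4), g 0 < B + k → f g = 0 := by
      intro k
      induction k with
      | zero => intro g hg; exact hB g (by simpa using hg)
      | succ k ih =>
        intro g hg
        have := key (g - Pi.single 0 1)
        rw [sub_add_cancel] at this
        rw [this, ih, smul_zero]
        simp [Pi.single_apply, Ne.symm ha]; push_cast at hg; omega
    funext g
    exact this (g 0 - B + 1).toNat g (by have := Int.self_le_toNat (g 0 - B + 1); omega)
  · have : ∀ (k : ℕ) (g : G4), B - k < g 0 → f g = 0 := by
      intro k
      induction k with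
      | zero => intro g hg; exact hB g (by simpa using hg)
      | succ k ih =>
        intro g hg
        have := key (g - Pi.single a 1)
        rw [sub_add_cancel, ih] at this
        · exact (smul_eq_zero.mp this.symm).resolve_left hd
        · simp [Pi.single_apply, Ne.symm ha]; push_cast at hg; omega
    funext g
    exact this (B - g 0 + 1).toNat g (by have := Int.self_le_toNat (B - g 0 + 1); omega)

end shift

end TD

namespace TD
open QAS
open scoped TensorProduct

section contr
variable {A : Type} [Ring A] [Algebra ℂ A]

/-- bounded family: vanishes for negative (up = false) or positive (up = true) indices -/
def BF (up : Bool) (φ : ℤ → A) : Prop := ∀ n : ℤ, (if up then 0 < n else n < 0) → φ n = 0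

theorem phi_comm {up : Bool} (φ x : ℤ → A) (hb : BF up φ) (h : Exch 1 φ x) (m n : ℤ) :
    φ m * x n = x n * φ m := by
  let X : Fin 4 → ℤ → A := ![φ, x, x, x]
  have h1 := Wd_ctx X 1 0 1 (by decide) h [] [] (by decide) (by decide) (by decide) (by decide)
  have : Wd X [0, 1] - Wd X [1, 0] = 0 := by
    apply cancel_fac (up := up) 1 one_ne_zero 1 (by decide)
    · exact (Wd_bdd up X _ (by decide) hb).sub (Wd_bdd up X _ (by decide) hb)
    · rw [smul_sub, sub_eq_zero]
      have e : sc 1 = 1 := map_one _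
      rw [e, one_mul, one_mul] at h1
      rw [e, one_mul]
      exact h1
  have := congrFun this ![m, n, 0, 0]
  simp [Dst.sub_apply, Wd, X, Dst.zero_apply] at this
  exact sub_eq_zero.mp this

theorem sc_mul (p s : ℂ) : sc (p * s) = sc p * sc s := map_mul _ _ _

theorem serreJ {up : Bool} (φ x : ℤ → A) (p s : ℂ) (hp : p * s = 1) (hb : BF up φ)
    (h1 : Exch p φ x) (h2 : Exch (s ^ 2) x x) (l m n : ℤ) :
    x m * x n * φ l - (p + s) • (x m * φ l * x n) + φ l * x m * x n +
      (x n * x m * φ l - (p + s) • (x n * φ l * x m) + φ l * x n * x m) = 0 := by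
  let X : Fin 4 → ℤ → A := ![φ, x, x, x]
  have hp0 : p ≠ 0 := left_ne_zero_of_mul_eq_one hp
  have e2 : sc (s ^ 2) = sc s ^ 2 := map_pow _ _ _
  have e3 : sc (p + s) = sc p + sc s := map_add _ _ _
  have key := serreJ_abs (sc p) (sc s) (zz 0) (zz 1) (zz 2)
    (by rw [← sc_mul, hp]; exact map_one _)
    (Wd X [1, 2, 0]) (Wd X [1, 0, 2]) (Wd X [0, 1, 2])
    (Wd X [2, 1, 0]) (Wd X [2, 0, 1]) (Wd X [0, 2, 1])
    (Wd_ctx X p 0 2 (by decide) h1 [1] [] (by decide) (by decide) (by decide) (by decide))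
    (Wd_ctx X p 0 1 (by decide) h1 [] [2] (by decide) (by decide) (by decide) (by decide))
    (Wd_ctx X p 0 1 (by decide) h1 [2] [] (by decide) (by decide) (by decide) (by decide))
    (Wd_ctx X p 0 2 (by decide) h1 [] [1] (by decide) (by decide) (by decide) (by decide))
    (by rw [← e2]; exact
      (Wd_ctx X (s ^ 2) 1 2 (by decide) h2 [] [0] (by decide) (by decide) (by decide) (by decide)))
  have B := fun l h => Wd_bdd up X l h hb
  rw [← e3, sc_smul, sc_smul] at key
  have hB : Bdd up (Wd X [1, 2, 0] - (p + s) • Wd X [1, 0, 2] + Wd X [0, 1, 2] +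
      (Wd X [2, 1, 0] - (p + s) • Wd X [2, 0, 1] + Wd X [0, 2, 1])) :=
    ((((B _ (by decide)).sub ((B _ (by decide)).smul _)).add (B _ (by decide))).add
     (((B _ (by decide)).sub ((B _ (by decide)).smul _)).add (B _ (by decide))))
  have key := cancel_fac p hp0 2 (by decide) _ hB
    (cancel_fac p hp0 1 (by decide) _ (hB.fac _ _) key)
  have := congrFun key ![l, m, n, 0]
  simpa [Dst.sub_apply, Dst.add_apply, Dst.smul_apply, Wd, X, Dst.zero_apply, mul_assoc]
    using this

theorem serreI {up : Bool} (φ x y : ℤ → A) (p s : ℂ) (hp : p * s = 1) (hb : BF up φ)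
    (h1 : Exch (s ^ 2) φ x) (h2 : Exch p φ y) (h3 : Exch p x y) (l m n : ℤ) :
    φ l * x m * y n + x m * φ l * y n - (p + s) • (φ l * y n * x m + x m * y n * φ l)
      + y n * φ l * x m + y n * x m * φ l = 0 := by
  let X : Fin 4 → ℤ → A := ![φ, x, y, x]
  have hp0 : p ≠ 0 := left_ne_zero_of_mul_eq_one hp
  have hs0 : s ≠ 0 := right_ne_zero_of_mul_eq_one hp
  have e2 : sc (s ^ 2) = sc s ^ 2 := map_pow _ _ _
  have e3 : sc (p + s) = sc p + sc s := map_add _ _ _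
  have key := serreI_abs (sc p) (sc s) (zz 0) (zz 1) (zz 2)
    (by rw [← sc_mul, hp]; exact map_one _)
    (Wd X [0, 1, 2]) (Wd X [1, 0, 2]) (Wd X [0, 2, 1])
    (Wd X [2, 0, 1]) (Wd X [1, 2, 0]) (Wd X [2, 1, 0])
    (by rw [← e2]; exact
      (Wd_ctx X (s ^ 2) 0 1 (by decide) h1 [] [2] (by decide) (by decide) (by decide) (by decide)))
    (Wd_ctx X p 0 2 (by decide) h2 [1] [] (by decide) (by decide) (by decide) (by decide))
    (Wd_ctx X p 0 2 (by decide) h2 [] [1] (by decide) (by decide) (by decide) (by decide))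
    (by rw [← e2]; exact
      (Wd_ctx X (s ^ 2) 0 1 (by decide) h1 [2] [] (by decide) (by decide) (by decide) (by decide)))
    (Wd_ctx X p 1 2 (by decide) h3 [] [0] (by decide) (by decide) (by decide) (by decide))
  have B := fun l h => Wd_bdd up X l h hb
  rw [← e3, sc_smul, ← e2] at key
  have hB : Bdd up (Wd X [0, 1, 2] + Wd X [1, 0, 2] - (p + s) • (Wd X [0, 2, 1] + Wd X [1, 2, 0])
      + Wd X [2, 0, 1] + Wd X [2, 1, 0]) :=
    (((((B _ (by decide)).add (B _ (by decide))).sub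
     (((B _ (by decide)).add (B _ (by decide))).smul _)).add (B _ (by decide))).add (B _ (by decide)))
  have key := cancel_fac (s ^ 2) (pow_ne_zero _ hs0) 1 (by decide) _ hB
    (cancel_fac p hp0 2 (by decide) _ (hB.fac _ _) key)
  have := congrFun key ![l, m, n, 0]
  simpa [Dst.sub_apply, Dst.add_apply, Dst.smul_apply, Wd, X, Dst.zero_apply, mul_assoc]
    using this

theorem oscA {up : Bool} (φ b d : ℤ → A) (p s : ℂ) (hp : p * s = 1) (hb : BF up φ)
    (h1 : Exch p φ b) (h2 : ∀ m n, φ m * d n = d n * φ m) (h3 : Exch s b d)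
    (h4 : ∀ m n, b m * b n = - (b n * b m)) (l m n k : ℤ) :
    φ l * b m * d k * b n + φ l * b n * d k * b m
      - (p + s) • (b m * φ l * d k * b n + b n * φ l * d k * b m)
      + d k * b m * φ l * b n + d k * b n * φ l * b m + b n * φ l * b m * d k
      + b m * φ l * b n * d k + b n * d k * b m * φ l + b m * d k * b n * φ l = 0 := by
  let X : Fin 4 → ℤ → A := ![φ, b, b, d]
  have hp0 : p ≠ 0 := left_ne_zero_of_mul_eq_one hp
  have e3 : sc (p + s) = sc p + sc s := map_add _ _ _
  have c03 := fun L R => (Wd_comm X 0 3 1 (by simpa [X] using h2) L R).trans (one_smul _ _)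
  have c12 := fun L R => (Wd_comm X 1 2 (-1) (by simpa [X] using h4) L R).trans (neg_one_smul _ _)
  have s01 := fun L R a1 a2 a3 a4 => Wd_ctx X p 0 1 (by decide) h1 L R a1 a2 a3 a4
  have s02 := fun L R a1 a2 a3 a4 => Wd_ctx X p 0 2 (by decide) h1 L R a1 a2 a3 a4
  have s13 := fun L R a1 a2 a3 a4 => Wd_ctx X s 1 3 (by decide) h3 L R a1 a2 a3 a4
  have s23 := fun L R a1 a2 a3 a4 => Wd_ctx X s 2 3 (by decide) h3 L R a1 a2 a3 a4
  have i1 : Wd X [1, 0, 3, 2] = Wd X [1, 3, 0, 2] := c03 [1] [2]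
  have i2 : Wd X [2, 0, 3, 1] = Wd X [2, 3, 0, 1] := c03 [2] [1]
  have i3 : Wd X [3, 2, 1, 0] = - Wd X [3, 1, 2, 0] := by
    rw [show Wd X [3, 1, 2, 0] = - Wd X [3, 2, 1, 0] from c12 [3] [0], neg_neg]
  have i4 : Wd X [2, 1, 0, 3] = - Wd X [1, 2, 3, 0] := by
    rw [show Wd X [2, 1, 0, 3] = Wd X [2, 1, 3, 0] from c03 [2, 1] [],
      show Wd X [1, 2, 3, 0] = - Wd X [2, 1, 3, 0] from c12 [] [3, 0], neg_neg]
  have i5 : Wd X [1, 2, 0, 3] = Wd X [1, 2, 3, 0] := c03 [1, 2] []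
  have i6 : - Wd X [1, 2, 3, 0] = Wd X [2, 1, 3, 0] := by
    rw [show Wd X [1, 2, 3, 0] = - Wd X [2, 1, 3, 0] from c12 [] [3, 0], neg_neg]
  have key := oscA_abs (sc p) (sc s) (zz 0) (zz 1) (zz 2) (zz 3)
    (by rw [← sc_mul, hp]; exact map_one _)
    (Wd X [0, 1, 3, 2]) (Wd X [1, 0, 3, 2]) (Wd X [0, 2, 3, 1]) (Wd X [2, 0, 3, 1])
    (Wd X [3, 1, 0, 2]) (Wd X [3, 2, 0, 1]) (Wd X [2, 0, 1, 3]) (Wd X [1, 0, 2, 3])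
    (Wd X [1, 3, 2, 0]) (Wd X [2, 3, 1, 0]) (Wd X [3, 1, 2, 0]) (Wd X [1, 2, 3, 0])
    (s01 [] [3, 2] (by decide) (by decide) (by decide) (by decide))
    (by rw [i1]; exact s02 [1, 3] [] (by decide) (by decide) (by decide) (by decide))
    (s02 [] [3, 1] (by decide) (by decide) (by decide) (by decide))
    (by rw [i2]; exact s01 [2, 3] [] (by decide) (by decide) (by decide) (by decide))
    (s02 [3, 1] [] (by decide) (by decide) (by decide) (by decide))
    (by rw [← smul_neg, ← i3]; exact s01 [3, 2] [] (by decide) (by decide) (by decide) (by decide))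
    (by rw [← smul_neg, ← i4]; exact s01 [2] [3] (by decide) (by decide) (by decide) (by decide))
    (by rw [← i5]; exact s02 [1] [3] (by decide) (by decide) (by decide) (by decide))
    (s13 [] [2, 0] (by decide) (by decide) (by decide) (by decide))
    (s23 [1] [0] (by decide) (by decide) (by decide) (by decide))
    (by rw [← smul_neg, i6]; exact s13 [2] [0] (by decide) (by decide) (by decide) (by decide))
    (by rw [← smul_neg, ← i3]; exact s23 [] [1, 0] (by decide) (by decide) (by decide) (by decide))
  have B := fun l h => Wd_bdd up X l h hb
  rw [← e3, sc_smul] at key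
  have hB : Bdd up (Wd X [0, 1, 3, 2] + Wd X [0, 2, 3, 1] -
      (p + s) • (Wd X [1, 0, 3, 2] + Wd X [2, 0, 3, 1]) + Wd X [3, 1, 0, 2] + Wd X [3, 2, 0, 1]
      + Wd X [2, 0, 1, 3] + Wd X [1, 0, 2, 3] + Wd X [2, 3, 1, 0] + Wd X [1, 3, 2, 0]) := by
    repeat' first | apply Bdd.add | apply Bdd.sub | apply Bdd.smul | exact B _ (by decide)
  have key := cancel_fac p hp0 2 (by decide) _ hB
    (cancel_fac p hp0 1 (by decide) _ (hB.fac _ _) key)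
  have := congrFun key ![l, m, n, k]
  simpa [Dst.sub_apply, Dst.add_apply, Dst.smul_apply, Wd, X, Dst.zero_apply, mul_assoc]
    using this

theorem oscB {up : Bool} (φ a d b : ℤ → A) (p s : ℂ) (hp : p * s = 1) (hb : BF up φ)
    (h1 : Exch p φ a) (h2 : Exch s φ d) (h3 : ∀ m n, φ m * b n = b n * φ m)
    (h4 : ∀ m n, a m * d n = d n * a m) (h5 : Exch p a b) (h6 : Exch s b d)
    (l m n k : ℤ) :
    - (a m * φ l * d k * b n) + a m * b n * d k * φ l
      + (p + s) • (φ l * a m * d k * b n - b n * a m * d k * φ l)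
      - d k * φ l * a m * b n + d k * b n * a m * φ l + b n * a m * φ l * d k
      - φ l * a m * b n * d k + b n * d k * φ l * a m - φ l * d k * b n * a m = 0 := by
  let X : Fin 4 → ℤ → A := ![φ, a, d, b]
  have hp0 : p ≠ 0 := left_ne_zero_of_mul_eq_one hp
  have hs0 : s ≠ 0 := right_ne_zero_of_mul_eq_one hp
  have e3 : sc (p + s) = sc p + sc s := map_add _ _ _
  have c03 := fun L R => (Wd_comm X 0 3 1 (by simpa [X] using h3) L R).trans (one_smul _ _)
  have c12 := fun L R => (Wd_comm X 1 2 1 (by simpa [X] using h4) L R).trans (one_smul _ _)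
  have s01 := fun L R a1 a2 a3 a4 => Wd_ctx X p 0 1 (by decide) h1 L R a1 a2 a3 a4
  have s02 := fun L R a1 a2 a3 a4 => Wd_ctx X s 0 2 (by decide) h2 L R a1 a2 a3 a4
  have s13 := fun L R a1 a2 a3 a4 => Wd_ctx X p 1 3 (by decide) h5 L R a1 a2 a3 a4
  have s32 := fun L R a1 a2 a3 a4 => Wd_ctx X s 3 2 (by decide) h6 L R a1 a2 a3 a4
  have i1 : Wd X [1, 2, 3, 0] = Wd X [1, 2, 0, 3] := (c03 [1, 2] []).symm
  have i2 : Wd X [2, 1, 0, 3] = Wd X [1, 2, 3, 0] := by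
    rw [i1]; exact (c12 [] [0, 3]).symm
  have i3 : Wd X [1, 0, 3, 2] = Wd X [1, 3, 0, 2] := c03 [1] [2]
  have i4 : Wd X [2, 0, 3, 1] = Wd X [2, 3, 0, 1] := c03 [2] [1]
  have i5 : Wd X [3, 1, 2, 0] = Wd X [3, 2, 1, 0] := c12 [3] [0]
  have i6 : Wd X [1, 2, 3, 0] = Wd X [2, 1, 3, 0] := c12 [] [3, 0]
  have key := oscB_abs (sc p) (sc s) (zz 0) (zz 1) (zz 2) (zz 3)
    (by rw [← sc_mul, hp]; exact map_one _)
    (Wd X [1, 0, 2, 3]) (Wd X [0, 1, 2, 3]) (Wd X [2, 0, 1, 3]) (Wd X [3, 1, 0, 2])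
    (Wd X [0, 1, 3, 2]) (Wd X [1, 0, 3, 2]) (Wd X [3, 2, 0, 1]) (Wd X [0, 2, 3, 1])
    (Wd X [2, 0, 3, 1]) (Wd X [1, 2, 3, 0]) (Wd X [3, 1, 2, 0]) (Wd X [1, 3, 2, 0])
    (Wd X [2, 3, 1, 0])
    (by rw [i1]; exact s02 [1] [3] (by decide) (by decide) (by decide) (by decide))
    (s01 [] [2, 3] (by decide) (by decide) (by decide) (by decide))
    (by rw [← i2]; exact s01 [2] [3] (by decide) (by decide) (by decide) (by decide))
    (s02 [3, 1] [] (by decide) (by decide) (by decide) (by decide))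
    (s01 [] [3, 2] (by decide) (by decide) (by decide) (by decide))
    (by rw [i3]; exact s02 [1, 3] [] (by decide) (by decide) (by decide) (by decide))
    (by rw [i5]; exact s01 [3, 2] [] (by decide) (by decide) (by decide) (by decide))
    (s02 [] [3, 1] (by decide) (by decide) (by decide) (by decide))
    (by rw [i4]; exact s01 [2, 3] [] (by decide) (by decide) (by decide) (by decide))
    (s13 [] [2, 0] (by decide) (by decide) (by decide) (by decide))
    (s32 [1] [0] (by decide) (by decide) (by decide) (by decide))
    (by rw [i6]; exact s13 [2] [0] (by decide) (by decide) (by decide) (by decide))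
    (by rw [i5]; exact s32 [] [1, 0] (by decide) (by decide) (by decide) (by decide))
  have B := fun l h => Wd_bdd up X l h hb
  rw [← e3, sc_smul] at key
  have hB : Bdd up (-Wd X [1, 0, 2, 3] + Wd X [1, 3, 2, 0] +
      (p + s) • (Wd X [0, 1, 2, 3] - Wd X [3, 1, 2, 0]) - Wd X [2, 0, 1, 3] + Wd X [2, 3, 1, 0]
      + Wd X [3, 1, 0, 2] - Wd X [0, 1, 3, 2] + Wd X [3, 2, 0, 1] - Wd X [0, 2, 3, 1]) := by
    repeat' first | apply Bdd.add | apply Bdd.sub | apply Bdd.smul | apply Bdd.neg |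
      exact B _ (by decide)
  have key := cancel_fac s hs0 2 (by decide) _ hB
    (cancel_fac p hp0 1 (by decide) _ (hB.fac _ _) key)
  have := congrFun key ![l, m, k, n]
  simpa [Dst.sub_apply, Dst.add_apply, Dst.smul_apply, Dst.neg_apply, Wd, X, Dst.zero_apply,
    mul_assoc] using this

end contr

end TD

namespace TD
open QAS
open scoped TensorProduct

section contr2
variable {A : Type} [Ring A] [Algebra ℂ A]

def psi (κ : ℂ) (φ φ' : ℤ → A) (n : ℤ) : A := κ • (φ n - φ' n)

theorem psi_comm (κ : ℂ) (φ φ' x : ℤ → A) (b : BF false φ) (b' : BF true φ') (h : Exch 1 φ x)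
    (h' : Exch 1 φ' x) (m n : ℤ) : psi κ φ φ' m * x n = x n * psi κ φ φ' m := by
  simp only [psi, smul_mul_assoc, mul_smul_comm, sub_mul, mul_sub, phi_comm φ x b h,
    phi_comm φ' x b' h']

theorem psi_exch (κ d : ℂ) (φ φ' x : ℤ → A) (h : Exch d φ x)
    (h' : Exch d φ' x) : Exch d (psi κ φ φ') x := by
  intro m n
  have h1 := h m n
  have h2 := h' m n
  simp only [psi, smul_mul_assoc, mul_smul_comm, sub_mul, mul_sub]
  linear_combination (norm := skip) κ • h1 - κ • h2
  match_scalars <;> ring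

theorem serreJ_psi (κ : ℂ) (φ φ' x : ℤ → A) (p s : ℂ) (hp : p * s = 1)
    (b : BF false φ) (b' : BF true φ') (h : Exch p φ x) (h' : Exch p φ' x)
    (h2 : Exch (s ^ 2) x x) (l m n : ℤ) :
    x m * x n * psi κ φ φ' l - (p + s) • (x m * psi κ φ φ' l * x n) + psi κ φ φ' l * x m * x n +
      (x n * x m * psi κ φ φ' l - (p + s) • (x n * psi κ φ φ' l * x m)
        + psi κ φ φ' l * x n * x m) = 0 := by
  have h1 := serreJ φ x p s hp b h h2 l m n
  have h2 := serreJ φ' x p s hp b' h' h2 l m n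
  simp only [psi, smul_mul_assoc, mul_smul_comm, sub_mul, mul_sub]
  linear_combination (norm := skip) κ • h1 - κ • h2
  match_scalars <;> ring

theorem serreI_psi (κ : ℂ) (φ φ' x y : ℤ → A) (p s : ℂ) (hp : p * s = 1)
    (b : BF false φ) (b' : BF true φ')
    (h1 : Exch (s ^ 2) φ x) (h1' : Exch (s ^ 2) φ' x) (h2 : Exch p φ y) (h2' : Exch p φ' y)
    (h3 : Exch p x y) (l m n : ℤ) :
    psi κ φ φ' l * x m * y n + x m * psi κ φ φ' l * y n
      - (p + s) • (psi κ φ φ' l * y n * x m + x m * y n * psi κ φ φ' l)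
      + y n * psi κ φ φ' l * x m + y n * x m * psi κ φ φ' l = 0 := by
  have h1 := serreI φ x y p s hp b h1 h2 h3 l m n
  have h2 := serreI φ' x y p s hp b' h1' h2' h3 l m n
  simp only [psi, smul_mul_assoc, mul_smul_comm, sub_mul, mul_sub]
  linear_combination (norm := skip) κ • h1 - κ • h2
  match_scalars <;> ring

theorem oscA_psi (κ : ℂ) (φ φ' b d : ℤ → A) (p s : ℂ) (hp : p * s = 1)
    (hb : BF false φ) (hb' : BF true φ')
    (h1 : Exch p φ b) (h1' : Exch p φ' b) (h2 : ∀ m n, φ m * d n = d n * φ m)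
    (h2' : ∀ m n, φ' m * d n = d n * φ' m) (h3 : Exch s b d)
    (h4 : ∀ m n, b m * b n = - (b n * b m)) (l m n k : ℤ) (ψ : A) (hψ : ψ = psi κ φ φ' l) :
    ψ * b m * d k * b n + ψ * b n * d k * b m
      - (p + s) • (b m * ψ * d k * b n + b n * ψ * d k * b m)
      + d k * b m * ψ * b n + d k * b n * ψ * b m + b n * ψ * b m * d k
      + b m * ψ * b n * d k + b n * d k * b m * ψ + b m * d k * b n * ψ = 0 := by
  have h1 := oscA φ b d p s hp hb h1 h2 h3 h4 l m n k
  have h2 := oscA φ' b d p s hp hb' h1' h2' h3 h4 l m n k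
  subst hψ
  simp only [psi, smul_mul_assoc, mul_smul_comm, sub_mul, mul_sub]
  linear_combination (norm := skip) κ • h1 - κ • h2
  match_scalars <;> ring

theorem oscB_psi (κ : ℂ) (φ φ' a d b : ℤ → A) (p s : ℂ) (hp : p * s = 1)
    (hb : BF false φ) (hb' : BF true φ')
    (h1 : Exch p φ a) (h1' : Exch p φ' a) (h2 : Exch s φ d) (h2' : Exch s φ' d)
    (h3 : ∀ m n, φ m * b n = b n * φ m) (h3' : ∀ m n, φ' m * b n = b n * φ' m)
    (h4 : ∀ m n, a m * d n = d n * a m) (h5 : Exch p a b) (h6 : Exch s b d)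
    (l m n k : ℤ) (ψ : A) (hψ : ψ = psi κ φ φ' l) :
    - (a m * ψ * d k * b n) + a m * b n * d k * ψ
      + (p + s) • (ψ * a m * d k * b n - b n * a m * d k * ψ)
      - d k * ψ * a m * b n + d k * b n * a m * ψ + b n * a m * ψ * d k
      - ψ * a m * b n * d k + b n * d k * ψ * a m - ψ * d k * b n * a m = 0 := by
  have h1 := oscB φ a d b p s hp hb h1 h2 h3 h4 h5 h6 l m n k
  have h2 := oscB φ' a d b p s hp hb' h1' h2' h3' h4 h5 h6 l m n k
  subst hψ
  simp only [psi, smul_mul_assoc, mul_smul_comm, sub_mul, mul_sub]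
  linear_combination (norm := skip) κ • h1 - κ • h2
  match_scalars <;> ring

theorem c2 {a b y α β : A} {sa sb : ℂ} (ha : a * y = sa • (y * a) + α)
    (hb : b * y = sb • (y * b) + β) :
    a * b * y = (sa * sb) • (y * (a * b)) + sb • (α * b) + a * β := by
  rw [mul_assoc, hb, mul_add, mul_smul_comm, ← mul_assoc, ha]
  simp only [add_mul, smul_mul_assoc, smul_add, smul_smul, mul_assoc, mul_comm sa]

theorem c3 {a b c y α β γ : A} {sa sb sc : ℂ} (ha : a * y = sa • (y * a) + α)
    (hb : b * y = sb • (y * b) + β) (hc : c * y = sc • (y * c) + γ) :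
    a * b * c * y = (sa * sb * sc) • (y * (a * b * c)) + (sb * sc) • (α * b * c)
      + sc • (a * β * c) + a * b * γ := by
  have h := c2 ha hb
  have h' : a * b * y = (sa * sb) • (y * (a * b)) + (sb • (α * b) + a * β) := by
    rw [h, add_assoc]
  rw [c2 h' hc]
  simp only [add_mul, smul_mul_assoc, smul_add, smul_smul, mul_assoc, mul_comm sc, add_assoc]

theorem c4 {a b c d y α β γ δ : A} {sa sb sc sd : ℂ} (ha : a * y = sa • (y * a) + α)
    (hb : b * y = sb • (y * b) + β) (hc : c * y = sc • (y * c) + γ)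
    (hd : d * y = sd • (y * d) + δ) :
    a * b * c * d * y = (sa * sb * sc * sd) • (y * (a * b * c * d)) + (sb * sc * sd) • (α * b * c * d)
      + (sc * sd) • (a * β * c * d) + sd • (a * b * γ * d) + a * b * c * δ := by
  have h := c3 ha hb hc
  have h' : a * b * c * y = (sa * sb * sc) • (y * (a * b * c)) + ((sb * sc) • (α * b * c)
      + sc • (a * β * c) + a * b * γ) := by
    rw [h]; simp only [add_assoc]
  rw [c2 h' hd]
  simp only [add_mul, smul_mul_assoc, smul_add, smul_smul, mul_assoc, mul_comm sd, add_assoc]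

end contr2

end TD

namespace TD
open QAS
open scoped TensorProduct

theorem cc_symm (M i j : ℕ) : cc M i j = cc M j i := by
  simp only [cc, form4, innerE]
  grind

theorem cc_M (M : ℕ) : cc M M M = 0 := by simp [cc, form4, innerE, lof]

theorem cc_diag_ne (M i : ℕ) (h : cc M i i = 0) : i = M := by
  simp only [cc, form4, innerE, lof] at h
  grind

theorem cc_serre (M i j : ℕ) (h : cc M i j = 1 ∨ cc M i j = -1) (hi : i ≠ M) :
    cc M i i = -2 * cc M i j ∧ i ≠ j := by
  simp only [cc, form4, innerE, lof] at *
  grind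

theorem cc_M1 (M : ℕ) (hM : 1 < M) : cc M (M - 1) M = -1 := by
  simp only [cc, form4, innerE, lof] at *
  grind
theorem cc_M2 (M : ℕ) : cc M M (M + 1) = 1 := by
  simp only [cc, form4, innerE, lof] at *
  grind
theorem cc_M3 (M : ℕ) (hM : 1 < M) : cc M (M - 1) (M + 1) = 0 := by
  simp only [cc, form4, innerE, lof] at *
  grind

section half
variable {A : Type} [Ring A] [Algebra ℂ A] {q : ℂ} {M N : ℕ}

/-- half of the Drinfeld double relations -/
structure Half (q : ℂ) (M N : ℕ) (κ : Idx M N → ℂ) (X Y P Q : Idx M N → ℤ → A) : Prop where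
  xy : ∀ i j m n, X i m * Y j n = sgn M i.1 j.1 • (Y j n * X i m) +
    (if i = j then psi (κ i) (P i) (Q i) (m + n) else 0)
  eP : ∀ i j, Exch (q ^ cc M i.1 j.1) (P i) (X j)
  eQ : ∀ i j, Exch (q ^ cc M i.1 j.1) (Q i) (X j)
  bP : ∀ i, BF false (P i)
  bQ : ∀ i, BF true (Q i)

/-- quasi-commutation -/
def QC (r y : A) : Prop := ∃ s : ℂ, r * y = s • (y * r)

def R4 (M : ℕ) {N : ℕ} (X : Idx M N → ℤ → A) (i j : Idx M N) (m n : ℤ) : A :=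
  X i m * X j n - sgn M i.1 j.1 • (X j n * X i m)

def R5 {M N : ℕ} (d : ℂ) (X : Idx M N → ℤ → A) (i j : Idx M N) (m n : ℤ) : A :=
  (X i (m + 1) * X j n - d • (X j n * X i (m + 1))) -
    (d • (X i m * X j (n + 1)) - X j (n + 1) * X i m)

variable {κ : Idx M N → ℂ} {X Y P Q : Idx M N → ℤ → A}

theorem Half.R4_comm (H : Half q M N κ X Y P Q) (i j : Idx M N) (h : cc M i.1 j.1 = 0) (m n : ℤ)
    (k : Idx M N) (l : ℤ) : QC (R4 M X i j m n) (Y k l) := by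
  have com : ∀ (i j : Idx M N), cc M i.1 j.1 = 0 → ∀ m n,
      psi (κ i) (P i) (Q i) m * X j n = X j n * psi (κ i) (P i) (Q i) m := by
    intro i j h m n
    apply psi_comm _ _ _ _ (H.bP i) (H.bQ i)
    · have := H.eP i j; rw [h, zpow_zero] at this; exact this
    · have := H.eQ i j; rw [h, zpow_zero] at this; exact this
  refine ⟨sgn M i.1 k.1 * sgn M j.1 k.1, ?_⟩
  have e1 := c2 (H.xy i k m l) (H.xy j k n l)
  have e2 := c2 (H.xy j k n l) (H.xy i k m l)
  rw [R4, sub_mul, smul_mul_assoc, e1, e2]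
  have h' : cc M j.1 i.1 = 0 := by rw [cc_symm]; exact h
  by_cases hij : i = j
  · subst hij
    have hi : i.1 = M := cc_diag_ne _ _ h
    have s1 : sgn M i.1 i.1 = -1 := by simp [sgn, hi]
    rw [s1]
    by_cases hk : i = k
    · subst hk
      simp only [if_true, s1, com i i h, mul_sub, mul_smul_comm, mul_zero, zero_mul]
      match_scalars <;> ring
    · simp only [hk, if_false, mul_sub, mul_smul_comm, mul_zero, zero_mul]
      match_scalars <;> ring
  · have hne : i.1 ≠ j.1 := fun h => hij (Subtype.ext h)
    have s1 : sgn M i.1 j.1 = 1 := by simp only [sgn]; grind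
    have s2 : sgn M j.1 i.1 = 1 := by simp only [sgn]; grind
    rw [s1]
    by_cases hk : i = k
    · subst hk
      simp only [if_true, Ne.symm hij, if_false, s2, com i j h, mul_sub, mul_smul_comm, mul_zero, zero_mul]
      match_scalars <;> ring
    · by_cases hk' : j = k
      · subst hk'
        simp only [if_true, hij, if_false, s1, com j i h', mul_sub, mul_smul_comm, mul_zero, zero_mul]
        match_scalars <;> ring
      · simp only [hk, hk', if_false, mul_sub, mul_smul_comm, mul_zero, zero_mul]
        match_scalars <;> ring

theorem Half.R5_comm (H : Half q M N κ X Y P Q) (i j : Idx M N) (h : cc M i.1 j.1 ≠ 0) (m n : ℤ)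
    (k : Idx M N) (l : ℤ) : QC (R5 (q ^ cc M i.1 j.1) X i j m n) (Y k l) := by
  refine ⟨sgn M i.1 k.1 * sgn M j.1 k.1, ?_⟩
  have hx := psi_exch (κ i) _ _ _ _ (H.eP i j) (H.eQ i j)
  have hy := psi_exch (κ j) _ _ _ _ (H.eP j i) (H.eQ j i)
  rw [cc_symm M j.1 i.1] at hy
  have hne : ¬ (i.1 = M ∧ j.1 = M) := by
    rintro ⟨h1, h2⟩; rw [h1, h2] at h; exact h (cc_M M)
  have s1 : sgn M i.1 j.1 = 1 := by simp only [sgn]; grind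
  have s2 : sgn M j.1 i.1 = 1 := by simp only [sgn]; grind
  rw [R5]
  simp only [sub_mul, smul_mul_assoc]
  rw [c2 (H.xy i k (m + 1) l) (H.xy j k n l), c2 (H.xy j k n l) (H.xy i k (m + 1) l),
    c2 (H.xy i k m l) (H.xy j k (n + 1) l), c2 (H.xy j k (n + 1) l) (H.xy i k m l)]
  have x1 := hx (m + l) n
  have y1 := hy (n + l) m
  rw [show m + l + 1 = m + 1 + l by ring] at x1
  rw [show n + l + 1 = n + 1 + l by ring] at y1
  set d := q ^ cc M i.1 j.1
  by_cases hij : i = j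
  · subst hij
    by_cases hk : i = k
    · subst hk
      simp only [if_true, s1, mul_sub, mul_smul_comm, mul_zero, zero_mul]
      linear_combination (norm := skip) x1 - d • y1 + d • y1 + y1
      match_scalars <;> ring
    · simp only [hk, if_false, mul_sub, mul_smul_comm, mul_zero, zero_mul]
      match_scalars <;> ring
  · by_cases hk : i = k
    · subst hk
      simp only [if_true, Ne.symm hij, if_false, s2, mul_sub, mul_smul_comm, mul_zero, zero_mul]
      linear_combination (norm := skip) x1
      match_scalars <;> ring
    · by_cases hk' : j = k
      · subst hk'
        simp only [if_true, hij, if_false, s1, mul_sub, mul_smul_comm, mul_zero, zero_mul]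
        linear_combination (norm := skip) y1
        match_scalars <;> ring
      · simp only [hk, hk', if_false, mul_sub, mul_smul_comm, mul_zero, zero_mul]
        match_scalars <;> ring

def SER (q : ℂ) {M N : ℕ} (X : Idx M N → ℤ → A) (i j : Idx M N) (m n k : ℤ) : A :=
  brF q (X i m) (brF q⁻¹ (X i n) (X j k)) + brF q (X i n) (brF q⁻¹ (X i m) (X j k))

theorem SER_eq (hq : q ≠ 0) (X : Idx M N → ℤ → A) (i j : Idx M N) (m n k : ℤ) :
    SER q X i j m n k = X i m * X i n * X j k - (q + q⁻¹) • (X i m * X j k * X i n)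
      + X j k * X i m * X i n + (X i n * X i m * X j k - (q + q⁻¹) • (X i n * X j k * X i m)
      + X j k * X i n * X i m) := by
  simp only [SER, brF, mul_sub, sub_mul, smul_sub, mul_smul_comm, smul_mul_assoc, mul_assoc]
  match_scalars <;> field_simp <;> ring

theorem Half.SER_comm (H : Half q M N κ X Y P Q) (hq : q ≠ 0) (i j : Idx M N)
    (h : cc M i.1 j.1 = 1 ∨ cc M i.1 j.1 = -1) (hi : i.1 ≠ M)
    (hR5 : ∀ i j : Idx M N, cc M i.1 j.1 ≠ 0 → Exch (q ^ cc M i.1 j.1) (X i) (X j)) (m n u : ℤ)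
    (k : Idx M N) (l : ℤ) : QC (SER q X i j m n u) (Y k l) := by
  obtain ⟨hcc, hij'⟩ := cc_serre M _ _ h hi
  have hij : i ≠ j := fun h => hij' (congrArg _ h)
  have hc0 : cc M i.1 j.1 ≠ 0 := by rcases h with h | h <;> rw [h] <;> decide
  have hcc0 : cc M i.1 i.1 ≠ 0 := by rw [hcc]; simpa using hc0
  set p : ℂ := q ^ cc M i.1 j.1 with hp
  set s : ℂ := q ^ (- cc M i.1 j.1) with hs
  have hps : p * s = 1 := by rw [hp, hs, ← zpow_add₀ hq]; simp
  have hsum : q + q⁻¹ = p + s := by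
    rcases h with h | h <;> simp only [hp, hs, h, neg_neg, zpow_one, zpow_neg_one]
    ring
  have hs2 : q ^ cc M i.1 i.1 = s ^ 2 := by
    rw [hcc, hs, ← zpow_natCast, ← zpow_mul]; congr 1; push_cast; ring
  have xx : Exch (s ^ 2) (X i) (X i) := by rw [← hs2]; exact hR5 i i hcc0
  have xy : Exch p (X i) (X j) := hR5 i j hc0
  have pj : Exch p (P j) (X i) := by rw [hp, cc_symm]; exact H.eP j i
  have qj : Exch p (Q j) (X i) := by rw [hp, cc_symm]; exact H.eQ j i
  have pi : Exch (s ^ 2) (P i) (X i) := by rw [← hs2]; exact H.eP i i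
  have qi : Exch (s ^ 2) (Q i) (X i) := by rw [← hs2]; exact H.eQ i i
  have sI : ∀ k : Idx M N, sgn M i.1 k.1 = 1 := by intro k; simp [sgn, hi]
  have si : sgn M j.1 i.1 = 1 := by simp [sgn, hi]
  have Hi := fun m => H.xy i k m l
  have Hj := fun m => H.xy j k m l
  simp only [sI] at Hi
  refine ⟨sgn M j.1 k.1, ?_⟩
  rw [SER_eq hq, hsum]
  simp only [sub_mul, add_mul, smul_mul_assoc]
  rw [c3 (Hi m) (Hi n) (Hj u), c3 (Hi m) (Hj u) (Hi n), c3 (Hj u) (Hi m) (Hi n),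
    c3 (Hi n) (Hi m) (Hj u), c3 (Hi n) (Hj u) (Hi m), c3 (Hj u) (Hi n) (Hi m)]
  by_cases hk : i = k
  · subst hk
    have e1 := serreI_psi (κ i) (P i) (Q i) (X i) (X j) p s hps (H.bP i) (H.bQ i) pi qi
      (H.eP i j) (H.eQ i j) xy (m + l) n u
    have e2 := serreI_psi (κ i) (P i) (Q i) (X i) (X j) p s hps (H.bP i) (H.bQ i) pi qi
      (H.eP i j) (H.eQ i j) xy (n + l) m u
    simp only [if_true, Ne.symm hij, if_false, si, mul_sub, mul_add, mul_zero, zero_mul,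
      mul_smul_comm]
    linear_combination (norm := skip) e1 + e2
    match_scalars <;> ring
  · by_cases hk' : j = k
    · subst hk'
      have e1 := serreJ_psi (κ j) (P j) (Q j) (X i) p s hps (H.bP j) (H.bQ j) pj qj xx (u + l) m n
      simp only [if_true, hij, if_false, mul_sub, mul_add, mul_zero, zero_mul,
        mul_smul_comm]
      linear_combination (norm := skip) e1
      match_scalars <;> ring
    · simp only [hk, hk', if_false, mul_sub, mul_add, mul_zero, zero_mul,
        mul_smul_comm]
      match_scalars <;> ring

/-- symmetrised oscillation element -/
def osc4 (q : ℂ) (a b d b' : A) : A :=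
  brF q (brF q⁻¹ a b) d * b' + b' * brF q (brF q⁻¹ a b) d

def OSC (q : ℂ) (a b d b' : A) : A := osc4 q a b d b' + osc4 q a b' d b

theorem OSC_eq (hq : q ≠ 0) (a b d b' : A) (h1 : a * d = d * a) (h2 : b * b' = - (b' * b)) :
    OSC q a b d b' = a * b * d * b' + a * b' * d * b
      - (q + q⁻¹) • (b * a * d * b' + b' * a * d * b)
      + d * b * a * b' + d * b' * a * b + b' * a * b * d
      + b * a * b' * d + b' * d * b * a + b * d * b' * a := by
  have h3 : d * (a * (b * b')) = - (d * (a * (b' * b))) := by rw [h2]; simp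
  have h4 : b * (b' * (a * d)) = - (b' * (b * (a * d))) := by
    rw [← mul_assoc, h2]; simp [mul_assoc]
  have h5 : b' * (d * (a * b)) = b' * (a * (d * b)) := by
    rw [← mul_assoc d, ← h1]; simp [mul_assoc]
  have h6 : b * (d * (a * b')) = b * (a * (d * b')) := by
    rw [← mul_assoc d, ← h1]; simp [mul_assoc]
  simp only [OSC, osc4, brF, mul_sub, sub_mul, smul_sub, mul_smul_comm, smul_mul_assoc, mul_assoc,
    h5, h6]
  rw [h3, h4]
  match_scalars <;> field_simp <;> ring

theorem Half.OSC_comm (H : Half q M N κ X Y P Q) (hq : q ≠ 0) (hM : 1 < M)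
    (i b j : Idx M N) (hi : i.1 = M - 1) (hb : b.1 = M) (hj : j.1 = M + 1)
    (hR4 : ∀ i j : Idx M N, cc M i.1 j.1 = 0 → ∀ m n, R4 M X i j m n = 0)
    (hR5 : ∀ i j : Idx M N, cc M i.1 j.1 ≠ 0 → Exch (q ^ cc M i.1 j.1) (X i) (X j))
    (m n u v : ℤ) (k : Idx M N) (l : ℤ) :
    QC (OSC q (X i m) (X b n) (X j u) (X b v)) (Y k l) := by
  have cib : cc M i.1 b.1 = -1 := by rw [hi, hb]; exact cc_M1 M hM
  have cbi : cc M b.1 i.1 = -1 := by rw [cc_symm]; exact cib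
  have cbj : cc M b.1 j.1 = 1 := by rw [hj, hb]; exact cc_M2 M
  have cjb : cc M j.1 b.1 = 1 := by rw [cc_symm]; exact cbj
  have cij : cc M i.1 j.1 = 0 := by rw [hi, hj]; exact cc_M3 M hM
  have cji : cc M j.1 i.1 = 0 := by rw [cc_symm]; exact cij
  have cbb : cc M b.1 b.1 = 0 := by rw [hb]; exact cc_M M
  have nib : i ≠ b := by intro h; rw [h, hb] at hi; omega
  have njb : j ≠ b := by intro h; rw [h, hb] at hj; omega
  have nij : i ≠ j := by intro h; rw [h, hj] at hi; omega
  have niM : i.1 ≠ M := by omega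
  have njM : j.1 ≠ M := by omega
  have aij : ∀ m n, X i m * X j n = X j n * X i m := by
    intro m n
    have := hR4 i j cij m n
    simp only [R4, sgn, niM, false_and, if_false, one_smul] at this
    exact sub_eq_zero.mp this
  have abb : ∀ m n, X b m * X b n = - (X b n * X b m) := by
    intro m n
    have := hR4 b b cbb m n
    simp only [R4, sgn, hb, true_and, if_true, neg_smul, one_smul] at this
    rw [sub_neg_eq_add] at this
    exact eq_neg_of_add_eq_zero_left this
  have xib : Exch q⁻¹ (X i) (X b) := by
    have := hR5 i b (by rw [cib]; decide)
    rwa [cib, zpow_neg_one] at this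
  have xbj : Exch q (X b) (X j) := by
    have := hR5 b j (by rw [cbj]; decide)
    rwa [cbj, zpow_one] at this
  have xbi : Exch q⁻¹ (X b) (X i) := by
    have := hR5 b i (by rw [cbi]; decide)
    rwa [cbi, zpow_neg_one] at this
  have hqi : q⁻¹ * q = 1 := inv_mul_cancel₀ hq
  have hqi' : q * q⁻¹ = 1 := mul_inv_cancel₀ hq
  have e0 : ∀ i j : Idx M N, cc M i.1 j.1 = 0 → Exch 1 (P i) (X j) ∧ Exch 1 (Q i) (X j) := by
    intro i j h
    have h1 := H.eP i j
    have h2 := H.eQ i j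
    rw [h, zpow_zero] at h1 h2
    exact ⟨h1, h2⟩
  have pc : ∀ i j : Idx M N, cc M i.1 j.1 = 0 → ∀ m n, P i m * X j n = X j n * P i m :=
    fun i j h => phi_comm _ _ (H.bP i) (e0 i j h).1
  have qc : ∀ i j : Idx M N, cc M i.1 j.1 = 0 → ∀ m n, Q i m * X j n = X j n * Q i m :=
    fun i j h => phi_comm _ _ (H.bQ i) (e0 i j h).2
  have em : ∀ i j : Idx M N, cc M i.1 j.1 = -1 → Exch q⁻¹ (P i) (X j) ∧ Exch q⁻¹ (Q i) (X j) := by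
    intro i j h
    have h1 := H.eP i j
    have h2 := H.eQ i j
    rw [h, zpow_neg_one] at h1 h2
    exact ⟨h1, h2⟩
  have ep : ∀ i j : Idx M N, cc M i.1 j.1 = 1 → Exch q (P i) (X j) ∧ Exch q (Q i) (X j) := by
    intro i j h
    have h1 := H.eP i j
    have h2 := H.eQ i j
    rw [h, zpow_one] at h1 h2
    exact ⟨h1, h2⟩
  have si : ∀ k : Idx M N, sgn M i.1 k.1 = 1 := by intro k; simp [sgn, niM]
  have sj : ∀ k : Idx M N, sgn M j.1 k.1 = 1 := by intro k; simp [sgn, njM]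
  have Ha := H.xy i k m l
  have Hd := H.xy j k u l
  have Hb := fun n => H.xy b k n l
  rw [si] at Ha
  rw [sj] at Hd
  refine ⟨1, ?_⟩
  rw [OSC_eq hq _ _ _ _ (aij m u) (abb n v)]
  simp only [sub_mul, add_mul, smul_mul_assoc]
  rw [c4 Ha (Hb n) Hd (Hb v), c4 Ha (Hb v) Hd (Hb n), c4 (Hb n) Ha Hd (Hb v),
    c4 (Hb v) Ha Hd (Hb n), c4 Hd (Hb n) Ha (Hb v), c4 Hd (Hb v) Ha (Hb n),
    c4 (Hb v) Ha (Hb n) Hd, c4 (Hb n) Ha (Hb v) Hd, c4 (Hb v) Hd (Hb n) Ha,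
    c4 (Hb n) Hd (Hb v) Ha]
  clear Ha Hb Hd
  by_cases hk : i = k
  · subst hk
    have sb : sgn M b.1 i.1 = 1 := by simp [sgn, niM]
    have e1 := oscA_psi (κ i) (P i) (Q i) (X b) (X j) q⁻¹ q hqi (H.bP i) (H.bQ i)
      (em i b cib).1 (em i b cib).2 (pc i j cij) (qc i j cij) xbj abb (m + l) n v u _ rfl
    simp only [if_true, nib.symm, nij.symm, if_false, sb, mul_sub, mul_add, mul_zero, zero_mul,
      mul_smul_comm, smul_zero, add_zero, zero_add, one_smul, mul_one]
    linear_combination (norm := skip) e1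
    match_scalars <;> ring
  by_cases hk' : j = k
  · subst hk'
    have sb : sgn M b.1 j.1 = 1 := by simp [sgn, njM]
    have e1 := oscA_psi (κ j) (P j) (Q j) (X b) (X i) q q⁻¹ hqi' (H.bP j) (H.bQ j)
      (ep j b cjb).1 (ep j b cjb).2 (pc j i cji) (qc j i cji) xbi abb (u + l) n v m _ rfl
    have cm : psi (κ j) (P j) (Q j) (u + l) * X i m = X i m * psi (κ j) (P j) (Q j) (u + l) :=
      psi_comm _ _ _ _ (H.bP j) (H.bQ j) (e0 j i cji).1 (e0 j i cji).2 _ _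
    have r1 : X b n * psi (κ j) (P j) (Q j) (u + l) * X i m =
        X b n * X i m * psi (κ j) (P j) (Q j) (u + l) := by rw [mul_assoc, cm, ← mul_assoc]
    have r2 : X b v * psi (κ j) (P j) (Q j) (u + l) * X i m =
        X b v * X i m * psi (κ j) (P j) (Q j) (u + l) := by rw [mul_assoc, cm, ← mul_assoc]
    rw [r1, r2] at e1
    simp only [if_true, nij, njb.symm, if_false, sb, mul_sub, mul_add, mul_zero, zero_mul,
      mul_smul_comm, smul_zero, add_zero, zero_add, one_smul, mul_one]
    linear_combination (norm := skip) e1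
    match_scalars <;> ring
  by_cases hk'' : b = k
  · subst hk''
    have sb : sgn M b.1 b.1 = -1 := by simp [sgn, hb]
    have e1 := oscB_psi (κ b) (P b) (Q b) (X i) (X j) (X b) q⁻¹ q hqi (H.bP b) (H.bQ b)
      (em b i cbi).1 (em b i cbi).2 (ep b j cbj).1 (ep b j cbj).2 (pc b b cbb) (qc b b cbb)
      aij xib xbj (n + l) m v u _ rfl
    have e2 := oscB_psi (κ b) (P b) (Q b) (X i) (X j) (X b) q⁻¹ q hqi (H.bP b) (H.bQ b)
      (em b i cbi).1 (em b i cbi).2 (ep b j cbj).1 (ep b j cbj).2 (pc b b cbb) (qc b b cbb)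
      aij xib xbj (v + l) m n u _ rfl
    simp only [if_true, nib, njb, if_false, sb, mul_sub, mul_add, mul_zero, zero_mul,
      mul_smul_comm, smul_zero, add_zero, zero_add, one_smul, mul_one]
    linear_combination (norm := skip) e1 + e2
    match_scalars <;> ring
  · have sb : sgn M b.1 k.1 * sgn M b.1 k.1 = 1 := by simp only [sgn]; grind
    simp only [hk, hk', hk'', if_false, mul_sub, mul_add, mul_zero, zero_mul,
      mul_smul_comm, smul_zero, add_zero, zero_add, one_smul, mul_one, one_mul, sb]

end half

end TD

namespace TD
open QAS
open scoped TensorProduct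
open Finset.HasAntidiagonal (antidiagonal)

theorem triple1 {B : Type} [AddCommMonoid B] (f : ℕ → ℕ → ℕ → B) (m : ℕ) :
    ∑ p ∈ antidiagonal m, ∑ r ∈ antidiagonal p.2, f p.1 r.1 r.2 =
      ∑ p ∈ antidiagonal m, ∑ r ∈ antidiagonal p.2, f r.1 p.1 r.2 := by
  rw [Finset.sum_sigma', Finset.sum_sigma']
  apply Finset.sum_nbij' (fun x => ⟨(x.2.1, x.1.1 + x.2.2), (x.1.1, x.2.2)⟩)
    (fun x => ⟨(x.2.1, x.1.1 + x.2.2), (x.1.1, x.2.2)⟩)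
  · rintro ⟨⟨a, b⟩, ⟨c, d⟩⟩ h; simp at h ⊢; omega
  · rintro ⟨⟨a, b⟩, ⟨c, d⟩⟩ h; simp at h ⊢; omega
  · rintro ⟨⟨a, b⟩, ⟨c, d⟩⟩ h; simp at h ⊢; omega
  · rintro ⟨⟨a, b⟩, ⟨c, d⟩⟩ h; simp at h ⊢; omega
  · rintro ⟨⟨a, b⟩, ⟨c, d⟩⟩ h; rfl

theorem triple2 {B : Type} [AddCommMonoid B] (f : ℕ → ℕ → ℕ → B) (m : ℕ) :
    ∑ p ∈ antidiagonal m, ∑ r ∈ antidiagonal p.2, f p.1 r.1 r.2 =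
      ∑ p ∈ antidiagonal m, ∑ r ∈ antidiagonal p.1, f r.1 r.2 p.2 := by
  rw [Finset.sum_sigma', Finset.sum_sigma']
  apply Finset.sum_nbij' (fun x => ⟨(x.1.1 + x.2.1, x.2.2), (x.1.1, x.2.1)⟩)
    (fun x => ⟨(x.2.1, x.2.2 + x.1.2), (x.2.2, x.1.2)⟩)
  · rintro ⟨⟨a, b⟩, ⟨c, d⟩⟩ h; simp at h ⊢; omega
  · rintro ⟨⟨a, b⟩, ⟨c, d⟩⟩ h; simp at h ⊢; omega
  · rintro ⟨⟨a, b⟩, ⟨c, d⟩⟩ h; simp at h ⊢; omega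
  · rintro ⟨⟨a, b⟩, ⟨c, d⟩⟩ h; simp at h ⊢; omega
  · rintro ⟨⟨a, b⟩, ⟨c, d⟩⟩ h; rfl

/-- coefficients of `(1 - d⁻¹ u) / (1 - d u)` -/
def gco (d : ℂ) : ℕ → ℂ
  | 0 => 1
  | k + 1 => (d - d⁻¹) * d ^ k

theorem gco_sum1 (d : ℂ) (r : ℕ) :
    ∑ p ∈ antidiagonal (r + 1), (d ^ p.1) * gco d p.2 = gco d (r + 1) + d ^ (r + 1)
      + r * (d - d⁻¹) * d ^ r := by
  induction r with
  | zero => simp [gco, Finset.Nat.sum_antidiagonal_succ]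
  | succ r ih =>
    rw [Finset.Nat.sum_antidiagonal_succ]
    simp only [pow_succ _ (_ : ℕ), mul_right_comm _ d]
    rw [← Finset.sum_mul, ih]
    simp [gco]; ring

theorem gco_sum2 (d : ℂ) (hd : d ≠ 0) (r : ℕ) :
    ∑ p ∈ antidiagonal (r + 1), (d⁻¹ ^ p.1) * gco d p.2 = d ^ (r + 1) := by
  induction r with
  | zero => simp [gco, Finset.Nat.sum_antidiagonal_succ]
  | succ r ih =>
    rw [Finset.Nat.sum_antidiagonal_succ]
    simp only [pow_succ d⁻¹ (_ : ℕ), mul_right_comm _ d⁻¹]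
    rw [← Finset.sum_mul, ih]
    simp [gco]; field_simp; ring

theorem gco_sum (d : ℂ) (hd : d ≠ 0) (r : ℕ) :
    ∑ p ∈ antidiagonal r, (d ^ p.1 - d⁻¹ ^ p.1) * gco d p.2 = r * gco d r := by
  cases r with
  | zero => simp
  | succ r =>
    simp only [sub_mul, Finset.sum_sub_distrib, gco_sum1, gco_sum2 d hd]
    simp [gco]; ring

section expo
variable {A : Type} [Ring A] [Algebra ℂ A]

theorem expC_rec (t : ℂ) (a : ℕ → A) (n : ℕ) :
    (n : ℂ) • expC t a n = ∑ p ∈ antidiagonal n, (t * p.1) • (a p.1 * expC t a p.2) := by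
  cases n with
  | zero => simp
  | succ n =>
    rw [expC, Finset.Nat.sum_antidiagonal_succ, Finset.Nat.sum_antidiagonal_eq_sum_range_succ_mk]
    have : (n : ℂ) + 1 ≠ 0 := by exact_mod_cast Nat.succ_ne_zero n
    rw [Nat.cast_succ, ← mul_smul, mul_inv_cancel₀ this, one_smul]
    simp [Finset.smul_sum, mul_smul]

theorem expC_X (t : ℂ) (a : ℕ → A) (X : ℤ → A) (d : ℂ) (hd : d ≠ 0)
    (h : ∀ s : ℕ, ∀ n : ℤ, (t * s) • (a s * X n) =
      (t * s) • (X n * a s) + (d ^ s - d⁻¹ ^ s) • X (n + s)) (m : ℕ) (n : ℤ) :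
    expC t a m * X n = ∑ p ∈ antidiagonal m, gco d p.1 • (X (n + p.1) * expC t a p.2) := by
  induction m using Nat.strong_induction_on generalizing n with
  | _ m ih =>
  rcases Nat.eq_zero_or_pos m with rfl | hm
  · simp [expC, gco]
  have hm0 : (m : ℂ) ≠ 0 := by exact_mod_cast hm.ne'
  apply smul_right_injective A hm0
  show (m : ℂ) • _ = (m : ℂ) • _
  rw [← smul_mul_assoc, expC_rec, Finset.sum_mul]
  have e1 : ∀ p ∈ antidiagonal m, (t * p.1) • (a p.1 * expC t a p.2) * X n =
      ∑ r ∈ antidiagonal p.2, (gco d r.1 • (X (n + r.1) * ((t * p.1) • (a p.1 * expC t a r.2))) +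
        ((d ^ p.1 - d⁻¹ ^ p.1) * gco d r.1) • (X (n + ((p.1 + r.1 : ℕ) : ℤ)) * expC t a r.2)) := by
    rintro ⟨s, l⟩ hp
    rw [Finset.HasAntidiagonal.mem_antidiagonal] at hp
    dsimp only at hp
    rcases Nat.eq_zero_or_pos s with rfl | hs
    · simp
    rw [smul_mul_assoc, mul_assoc, ih l (by omega), Finset.mul_sum, Finset.smul_sum]
    apply Finset.sum_congr rfl
    rintro ⟨k, j⟩ -
    have := h s (n + k)
    simp only
    rw [mul_smul_comm, ← mul_assoc, smul_comm, ← smul_mul_assoc, this]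
    rw [show n + (k : ℤ) + s = n + ((s + k : ℕ) : ℤ) by push_cast; ring]
    simp only [add_mul, smul_add, smul_mul_assoc, mul_smul_comm, smul_smul, mul_assoc]
    congr 2
    ring
  rw [Finset.sum_congr rfl e1]
  simp only [Finset.sum_add_distrib]
  rw [triple1 (fun s k j => gco d k • (X (n + k) * ((t * s) • (a s * expC t a j)))),
    triple2 (fun s k j => ((d ^ s - d⁻¹ ^ s) * gco d k) •
      (X (n + ((s + k : ℕ) : ℤ)) * expC t a j)), ← Finset.sum_add_distrib, Finset.smul_sum]
  apply Finset.sum_congr rfl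
  rintro ⟨k, l⟩ hp
  rw [Finset.HasAntidiagonal.mem_antidiagonal] at hp
  dsimp only at hp
  simp only [← Finset.smul_sum, ← Finset.mul_sum]
  rw [← expC_rec]
  have e2 : ∑ r ∈ antidiagonal k, ((d ^ r.1 - d⁻¹ ^ r.1) * gco d r.2) •
      (X (n + ((r.1 + r.2 : ℕ) : ℤ)) * expC t a l) =
      (k * gco d k) • (X (n + k) * expC t a l) := by
    rw [← gco_sum d hd, Finset.sum_smul]
    apply Finset.sum_congr rfl
    rintro ⟨u, v⟩ huv
    rw [Finset.HasAntidiagonal.mem_antidiagonal.mp huv]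
  rw [e2, mul_smul_comm, smul_smul, smul_smul, ← add_smul, ← hp]
  push_cast
  congr 1; ring

theorem expC_exch (t : ℂ) (a : ℕ → A) (X : ℤ → A) (d : ℂ) (hd : d ≠ 0)
    (h : ∀ s : ℕ, ∀ n : ℤ, (t * s) • (a s * X n) =
      (t * s) • (X n * a s) + (d ^ s - d⁻¹ ^ s) • X (n + s)) (m : ℕ) (n : ℤ) :
    expC t a (m + 1) * X n - d • (expC t a m * X (n + 1)) =
      X n * expC t a (m + 1) - d⁻¹ • (X (n + 1) * expC t a m) := by
  rw [expC_X t a X d hd h, expC_X t a X d hd h, Finset.Nat.sum_antidiagonal_succ,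
    Finset.smul_sum, add_sub_assoc, ← Finset.sum_sub_distrib]
  simp only [gco, Nat.cast_zero, add_zero, one_smul]
  rw [sub_eq_add_neg]
  congr 1
  rw [Finset.sum_eq_single (0, m)]
  · simp only [gco, zero_add, Nat.cast_zero, Nat.cast_one, add_zero, pow_zero, mul_one, sub_smul, one_smul]
    module
  · rintro ⟨k, l⟩ hp hne
    have : k ≠ 0 := by
      rintro rfl; apply hne; simp at hp; simp [hp]
    obtain ⟨k, rfl⟩ := Nat.exists_eq_succ_of_ne_zero this
    simp only [gco, smul_smul]
    rw [show n + ((k.succ + 1 : ℕ) : ℤ) = n + 1 + (k.succ : ℕ) by push_cast; ring, ← sub_smul]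
    convert zero_smul ℂ _
    simp only [Nat.succ_eq_add_one, gco]; ring
  · simp

theorem expC_comm (t : ℂ) (a : ℕ → A) (b : A) (h : ∀ s, a s * b = b * a s) (m : ℕ) :
    expC t a m * b = b * expC t a m := by
  induction m using Nat.strong_induction_on with
  | _ m ih =>
  cases m with
  | zero => simp [expC]
  | succ n =>
    rw [expC]
    simp only [smul_mul_assoc, mul_smul_comm, Finset.sum_mul, Finset.mul_sum]
    congr 2
    apply Finset.sum_congr rfl
    intro s hs
    rw [mul_assoc, ih _ (by omega), ← mul_assoc, h, mul_assoc]

theorem expC_map {B : Type} [Ring B] [Algebra ℂ B] (f : A →ₐ[ℂ] B) (t : ℂ) (a : ℕ → A) (m : ℕ) :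
    f (expC t a m) = expC t (fun s => f (a s)) m := by
  induction m using Nat.strong_induction_on with
  | _ m ih =>
  cases m with
  | zero => simp [expC]
  | succ n =>
    rw [expC, expC]
    simp only [map_smul, map_sum, map_mul]
    congr 2
    apply Finset.sum_congr rfl
    intro s hs
    rw [ih _ (by omega)]

open MulOpposite in
theorem expC_op (t : ℂ) (a : ℕ → A) (h : ∀ r s, a r * a s = a s * a r) (m : ℕ) :
    expC t (fun s => op (a s)) m = op (expC t a m) := by
  induction m using Nat.strong_induction_on with
  | _ m ih =>
  cases m with
  | zero => simp [expC]
  | succ n =>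
    rw [expC, expC]
    simp only [op_smul, Finset.op_sum]
    congr 2
    apply Finset.sum_congr rfl
    intro s hs
    rw [ih _ (by omega), ← op_mul, expC_comm t a _ (fun r => h r _)]

def fP (K : A) (t : ℂ) (h : ℤ → A) (n : ℤ) : A :=
  if 0 ≤ n then K * expC t (fun s => h (s : ℤ)) n.toNat else 0

def fM (K : A) (t : ℂ) (h : ℤ → A) (n : ℤ) : A :=
  if n ≤ 0 then K * expC (-t) (fun s => h (-(s : ℤ))) (-n).toNat else 0

theorem fP_BF (K : A) (t : ℂ) (h : ℤ → A) : BF false (fP K t h) := by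
  intro n hn; simp at hn; rw [fP, if_neg (by omega)]

theorem fM_BF (K : A) (t : ℂ) (h : ℤ → A) : BF true (fM K t h) := by
  intro n hn; simp at hn; rw [fM, if_neg (by omega)]

theorem fP_exch (K : A) (t : ℂ) (h : ℤ → A) (X : ℤ → A) (d : ℂ) (hd : d ≠ 0)
    (hK : ∀ n, K * X n = d • (X n * K))
    (hh : ∀ s n : ℤ, s ≠ 0 → (t * s) • (h s * X n) =
      (t * s) • (X n * h s) + (d ^ s - d ^ (-s)) • X (n + s)) : Exch d (fP K t h) X := by
  intro m n
  rcases lt_trichotomy (m + 1) 0 with hm | hm | hm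
  · rw [fP, fP, if_neg (by omega), if_neg (by omega)]; simp
  · rw [fP, fP, if_pos (by omega), if_neg (by omega), hm]; simp [expC, hK]
  · obtain ⟨k, rfl⟩ := Int.eq_ofNat_of_zero_le (show 0 ≤ m by omega)
    have e := expC_exch t (fun s => h (s : ℤ)) X d hd (by
      intro s n
      rcases Nat.eq_zero_or_pos s with rfl | hs
      · simp
      have := hh s n (by omega)
      simpa using this) k n
    rw [fP, fP, if_pos (by omega), if_pos (by omega)]
    have t1 : ((k : ℤ) + 1).toNat = k + 1 := by omega
    have t2 : ((k : ℤ)).toNat = k := by omega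
    rw [t1, t2]
    have e' := congrArg (K * ·) e
    simp only [mul_sub, mul_smul_comm, ← mul_assoc, hK, smul_mul_assoc, smul_smul,
      inv_mul_cancel₀ hd, one_smul] at e' ⊢
    exact e'

theorem fM_exch (K : A) (t : ℂ) (h : ℤ → A) (X : ℤ → A) (d : ℂ) (hd : d ≠ 0)
    (hK : ∀ n, K * X n = d⁻¹ • (X n * K))
    (hh : ∀ s n : ℤ, s ≠ 0 → (t * s) • (h s * X n) =
      (t * s) • (X n * h s) + (d ^ s - d ^ (-s)) • X (n + s)) : Exch d (fM K t h) X := by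
  intro m n
  rcases lt_trichotomy m 0 with hm | hm | hm
  · obtain ⟨k, rfl⟩ : ∃ k : ℕ, m = -(k : ℤ) - 1 := ⟨(-m - 1).toNat, by omega⟩
    have e := expC_exch (-t) (fun s => h (-(s : ℤ))) (fun n => X (-n)) d⁻¹ (inv_ne_zero hd) (by
      intro s n
      rcases Nat.eq_zero_or_pos s with rfl | hs
      · simp
      have := hh (-s) (-n) (by omega)
      simp only [neg_neg, zpow_neg, zpow_natCast] at this
      push_cast at this
      rw [show -n + -(s : ℤ) = -(n + s) by ring] at this
      rw [inv_inv, inv_pow, neg_mul, ← mul_neg, this]) k (-n - 1)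
    rw [fM, fM, if_pos (by omega), if_pos (by omega)]
    have t1 : (-(-(k : ℤ) - 1 + 1)).toNat = k := by omega
    have t2 : (-(-(k : ℤ) - 1)).toNat = k + 1 := by omega
    rw [t1, t2]
    rw [show -(-n - 1) = n + 1 by ring, show - (-n - 1 + 1) = n by ring] at e
    have e' := congrArg (fun x => (-d) • (K * x)) e
    simp only [mul_sub, mul_smul_comm, ← mul_assoc, hK, smul_mul_assoc, smul_smul, smul_sub,
      inv_mul_cancel₀ hd, mul_inv_cancel₀ hd, one_smul, inv_inv, neg_mul, neg_smul] at e' ⊢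
    linear_combination (norm := skip) e'
    match_scalars <;> field_simp <;> ring
  · subst hm
    rw [fM, fM, if_neg (by omega), if_pos (by omega)]; simp [expC, hK, smul_smul, hd]
  · rw [fM, fM, if_neg (by omega), if_neg (by omega)]; simp

end expo

end TD

namespace TD
open QAS
open scoped TensorProduct

/-- abbreviations for generators of the free algebra -/
def gXp {M N : ℕ} (i : Idx M N) (n : ℤ) : FA M N false := gi (Gen.Xp i n)
def gXm {M N : ℕ} (i : Idx M N) (n : ℤ) : FA M N false := gi (Gen.Xm i n)

/-- the coefficient in the `h`-`X` relation -/
def gam (q : ℂ) (M : ℕ) (i j : ℕ) (s : ℤ) : ℂ :=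
  qint (qpar q M i) (s * lof M i * cc M i j) / (s : ℂ)

def kap (q : ℂ) (M : ℕ) {N : ℕ} (i : Idx M N) : ℂ := (qpar q M i.1 - (qpar q M i.1)⁻¹)⁻¹

def tt (q : ℂ) (M : ℕ) (i : ℕ) : ℂ := qpar q M i - (qpar q M i)⁻¹

theorem lof_sq (M i : ℕ) : lof M i * lof M i = 1 := by
  unfold lof; split_ifs <;> simp

theorem tt_ne {q : ℂ} (hq0 : q ≠ 0) (hq1 : ∀ k : ℕ, k ≠ 0 → q ^ k ≠ 1) (M i : ℕ) :
    tt q M i ≠ 0 := by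
  have h2 : q ^ 2 ≠ 1 := hq1 2 (by norm_num)
  unfold tt qpar lof
  split_ifs
  · intro h
    apply h2
    rw [zpow_one, sub_eq_zero] at h
    rw [pow_two]; nth_rewrite 2 [h]; exact mul_inv_cancel₀ hq0
  · intro h
    apply h2
    rw [zpow_neg_one, inv_inv, sub_eq_zero] at h
    rw [pow_two]; nth_rewrite 2 [← h]; exact mul_inv_cancel₀ hq0

theorem gam_eq {q : ℂ} (hq0 : q ≠ 0) (hq1 : ∀ k : ℕ, k ≠ 0 → q ^ k ≠ 1) (M i j : ℕ) (s : ℤ)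
    (hs : s ≠ 0) : tt q M i * s * gam q M i j s = (q ^ cc M i j) ^ s - (q ^ cc M i j) ^ (-s) := by
  have ht := tt_ne hq0 hq1 M i
  have hs' : (s : ℂ) ≠ 0 := by exact_mod_cast hs
  unfold gam qint
  rw [show qpar q M i - (qpar q M i)⁻¹ = tt q M i from rfl]
  have e : ∀ u : ℤ, qpar q M i ^ (u * lof M i * cc M i j) = (q ^ cc M i j) ^ u := by
    intro u
    rw [qpar, ← zpow_mul, ← zpow_mul]
    congr 1
    linear_combination (u * cc M i j) * lof_sq M i
  rw [e, show -(s * lof M i * cc M i j) = -s * lof M i * cc M i j by ring, e]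
  field_simp

section L1
variable {A : Type} [Ring A] [Algebra ℂ A] {q : ℂ} {M N : ℕ}

/-- the relations (R1)-(R3) -/
def L1 (q : ℂ) {M N : ℕ} (ρ : FA M N false →ₐ[ℂ] A) : Prop :=
  ∀ a b, rel q M N false 1 a b → ρ a = ρ b

def PP (q : ℂ) (ρ : FA M N false →ₐ[ℂ] A) (i : Idx M N) (n : ℤ) : A := ρ (phiPF q M N false i.1 n)
def QQ (q : ℂ) (ρ : FA M N false →ₐ[ℂ] A) (i : Idx M N) (n : ℤ) : A := ρ (phiMF q M N false i.1 n)
def xp (ρ : FA M N false →ₐ[ℂ] A) (i : Idx M N) (n : ℤ) : A := ρ (gXp i n)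
def xm (ρ : FA M N false →ₐ[ℂ] A) (i : Idx M N) (n : ℤ) : A := ρ (gXm i n)

theorem PP_eq (ρ : FA M N false →ₐ[ℂ] A) (i : Idx M N) (n : ℤ) :
    PP q ρ i n = fP (ρ (gi (Gen.K i))) (tt q M i.1) (fun s => ρ (HF M N false i.1 s)) n := by
  unfold PP phiPF fP
  split_ifs
  · rw [map_mul, expC_map, KF, dif_pos i.2]; rfl
  · simp

theorem QQ_eq (ρ : FA M N false →ₐ[ℂ] A) (i : Idx M N) (n : ℤ) :
    QQ q ρ i n = fM (ρ (gi (Gen.Ki i))) (tt q M i.1) (fun s => ρ (HF M N false i.1 s)) n := by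
  unfold QQ phiMF fM
  split_ifs
  · rw [map_mul, expC_map, KiF, dif_pos i.2]; rfl
  · simp

theorem HF_eq (i : Idx M N) (s : {s : ℤ // s ≠ 0}) :
    HF M N false i.1 s.1 = gi (Gen.H i s) := by
  rw [HF, dif_pos ⟨i.2, s.2⟩]

theorem Ki_rel (k ki a : A) (s : ℂ) (hs : s ≠ 0) (h1 : k * ki = 1) (h2 : ki * k = 1)
    (h : k * a = s • (a * k)) : ki * a = s⁻¹ • (a * ki) := by
  have : ki * (k * a) * ki = s • (ki * (a * k) * ki) := by rw [h]; simp
  rw [← mul_assoc, h2, one_mul, mul_assoc, mul_assoc, h1, mul_one] at this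
  rw [this, smul_smul, inv_mul_cancel₀ hs, one_smul]

variable {ρ : FA M N false →ₐ[ℂ] A}

theorem L1.KKi (h : L1 q ρ) (i : Idx M N) : ρ (gi (Gen.K i)) * ρ (gi (Gen.Ki i)) = 1 := by
  simpa using h _ _ (rel.KKi i)
theorem L1.KiK (h : L1 q ρ) (i : Idx M N) : ρ (gi (Gen.Ki i)) * ρ (gi (Gen.K i)) = 1 := by
  simpa using h _ _ (rel.KiK i)
theorem L1.KXp (h : L1 q ρ) (i j : Idx M N) (n : ℤ) :
    ρ (gi (Gen.K i)) * xp ρ j n = (q ^ cc M i.1 j.1) • (xp ρ j n * ρ (gi (Gen.K i))) := by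
  simpa [xp, gXp] using h _ _ (rel.KXp i j n)
theorem L1.KXm (h : L1 q ρ) (i j : Idx M N) (n : ℤ) :
    ρ (gi (Gen.K i)) * xm ρ j n = (q ^ cc M i.1 j.1)⁻¹ • (xm ρ j n * ρ (gi (Gen.K i))) := by
  simpa [xm, gXm] using h _ _ (rel.KXm i j n)
theorem L1.KiXp (h : L1 q ρ) (hq : q ≠ 0) (i j : Idx M N) (n : ℤ) :
    ρ (gi (Gen.Ki i)) * xp ρ j n = (q ^ cc M i.1 j.1)⁻¹ • (xp ρ j n * ρ (gi (Gen.Ki i))) :=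
  Ki_rel _ _ _ _ (zpow_ne_zero _ hq) (h.KKi i) (h.KiK i) (h.KXp i j n)
theorem L1.KiXm (h : L1 q ρ) (hq : q ≠ 0) (i j : Idx M N) (n : ℤ) :
    ρ (gi (Gen.Ki i)) * xm ρ j n = (q ^ cc M i.1 j.1) • (xm ρ j n * ρ (gi (Gen.Ki i))) := by
  have := Ki_rel _ _ _ _ (inv_ne_zero (zpow_ne_zero _ hq)) (h.KKi i) (h.KiK i) (h.KXm i j n)
  rwa [inv_inv] at this
theorem L1.HXp (h : L1 q ρ) (i j : Idx M N) (s n : ℤ) (hs : s ≠ 0) :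
    ρ (HF M N false i.1 s) * xp ρ j n = xp ρ j n * ρ (HF M N false i.1 s) +
      gam q M i.1 j.1 s • xp ρ j (n + s) := by
  have := h _ _ (rel.HXp i j ⟨s, hs⟩ n)
  rw [← HF_eq] at this
  rw [← sub_eq_iff_eq_add']
  simpa [xp, gXp, gam] using this
theorem L1.HXm (h : L1 q ρ) (i j : Idx M N) (s n : ℤ) (hs : s ≠ 0) :
    ρ (HF M N false i.1 s) * xm ρ j n = xm ρ j n * ρ (HF M N false i.1 s) -
      gam q M i.1 j.1 s • xm ρ j (n + s) := by
  have := h _ _ (rel.HXm i j ⟨s, hs⟩ n)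
  rw [← HF_eq] at this
  rw [sub_eq_add_neg, ← sub_eq_iff_eq_add']
  simpa [xm, gXm, gam] using this

theorem L1.half (h : L1 q ρ) (hq0 : q ≠ 0) (hq1 : ∀ k : ℕ, k ≠ 0 → q ^ k ≠ 1) :
    Half q M N (kap q M) (xp ρ) (xm ρ) (PP q ρ) (QQ q ρ) where
  xy i j m n := by
    have := h _ _ (rel.XpXm i j m n)
    rw [map_sub, sub_eq_iff_eq_add'] at this
    rw [map_smul, map_mul, map_mul] at this
    rw [xp, xm, gXp, gXm, this]
    congr 1
    split_ifs with hij
    · simp [psi, kap, PP, QQ]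
    · simp
  eP i j := by
    rw [show PP q ρ i = _ from funext (PP_eq ρ i)]
    apply fP_exch _ _ _ _ _ (zpow_ne_zero _ hq0) (h.KXp i j)
    intro s n hs
    rw [h.HXp i j s n hs, smul_add, smul_smul, gam_eq hq0 hq1 _ _ _ _ hs]
  eQ i j := by
    rw [show QQ q ρ i = _ from funext (QQ_eq ρ i)]
    apply fM_exch _ _ _ _ _ (zpow_ne_zero _ hq0) (h.KiXp hq0 i j)
    intro s n hs
    rw [h.HXp i j s n hs, smul_add, smul_smul, gam_eq hq0 hq1 _ _ _ _ hs]
  bP i := by rw [show PP q ρ i = _ from funext (PP_eq ρ i)]; apply fP_BF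
  bQ i := by rw [show QQ q ρ i = _ from funext (QQ_eq ρ i)]; apply fM_BF

open MulOpposite in
theorem Exch_op {d : ℂ} (hd : d ≠ 0) {P X : ℤ → A} (h : Exch d⁻¹ P X) :
    Exch d (fun n => op (P n)) (fun n => op (X n)) := by
  intro m n
  have := h m n
  simp only [← op_mul, ← op_smul, ← op_sub]
  congr 1
  have e := congrArg (fun x => d • x) this
  simp only [smul_sub, smul_smul, mul_inv_cancel₀ hd, one_smul] at e
  linear_combination (norm := module) -e

theorem sgn_symm (M i j : ℕ) : sgn M i j = sgn M j i := by
  unfold sgn; simp only [and_comm]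

open MulOpposite in
theorem L1.halfop (h : L1 q ρ) (hq0 : q ≠ 0) (hq1 : ∀ k : ℕ, k ≠ 0 → q ^ k ≠ 1) :
    Half q M N (kap q M) (fun i n => op (xm ρ i n)) (fun i n => op (xp ρ i n))
      (fun i n => op (PP q ρ i n)) (fun i n => op (QQ q ρ i n)) where
  xy i j m n := by
    rw [← op_mul, (h.half hq0 hq1).xy, ← op_mul, ← op_smul, sgn_symm, op_add]
    congr 1
    by_cases hij : i = j
    · subst hij
      simp [psi, add_comm]
    · simp [hij, Ne.symm hij]
  eP i j := by
    apply Exch_op (zpow_ne_zero _ hq0)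
    rw [show PP q ρ i = _ from funext (PP_eq ρ i)]
    apply fP_exch _ _ _ _ _ (inv_ne_zero (zpow_ne_zero _ hq0)) (h.KXm i j)
    intro s n hs
    rw [h.HXm i j s n hs, smul_sub, smul_smul, gam_eq hq0 hq1 _ _ _ _ hs, sub_eq_add_neg,
      ← neg_smul, neg_sub, inv_zpow', inv_zpow', neg_neg]
  eQ i j := by
    apply Exch_op (zpow_ne_zero _ hq0)
    rw [show QQ q ρ i = _ from funext (QQ_eq ρ i)]
    apply fM_exch _ _ _ _ _ (inv_ne_zero (zpow_ne_zero _ hq0))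
      (by simpa using h.KiXm hq0 i j)
    intro s n hs
    rw [h.HXm i j s n hs, smul_sub, smul_smul, gam_eq hq0 hq1 _ _ _ _ hs, sub_eq_add_neg,
      ← neg_smul, neg_sub, inv_zpow', inv_zpow', neg_neg]
  bP i := by
    intro n hn
    have : PP q ρ i n = 0 := (h.half hq0 hq1).bP i n hn
    simp [this]
  bQ i := by
    intro n hn
    have : QQ q ρ i n = 0 := (h.half hq0 hq1).bQ i n hn
    simp [this]

/-! the relators of the opposite algebra -/
open MulOpposite in
theorem R4_op (X : Idx M N → ℤ → A) (i j : Idx M N) (m n : ℤ) :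
    R4 M (fun i n => op (X i n)) i j m n = op (R4 M X j i n m) := by
  simp only [R4, ← op_mul, ← op_smul, ← op_sub, sgn_symm M i.1]

open MulOpposite in
theorem R5_op (d : ℂ) (hd : d ≠ 0) (X : Idx M N → ℤ → A) (i j : Idx M N) (m n : ℤ) :
    R5 d (fun i n => op (X i n)) i j m n = (-d) • op (R5 d⁻¹ X i j m n) := by
  simp only [R5, ← op_mul, ← op_smul, ← op_sub]
  congr 1
  match_scalars <;> field_simp

open MulOpposite in
theorem SER_op (hq : q ≠ 0) (X : Idx M N → ℤ → A) (i j : Idx M N) (m n k : ℤ) :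
    SER q (fun i n => op (X i n)) i j m n k = op (SER q X i j m n k) := by
  rw [SER_eq hq, SER_eq hq]
  simp only [← op_mul, ← op_smul, ← op_sub, ← op_add, mul_assoc]
  congr 1
  module

open MulOpposite in
theorem OSC_op (hq : q ≠ 0) (a b d b' : A) (h1 : a * d = d * a) (h2 : b * b' = - (b' * b)) :
    OSC q (op a) (op b) (op d) (op b') = op (OSC q a b d b') := by
  have h2' : b' * b = - (b * b') := by rw [h2, neg_neg]
  rw [OSC_eq hq, OSC_eq hq _ _ _ _ h1 h2]
  · simp only [← op_mul, ← op_smul, ← op_sub, ← op_add, mul_assoc]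
    congr 1
    have e1 : d * (a * b) = a * (d * b) := by rw [← mul_assoc, ← h1, mul_assoc]
    have e2 : d * (a * b') = a * (d * b') := by rw [← mul_assoc, ← h1, mul_assoc]
    rw [e1, e2]
    module
  · rw [← op_mul, ← h1, op_mul]
  · rw [← op_mul, h2', op_neg, op_mul]

open MulOpposite in
theorem QC_op {r y : A} (h : QC (op r) (op y)) : ∃ s : ℂ, y * r = s • (r * y) := by
  obtain ⟨s, h⟩ := h
  refine ⟨s, ?_⟩
  rw [← op_mul, ← op_mul, ← op_smul] at h
  exact op_injective h

/-! relators under algebra maps -/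
variable {B : Type} [Ring B] [Algebra ℂ B]

theorem brF_map (f : A →ₐ[ℂ] B) (u : ℂ) (x y : A) : f (brF u x y) = brF u (f x) (f y) := by
  simp [brF]
theorem R4_map (f : A →ₐ[ℂ] B) (X : Idx M N → ℤ → A) (i j : Idx M N) (m n : ℤ) :
    f (R4 M X i j m n) = R4 M (fun i n => f (X i n)) i j m n := by
  simp [R4]
theorem R5_map (f : A →ₐ[ℂ] B) (d : ℂ) (X : Idx M N → ℤ → A) (i j : Idx M N) (m n : ℤ) :
    f (R5 d X i j m n) = R5 d (fun i n => f (X i n)) i j m n := by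
  simp [R5]
theorem SER_map (f : A →ₐ[ℂ] B) (X : Idx M N → ℤ → A) (i j : Idx M N) (m n k : ℤ) :
    f (SER q X i j m n k) = SER q (fun i n => f (X i n)) i j m n k := by
  simp [SER, brF]
theorem OSC_map (f : A →ₐ[ℂ] B) (a b c d : A) :
    f (OSC q a b c d) = OSC q (f a) (f b) (f c) (f d) := by
  simp [OSC, osc4, brF]

theorem R5_exch {d : ℂ} {X : Idx M N → ℤ → A} {i j : Idx M N} (h : ∀ m n, R5 d X i j m n = 0) :
    Exch d (X i) (X j) := by
  intro m n
  have := h m n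
  rw [R5] at this
  linear_combination (norm := module) this

/-- relators of degree two -/
def T2 (q : ℂ) {M N : ℕ} (e : ℤ) (X : Idx M N → ℤ → A) : Set A :=
  {r | ∃ i j m n, cc M i.1 j.1 = 0 ∧ r = R4 M X i j m n} ∪
  {r | ∃ i j m n, cc M i.1 j.1 ≠ 0 ∧ r = R5 (q ^ (e * cc M i.1 j.1)) X i j m n}

/-- relators of degree three and four -/
def T3 (q : ℂ) {M N : ℕ} (X : Idx M N → ℤ → A) : Set A :=
  {r | ∃ i j m n k, (cc M i.1 j.1 = 1 ∨ cc M i.1 j.1 = -1) ∧ i.1 ≠ M ∧ r = SER q X i j m n k} ∪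
  {r | ∃ (i b j : Idx M N) (m n k u : ℤ), 1 < M ∧ 1 < N ∧ i.1 = M - 1 ∧ b.1 = M ∧ j.1 = M + 1 ∧
    r = OSC q (X i m) (X b n) (X j k) (X b u)}

theorem T2_map (f : A →ₐ[ℂ] B) (e : ℤ) (X : Idx M N → ℤ → A) :
    T2 q e (fun i n => f (X i n)) = Set.image f (T2 q e X) := by
  ext r; constructor
  · rintro (⟨i, j, m, n, h, rfl⟩ | ⟨i, j, m, n, h, rfl⟩)
    · exact ⟨_, Or.inl ⟨i, j, m, n, h, rfl⟩, R4_map _ _ _ _ _ _⟩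
    · exact ⟨_, Or.inr ⟨i, j, m, n, h, rfl⟩, R5_map _ _ _ _ _ _ _⟩
  · rintro ⟨_, (⟨i, j, m, n, h, rfl⟩ | ⟨i, j, m, n, h, rfl⟩), rfl⟩
    · exact Or.inl ⟨i, j, m, n, h, R4_map _ _ _ _ _ _⟩
    · exact Or.inr ⟨i, j, m, n, h, R5_map _ _ _ _ _ _ _⟩

theorem T3_map (f : A →ₐ[ℂ] B) (X : Idx M N → ℤ → A) :
    T3 q (fun i n => f (X i n)) = Set.image f (T3 q X) := by
  ext r; constructor
  · rintro (⟨i, j, m, n, k, h, h', rfl⟩ | ⟨i, b, j, m, n, k, u, h1, h2, h3, h4, h5, rfl⟩)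
    · exact ⟨_, Or.inl ⟨i, j, m, n, k, h, h', rfl⟩, SER_map _ _ _ _ _ _ _⟩
    · exact ⟨_, Or.inr ⟨i, b, j, m, n, k, u, h1, h2, h3, h4, h5, rfl⟩, OSC_map _ _ _ _ _⟩
  · rintro ⟨_, (⟨i, j, m, n, k, h, h', rfl⟩ | ⟨i, b, j, m, n, k, u, h1, h2, h3, h4, h5, rfl⟩), rfl⟩
    · exact Or.inl ⟨i, j, m, n, k, h, h', SER_map _ _ _ _ _ _ _⟩
    · exact Or.inr ⟨i, b, j, m, n, k, u, h1, h2, h3, h4, h5, OSC_map _ _ _ _ _⟩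

theorem T2_Exch {X : Idx M N → ℤ → A} {e : ℤ} (h : ∀ r ∈ T2 q e X, r = 0) (i j : Idx M N)
    (hc : cc M i.1 j.1 ≠ 0) : Exch (q ^ (e * cc M i.1 j.1)) (X i) (X j) :=
  R5_exch fun m n => h _ (Or.inr ⟨i, j, m, n, hc, rfl⟩)

theorem T2_R4 {X : Idx M N → ℤ → A} {e : ℤ} (h : ∀ r ∈ T2 q e X, r = 0) (i j : Idx M N)
    (hc : cc M i.1 j.1 = 0) (m n : ℤ) : R4 M X i j m n = 0 :=
  h _ (Or.inl ⟨i, j, m, n, hc, rfl⟩)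

theorem T2_plus (h : L1 q ρ) (hq0 : q ≠ 0) (hq1 : ∀ k : ℕ, k ≠ 0 → q ^ k ≠ 1) (r : A)
    (hr : r ∈ T2 q 1 (xp ρ)) (k : Idx M N) (l : ℤ) : QC r (xm ρ k l) := by
  rcases hr with ⟨i, j, m, n, hc, rfl⟩ | ⟨i, j, m, n, hc, rfl⟩
  · exact (h.half hq0 hq1).R4_comm i j hc m n k l
  · rw [one_mul]; exact (h.half hq0 hq1).R5_comm i j hc m n k l

theorem T3_plus (h : L1 q ρ) (hq0 : q ≠ 0) (hq1 : ∀ k : ℕ, k ≠ 0 → q ^ k ≠ 1)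
    (h2 : ∀ r ∈ T2 q 1 (xp ρ), r = 0) (r : A)
    (hr : r ∈ T3 q (xp ρ)) (k : Idx M N) (l : ℤ) : QC r (xm ρ k l) := by
  have e5 : ∀ i j : Idx M N, cc M i.1 j.1 ≠ 0 → Exch (q ^ cc M i.1 j.1) (xp ρ i) (xp ρ j) := by
    intro i j hc; have := T2_Exch h2 i j hc; rwa [one_mul] at this
  rcases hr with ⟨i, j, m, n, u, hc, hi, rfl⟩ | ⟨i, b, j, m, n, u, v, h1, hN, h3, h4, h5, rfl⟩
  · exact (h.half hq0 hq1).SER_comm hq0 i j hc hi e5 _ _ _ _ _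
  · exact (h.half hq0 hq1).OSC_comm hq0 h1 i b j h3 h4 h5 (T2_R4 h2) e5 _ _ _ _ _ _

theorem T2_minus (h : L1 q ρ) (hq0 : q ≠ 0) (hq1 : ∀ k : ℕ, k ≠ 0 → q ^ k ≠ 1) (r : A)
    (hr : r ∈ T2 q (-1) (xm ρ)) (k : Idx M N) (l : ℤ) :
    ∃ s : ℂ, xp ρ k l * r = s • (r * xp ρ k l) := by
  rcases hr with ⟨i, j, m, n, hc, rfl⟩ | ⟨i, j, m, n, hc, rfl⟩
  · apply QC_op
    rw [← R4_op]
    exact (h.halfop hq0 hq1).R4_comm j i (by rw [cc_symm, hc]) n m k l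
  · have hd : q ^ cc M i.1 j.1 ≠ 0 := zpow_ne_zero _ hq0
    have := (h.halfop hq0 hq1).R5_comm i j hc m n k l
    rw [R5_op _ hd, neg_smul, ← neg_smul] at this
    obtain ⟨s, hs⟩ := this
    apply QC_op
    refine ⟨s, ?_⟩
    rw [neg_one_mul, zpow_neg]
    apply smul_right_injective _ (neg_ne_zero.mpr hd)
    simp only
    rw [← smul_mul_assoc, hs, mul_smul_comm, smul_comm]

theorem T3_minus (h : L1 q ρ) (hq0 : q ≠ 0) (hq1 : ∀ k : ℕ, k ≠ 0 → q ^ k ≠ 1)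
    (h2 : ∀ r ∈ T2 q (-1) (xm ρ), r = 0) (r : A)
    (hr : r ∈ T3 q (xm ρ)) (k : Idx M N) (l : ℤ) :
    ∃ s : ℂ, xp ρ k l * r = s • (r * xp ρ k l) := by
  have e5 : ∀ i j : Idx M N, cc M i.1 j.1 ≠ 0 → Exch (q ^ cc M i.1 j.1)
      (fun n => MulOpposite.op (xm ρ i n)) (fun n => MulOpposite.op (xm ρ j n)) := by
    intro i j hc
    have := T2_Exch h2 i j hc
    rw [neg_one_mul, zpow_neg] at this
    exact Exch_op (zpow_ne_zero _ hq0) this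
  have e4 : ∀ i j : Idx M N, cc M i.1 j.1 = 0 → ∀ m n,
      R4 M (fun i n => MulOpposite.op (xm ρ i n)) i j m n = 0 := by
    intro i j hc m n
    rw [R4_op, T2_R4 h2 j i (by rw [cc_symm, hc])]; simp
  rcases hr with ⟨i, j, m, n, u, hc, hi, rfl⟩ | ⟨i, b, j, m, n, u, v, h1, hN, h3, h4, h5, rfl⟩
  · apply QC_op
    rw [← SER_op hq0]
    exact (h.halfop hq0 hq1).SER_comm hq0 i j hc hi e5 _ _ _ _ _
  · apply QC_op
    rw [← OSC_op hq0]
    · exact (h.halfop hq0 hq1).OSC_comm hq0 h1 i b j h3 h4 h5 e4 e5 _ _ _ _ _ _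
    · have := T2_R4 h2 i j (by rw [h3, h5]; exact cc_M3 M h1) m u
      rw [R4, sgn, if_neg (by omega), one_smul, sub_eq_zero] at this
      exact this
    · have := T2_R4 h2 b b (by rw [h4]; exact cc_M M) n v
      rw [R4, sgn, if_pos ⟨h4, h4⟩, sub_eq_zero] at this
      simpa using this

end L1
end TD

namespace TD
open QAS
open scoped TensorProduct

section act
variable {A : Type} [Ring A] [Algebra ℂ A] {q : ℂ} {M N : ℕ} {X : Idx M N → ℤ → A}

theorem kact2 (e : ℤ) (k : A) (c : Idx M N → ℂ) (hx : ∀ i n, k * X i n = c i • (X i n * k))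
    (r : A) (hr : r ∈ T2 q e X) : ∃ s : ℂ, k * r = s • (r * k) := by
  have hx' : ∀ i n y, k * (X i n * y) = c i • (X i n * (k * y)) := by
    intro i n y; rw [← mul_assoc, hx, smul_mul_assoc, mul_assoc]
  rcases hr with ⟨i, j, m, n, hc, rfl⟩ | ⟨i, j, m, n, hc, rfl⟩
  · refine ⟨c i * c j, ?_⟩
    simp only [R4, mul_sub, sub_mul, mul_smul_comm, smul_mul_assoc, mul_assoc, hx, hx']
    module
  · refine ⟨c i * c j, ?_⟩
    simp only [R5, mul_sub, sub_mul, mul_smul_comm, smul_mul_assoc, mul_assoc, hx, hx']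
    module

theorem kact3 (k : A) (c : Idx M N → ℂ) (hx : ∀ i n, k * X i n = c i • (X i n * k))
    (r : A) (hr : r ∈ T3 q X) : ∃ s : ℂ, k * r = s • (r * k) := by
  have hx' : ∀ i n y, k * (X i n * y) = c i • (X i n * (k * y)) := by
    intro i n y; rw [← mul_assoc, hx, smul_mul_assoc, mul_assoc]
  rcases hr with ⟨i, j, m, n, u, hc, hi, rfl⟩ | ⟨i, b, j, m, n, u, v, h1, hN, h3, h4, h5, rfl⟩
  · refine ⟨c i * c i * c j, ?_⟩
    simp only [SER, brF, mul_sub, sub_mul, mul_add, add_mul, mul_smul_comm, smul_mul_assoc,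
      mul_assoc, hx, hx']
    module
  · refine ⟨c i * c b * c j * c b, ?_⟩
    simp only [OSC, osc4, brF, mul_sub, sub_mul, mul_add, add_mul, mul_smul_comm, smul_mul_assoc,
      mul_assoc, hx, hx']
    module

theorem hact2 (e : ℤ) (h : A) (s : ℤ) (c : Idx M N → ℂ)
    (hx : ∀ i n, h * X i n = X i n * h - c i • X i (n + s))
    (r : A) (hr : r ∈ T2 q e X) : ∃ d ∈ Submodule.span ℂ (T2 q e X), h * r = r * h + d := by
  have hx' : ∀ i n y, h * (X i n * y) = X i n * (h * y) - c i • (X i (n + s) * y) := by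
    intro i n y; rw [← mul_assoc, hx, sub_mul, smul_mul_assoc, mul_assoc]
  rcases hr with ⟨i, j, m, n, hc, rfl⟩ | ⟨i, j, m, n, hc, rfl⟩
  · refine ⟨(-c i) • R4 M X i j (m + s) n + (-c j) • R4 M X i j m (n + s), ?_, ?_⟩
    · refine add_mem (Submodule.smul_mem _ _ (Submodule.subset_span ?_))
        (Submodule.smul_mem _ _ (Submodule.subset_span ?_)) <;> exact Or.inl ⟨_, _, _, _, hc, rfl⟩
    simp only [R4, mul_sub, sub_mul, mul_smul_comm, smul_mul_assoc, mul_assoc, hx, hx']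
    module
  · refine ⟨(-c i) • R5 (q ^ (e * cc M i.1 j.1)) X i j (m + s) n + (-c j) • R5 (q ^ (e * cc M i.1 j.1)) X i j m (n + s), ?_, ?_⟩
    · refine add_mem (Submodule.smul_mem _ _ (Submodule.subset_span ?_))
        (Submodule.smul_mem _ _ (Submodule.subset_span ?_)) <;> exact Or.inr ⟨_, _, _, _, hc, rfl⟩
    simp only [R5, mul_sub, sub_mul, mul_smul_comm, smul_mul_assoc, mul_assoc, hx, hx',
      add_right_comm _ (1 : ℤ) s]
    module

theorem hact3 (h : A) (s : ℤ) (c : Idx M N → ℂ)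
    (hx : ∀ i n, h * X i n = X i n * h - c i • X i (n + s))
    (r : A) (hr : r ∈ T3 q X) : ∃ d ∈ Submodule.span ℂ (T3 q X), h * r = r * h + d := by
  have hx' : ∀ i n y, h * (X i n * y) = X i n * (h * y) - c i • (X i (n + s) * y) := by
    intro i n y; rw [← mul_assoc, hx, sub_mul, smul_mul_assoc, mul_assoc]
  rcases hr with ⟨i, j, m, n, u, hc, hi, rfl⟩ | ⟨i, b, j, m, n, u, v, h1, hN, h3, h4, h5, rfl⟩
  · refine ⟨(-c i) • SER q X i j (m + s) n u + (-c i) • SER q X i j m (n + s) u +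
      (-c j) • SER q X i j m n (u + s), ?_, ?_⟩
    · refine add_mem (add_mem (Submodule.smul_mem _ _ (Submodule.subset_span ?_))
        (Submodule.smul_mem _ _ (Submodule.subset_span ?_)))
        (Submodule.smul_mem _ _ (Submodule.subset_span ?_)) <;>
        exact Or.inl ⟨_, _, _, _, _, hc, hi, rfl⟩
    simp only [SER, brF, mul_sub, sub_mul, mul_add, add_mul, mul_smul_comm, smul_mul_assoc,
      mul_assoc, hx, hx']
    module
  · refine ⟨(-c i) • OSC q (X i (m + s)) (X b n) (X j u) (X b v) +
      (-c b) • OSC q (X i m) (X b (n + s)) (X j u) (X b v) +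
      (-c j) • OSC q (X i m) (X b n) (X j (u + s)) (X b v) +
      (-c b) • OSC q (X i m) (X b n) (X j u) (X b (v + s)), ?_, ?_⟩
    · refine add_mem (add_mem (add_mem (Submodule.smul_mem _ _ (Submodule.subset_span ?_))
        (Submodule.smul_mem _ _ (Submodule.subset_span ?_)))
        (Submodule.smul_mem _ _ (Submodule.subset_span ?_)))
        (Submodule.smul_mem _ _ (Submodule.subset_span ?_)) <;>
        exact Or.inr ⟨_, _, _, _, _, _, _, h1, hN, h3, h4, h5, rfl⟩
    simp only [OSC, osc4, brF, mul_sub, sub_mul, mul_add, add_mul, mul_smul_comm, smul_mul_assoc,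
      mul_assoc, hx, hx']
    module

theorem expC_mem (S : Subalgebra ℂ A) (t : ℂ) (a : ℕ → A) (h : ∀ s, a s ∈ S) (m : ℕ) :
    expC t a m ∈ S := by
  induction m using Nat.strong_induction_on with
  | _ m ih =>
  cases m with
  | zero => rw [expC]; exact one_mem _
  | succ n =>
    rw [expC]
    refine S.smul_mem (S.smul_mem (sum_mem fun s hs => S.smul_mem (mul_mem (h _) (ih _ ?_)) _) _) _
    omega

theorem phiPF_mem (S : Subalgebra ℂ (FA M N false)) (hK : ∀ i : Idx M N, gi (Gen.K i) ∈ S)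
    (hH : ∀ (i : Idx M N) s, gi (Gen.H i s) ∈ S) (i : Idx M N) (n : ℤ) :
    phiPF q M N false i.1 n ∈ S := by
  unfold phiPF
  split_ifs
  · refine mul_mem ?_ (expC_mem _ _ _ ?_ _)
    · rw [KF, dif_pos i.2]; exact hK _
    · intro s; rw [HF]; split_ifs
      · exact hH _ _
      · exact zero_mem _
  · exact zero_mem _

theorem phiMF_mem (S : Subalgebra ℂ (FA M N false)) (hK : ∀ i : Idx M N, gi (Gen.Ki i) ∈ S)
    (hH : ∀ (i : Idx M N) s, gi (Gen.H i s) ∈ S) (i : Idx M N) (n : ℤ) :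
    phiMF q M N false i.1 n ∈ S := by
  unfold phiMF
  split_ifs
  · refine mul_mem ?_ (expC_mem _ _ _ ?_ _)
    · rw [KiF, dif_pos i.2]; exact hK _
    · intro s; rw [HF]; split_ifs
      · exact hH _ _
      · exact zero_mem _
  · exact zero_mem _

end act

section quot
variable {q : ℂ} {M N : ℕ} {V : Type} [AddCommGroup V] [Module ℂ V]

/-- the submodule generated by the relators in `S` -/
def NN (ρ : FA M N false →ₐ[ℂ] Module.End ℂ V) (S : Set (Module.End ℂ V)) : Submodule ℂ V :=
  sInf {W | (∀ r ∈ S, ∀ v, r v ∈ W) ∧ ∀ i n, ∀ w ∈ W, xm ρ i n w ∈ W}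

variable {ρ : FA M N false →ₐ[ℂ] Module.End ℂ V} {S : Set (Module.End ℂ V)}

theorem NN_gen (r) (hr : r ∈ S) (v : V) : r v ∈ NN ρ S := by
  rw [NN, Submodule.mem_sInf]; rintro W ⟨h1, -⟩; exact h1 _ hr _

theorem NN_span (r) (hr : r ∈ Submodule.span ℂ S) (v : V) : r v ∈ NN ρ S := by
  induction hr using Submodule.span_induction with
  | mem x h => exact NN_gen _ h _
  | zero => simp
  | add x y _ _ hx hy => exact add_mem hx hy
  | smul a x _ hx => exact Submodule.smul_mem _ _ hx

theorem NN_xm (i n) (w : V) (hw : w ∈ NN ρ S) : xm ρ i n w ∈ NN ρ S := by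
  rw [NN, Submodule.mem_sInf] at hw ⊢
  rintro W hW; exact hW.2 _ _ _ (hw W hW)

theorem NN_ind (g : Module.End ℂ V) (h1 : ∀ r ∈ S, ∀ v, g (r v) ∈ NN ρ S)
    (h2 : ∀ i n, ∀ w ∈ NN ρ S, g w ∈ NN ρ S → g (xm ρ i n w) ∈ NN ρ S) :
    ∀ w ∈ NN ρ S, g w ∈ NN ρ S := by
  have : NN ρ S ≤ NN ρ S ⊓ (NN ρ S).comap g := by
    conv_lhs => rw [NN]
    apply sInf_le
    refine ⟨fun r hr v => ⟨NN_gen r hr v, h1 r hr v⟩, fun i n w hw => ⟨NN_xm _ _ _ hw.1, ?_⟩⟩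
    exact h2 i n w hw.1 hw.2
  intro w hw
  exact (this hw).2

def Stb (ρ : FA M N false →ₐ[ℂ] Module.End ℂ V) (W : Submodule ℂ V) :
    Subalgebra ℂ (FA M N false) where
  carrier := {a | ∀ w ∈ W, ρ a w ∈ W}
  mul_mem' := by
    intro a b ha hb w hw
    rw [map_mul]; exact ha _ (hb _ hw)
  add_mem' := by
    intro a b ha hb w hw
    rw [map_add]; exact add_mem (ha _ hw) (hb _ hw)
  algebraMap_mem' := by
    intro c w hw
    rw [AlgHom.commutes, Module.algebraMap_end_apply]
    exact W.smul_mem _ hw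

theorem NN_stab (h : L1 q ρ) (hq0 : q ≠ 0) (hq1 : ∀ k : ℕ, k ≠ 0 → q ^ k ≠ 1)
    (kS : ∀ (k : Module.End ℂ V) (c : Idx M N → ℂ), (∀ i n, k * xm ρ i n = c i • (xm ρ i n * k)) →
      ∀ r ∈ S, ∃ s : ℂ, k * r = s • (r * k))
    (hS : ∀ (k : Module.End ℂ V) (s : ℤ) (c : Idx M N → ℂ),
      (∀ i n, k * xm ρ i n = xm ρ i n * k - c i • xm ρ i (n + s)) →
      ∀ r ∈ S, ∃ d ∈ Submodule.span ℂ S, k * r = r * k + d)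
    (pS : ∀ r ∈ S, ∀ k l, ∃ s : ℂ, xp ρ k l * r = s • (r * xp ρ k l)) :
    Stb ρ (NN ρ S) = ⊤ := by
  have hk : ∀ (k : Module.End ℂ V) (c : Idx M N → ℂ),
      (∀ i n, k * xm ρ i n = c i • (xm ρ i n * k)) → ∀ w ∈ NN ρ S, k w ∈ NN ρ S := by
    intro k c hc
    apply NN_ind
    · intro r hr v
      obtain ⟨s, hs⟩ := kS k c hc r hr
      have := LinearMap.congr_fun hs v
      simp only [Module.End.mul_apply, LinearMap.smul_apply] at this
      rw [this]; exact Submodule.smul_mem _ _ (NN_gen r hr _)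
    · intro i n w hw hkw
      have := LinearMap.congr_fun (hc i n) w
      simp only [Module.End.mul_apply, LinearMap.smul_apply] at this
      rw [this]; exact Submodule.smul_mem _ _ (NN_xm _ _ _ hkw)
  have mK : ∀ i : Idx M N, gi (Gen.K i) ∈ Stb ρ (NN ρ S) := fun i => hk _ _ (h.KXm i)
  have mKi : ∀ i : Idx M N, gi (Gen.Ki i) ∈ Stb ρ (NN ρ S) := fun i => hk _ _ (h.KiXm hq0 i)
  have mH : ∀ (i : Idx M N) s, gi (Gen.H i s) ∈ Stb ρ (NN ρ S) := by
    intro i s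
    have e := fun j n => h.HXm i j s.1 n s.2
    rw [HF_eq] at e
    apply NN_ind
    · intro r hr v
      obtain ⟨d, hd, hs⟩ := hS _ s.1 _ e r hr
      have := LinearMap.congr_fun hs v
      simp only [Module.End.mul_apply, LinearMap.add_apply] at this
      rw [this]; exact add_mem (NN_gen r hr _) (NN_span _ hd _)
    · intro j n w hw hkw
      have := LinearMap.congr_fun (e j n) w
      simp only [Module.End.mul_apply, LinearMap.sub_apply, LinearMap.smul_apply] at this
      rw [this]; exact sub_mem (NN_xm _ _ _ hkw) (Submodule.smul_mem _ _ (NN_xm _ _ _ hw))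
  have mX : ∀ (i : Idx M N) n, gi (Gen.Xp i n) ∈ Stb ρ (NN ρ S) := by
    intro i n
    apply NN_ind
    · intro r hr v
      obtain ⟨s, hs⟩ := pS r hr i n
      have := LinearMap.congr_fun hs v
      simp only [Module.End.mul_apply, LinearMap.smul_apply, xp, gXp] at this
      rw [this]; exact Submodule.smul_mem _ _ (NN_gen r hr _)
    · intro j m w hw hkw
      have := LinearMap.congr_fun ((h.half hq0 hq1).xy i j n m) w
      simp only [Module.End.mul_apply, LinearMap.add_apply, LinearMap.smul_apply] at this
      rw [xp, gXp] at this
      rw [this]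
      refine add_mem (Submodule.smul_mem _ _ (NN_xm _ _ _ hkw)) ?_
      split_ifs
      · rw [psi, LinearMap.smul_apply, LinearMap.sub_apply]
        exact Submodule.smul_mem _ _ (sub_mem (phiPF_mem _ mK mH i _ w hw)
          (phiMF_mem _ mKi mH i _ w hw))
      · simp
  rw [eq_top_iff]
  rintro a -
  induction a using FreeAlgebra.induction with
  | grade0 r => exact Subalgebra.algebraMap_mem _ _
  | grade1 g =>
    cases g with
    | Xp i n => exact mX i n
    | Xm i n => exact fun w hw => NN_xm i n w hw
    | K i => exact mK i
    | Ki i => exact mKi i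
    | H i s => exact mH i s
    | K0 he => cases he
    | K0i he => cases he
  | mul a b ha hb => exact mul_mem ha hb
  | add a b ha hb => exact add_mem ha hb

abbrev UU (q : ℂ) (M N : ℕ) := ALG q M N false 3
abbrev mk3 (q : ℂ) (M N : ℕ) : FA M N false →ₐ[ℂ] UU q M N := mkA q M N false 3

/-- generators other than `X⁻` -/
def nonM {M N : ℕ} : Gen M N false → Prop
  | Gen.Xm _ _ => False
  | _ => True

variable {T : Type} [Ring T] [Algebra ℂ T] {iL iR : UU q M N →ₐ[ℂ] T}

structure IsDat (iL iR : UU q M N →ₐ[ℂ] T)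
    (ρ : FA M N false →ₐ[ℂ] Module.End ℂ V) (π : V →ₗ[ℂ] T)
    (e : UU q M N →ₗ[ℂ] V) : Prop where
  l1 : L1 q ρ
  p2 : ∀ r ∈ T2 q 1 (xp ρ), r = 0
  p3 : ∀ r ∈ T3 q (xp ρ), r = 0
  pim : ∀ i n v, π (xm ρ i n v) = iL (mk3 q M N (gXm i n)) * π v
  pie : ∀ b, π (e b) = iR b
  eg : ∀ g, nonM g → ∀ b, ρ (gi g) (e b) = e (mk3 q M N (gi g) * b)

theorem pim_adjoin {π : V →ₗ[ℂ] T}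
    (pim : ∀ i n v, π (xm ρ i n v) = iL (mk3 q M N (gXm i n)) * π v)
    (a : FA M N false) (ha : a ∈ Algebra.adjoin ℂ {x | ∃ i n, x = gXm i n}) :
    ∀ v, π (ρ a v) = iL (mk3 q M N a) * π v := by
  induction ha using Algebra.adjoin_induction with
  | mem x h => obtain ⟨i, n, rfl⟩ := h; exact pim i n
  | algebraMap r =>
    intro v
    rw [AlgHom.commutes, AlgHom.commutes, AlgHom.commutes, Module.algebraMap_end_apply, map_smul,
      Algebra.smul_def]
  | add x y _ _ hx hy =>
    intro v
    rw [map_add, map_add, LinearMap.add_apply, map_add, hx, hy, map_add, add_mul]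
  | mul x y _ _ hx hy =>
    intro v
    rw [map_mul, map_mul, Module.End.mul_apply, hx, hy, ← mul_assoc, map_mul]

theorem T2_adjoin (e : ℤ) (r : FA M N false) (hr : r ∈ T2 q e (gXm (M := M) (N := N))) :
    r ∈ Algebra.adjoin ℂ {x | ∃ i n, x = gXm (M := M) (N := N) i n} := by
  have m : ∀ i n, gXm (M := M) (N := N) i n ∈ Algebra.adjoin ℂ {x | ∃ i n, x = gXm (M := M) (N := N) i n} :=
    fun i n => Algebra.subset_adjoin ⟨i, n, rfl⟩
  have br : ∀ (u : ℂ) x y, x ∈ Algebra.adjoin ℂ {x | ∃ i n, x = gXm (M := M) (N := N) i n} →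
      y ∈ Algebra.adjoin ℂ {x | ∃ i n, x = gXm (M := M) (N := N) i n} →
      x * y - u • (y * x) ∈ Algebra.adjoin ℂ {x | ∃ i n, x = gXm (M := M) (N := N) i n} :=
    fun u x y hx hy => sub_mem (mul_mem hx hy) (Subalgebra.smul_mem _ (mul_mem hy hx) _)
  rcases hr with ⟨i, j, m', n, hc, rfl⟩ | ⟨i, j, m', n, hc, rfl⟩
  · exact br _ _ _ (m _ _) (m _ _)
  · exact sub_mem (br _ _ _ (m _ _) (m _ _))
      (sub_mem (Subalgebra.smul_mem _ (mul_mem (m _ _) (m _ _)) _) (mul_mem (m _ _) (m _ _)))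

theorem T3_adjoin (r : FA M N false) (hr : r ∈ T3 q (gXm (M := M) (N := N))) :
    r ∈ Algebra.adjoin ℂ {x | ∃ i n, x = gXm (M := M) (N := N) i n} := by
  have m : ∀ i n, gXm (M := M) (N := N) i n ∈ Algebra.adjoin ℂ {x | ∃ i n, x = gXm (M := M) (N := N) i n} :=
    fun i n => Algebra.subset_adjoin ⟨i, n, rfl⟩
  have br : ∀ (u : ℂ) x y, x ∈ Algebra.adjoin ℂ {x | ∃ i n, x = gXm (M := M) (N := N) i n} →
      y ∈ Algebra.adjoin ℂ {x | ∃ i n, x = gXm (M := M) (N := N) i n} →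
      brF u x y ∈ Algebra.adjoin ℂ {x | ∃ i n, x = gXm (M := M) (N := N) i n} :=
    fun u x y hx hy => sub_mem (mul_mem hx hy) (Subalgebra.smul_mem _ (mul_mem hy hx) _)
  have os : ∀ a b c d, a ∈ Algebra.adjoin ℂ {x | ∃ i n, x = gXm (M := M) (N := N) i n} →
      b ∈ Algebra.adjoin ℂ {x | ∃ i n, x = gXm (M := M) (N := N) i n} →
      c ∈ Algebra.adjoin ℂ {x | ∃ i n, x = gXm (M := M) (N := N) i n} →
      d ∈ Algebra.adjoin ℂ {x | ∃ i n, x = gXm (M := M) (N := N) i n} →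
      osc4 q a b c d ∈ Algebra.adjoin ℂ {x | ∃ i n, x = gXm (M := M) (N := N) i n} :=
    fun a b c d ha hb hc hd => add_mem (mul_mem (br _ _ _ (br _ _ _ ha hb) hc) hd)
      (mul_mem hd (br _ _ _ (br _ _ _ ha hb) hc))
  rcases hr with ⟨i, j, m', n, u, hc, hi, rfl⟩ | ⟨i, b, j, m', n, u, v, h1, hN, h3, h4, h5, rfl⟩
  · exact add_mem (br _ _ _ (m _ _) (br _ _ _ (m _ _) (m _ _)))
      (br _ _ _ (m _ _) (br _ _ _ (m _ _) (m _ _)))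
  · exact add_mem (os _ _ _ _ (m _ _) (m _ _) (m _ _) (m _ _))
      (os _ _ _ _ (m _ _) (m _ _) (m _ _) (m _ _))

/-- passing to the quotient by a set of relators in the `X⁻` -/
theorem quot_step {π : V →ₗ[ℂ] T} {e : UU q M N →ₗ[ℂ] V}
    (D : IsDat iL iR ρ π e) (R : Set (FA M N false))
    (hR : ∀ r ∈ R, r ∈ Algebra.adjoin ℂ {x | ∃ i n, x = gXm (M := M) (N := N) i n}) (hR0 : ∀ r ∈ R, mk3 q M N r = 0)
    (hst : Stb ρ (NN ρ (Set.image ρ R)) = ⊤) :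
    ∃ (V' : Type) (_ : AddCommGroup V') (_ : Module ℂ V')
      (ρ' : FA M N false →ₐ[ℂ] Module.End ℂ V') (π' : V' →ₗ[ℂ] T)
      (e' : UU q M N →ₗ[ℂ] V'), IsDat iL iR ρ' π' e' ∧ (∀ r ∈ R, ρ' r = 0) ∧
      ∀ r, ρ r = 0 → ρ' r = 0 := by
  have st : ∀ a, ∀ w ∈ NN ρ (Set.image ρ R), ρ a w ∈ NN ρ (Set.image ρ R) := by
    intro a; have : a ∈ Stb ρ (NN ρ (Set.image ρ R)) := by rw [hst]; trivial
    exact this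
  have hker : NN ρ (Set.image ρ R) ≤ LinearMap.ker π := by
    rw [NN]
    apply sInf_le
    constructor
    · rintro _ ⟨r, hr, rfl⟩ v
      rw [LinearMap.mem_ker, pim_adjoin D.pim r (hR r hr), hR0 r hr, map_zero, zero_mul]
    · intro i n w hw
      rw [LinearMap.mem_ker] at hw ⊢
      rw [D.pim, hw, mul_zero]
  let W := NN ρ (Set.image ρ R)
  let ρ' : FA M N false →ₐ[ℂ] Module.End ℂ (V ⧸ W) :=
    FreeAlgebra.lift ℂ (fun g => W.mapQ W (ρ (gi g)) (st (gi g)))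
  have key : ∀ a v, ρ' a (W.mkQ v) = W.mkQ (ρ a v) := by
    intro a
    induction a using FreeAlgebra.induction with
    | grade0 r => intro v; rw [AlgHom.commutes, AlgHom.commutes]; simp
    | grade1 g => intro v; simp only [ρ', FreeAlgebra.lift_ι_apply]; rfl
    | mul a b ha hb => intro v; rw [map_mul, map_mul, Module.End.mul_apply, hb, ha]; rfl
    | add a b ha hb =>
      intro v; rw [map_add, map_add, LinearMap.add_apply, ha, hb, LinearMap.add_apply, map_add]
  have surj := W.mkQ_surjective
  have ext0 : ∀ a b, ρ a = ρ b → ρ' a = ρ' b := by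
    intro a b hab
    ext v
    simp only [LinearMap.comp_apply]
    rw [key, key, hab]
  have ext1 : ∀ a, ρ a = 0 → ρ' a = 0 := by
    intro a ha; rw [← map_zero ρ] at ha; rw [ext0 a 0 ha, map_zero]
  refine ⟨V ⧸ W, inferInstance, inferInstance, ρ', W.liftQ π hker, W.mkQ ∘ₗ e, ?_, ?_, ext1⟩
  · constructor
    · exact fun a b hab => ext0 _ _ (D.l1 a b hab)
    · intro r hr
      have : T2 q 1 (xp ρ') = Set.image ρ' (T2 q 1 gXp) := T2_map ρ' 1 gXp
      rw [this] at hr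
      obtain ⟨a, ha, rfl⟩ := hr
      apply ext1
      apply D.p2
      have : T2 q 1 (xp ρ) = Set.image ρ (T2 q 1 gXp) := T2_map ρ 1 gXp
      rw [this]; exact ⟨a, ha, rfl⟩
    · intro r hr
      have : T3 q (xp ρ') = Set.image ρ' (T3 q gXp) := T3_map ρ' gXp
      rw [this] at hr
      obtain ⟨a, ha, rfl⟩ := hr
      apply ext1
      apply D.p3
      have : T3 q (xp ρ) = Set.image ρ (T3 q gXp) := T3_map ρ gXp
      rw [this]; exact ⟨a, ha, rfl⟩
    · intro i n v
      obtain ⟨v, rfl⟩ := surj v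
      rw [xm, key]
      simp only [Submodule.mkQ_apply, Submodule.liftQ_apply]
      exact D.pim i n v
    · intro b
      simp only [LinearMap.comp_apply, Submodule.mkQ_apply, Submodule.liftQ_apply]
      exact D.pie b
    · intro g hg b
      rw [LinearMap.comp_apply, key, D.eg g hg, LinearMap.comp_apply]
  · intro r hr
    ext v
    simp only [LinearMap.comp_apply]
    rw [key]
    simp only [LinearMap.zero_apply]
    rw [Submodule.mkQ_apply, Submodule.Quotient.mk_eq_zero]
    exact NN_gen (ρ r) (Set.mem_image_of_mem _ hr) v

end quot
end TD

namespace TD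
open QAS
open scoped TensorProduct

section rels
variable {q : ℂ} {M N : ℕ} {A : Type} [Ring A] [Algebra ℂ A]

theorem mk3_rel {a b : FA M N false} (h : rel q M N false 3 a b) : mk3 q M N a = mk3 q M N b :=
  RingQuot.mkAlgHom_rel ℂ h

theorem XmF_eq (i : Idx M N) (n : ℤ) : XmF M N false i.1 n = gXm i n := by
  rw [XmF, dif_pos i.2]; rfl
theorem XpF_eq (i : Idx M N) (n : ℤ) : XpF M N false i.1 n = gXp i n := by
  rw [XpF, dif_pos i.2]; rfl

theorem oscM_eq (i b j : Idx M N) (h3 : i.1 = M - 1) (h4 : b.1 = M) (h5 : j.1 = M + 1)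
    (m n k u : ℤ) : oscOf q M (XmF M N false) m n k u + oscOf q M (XmF M N false) m u k n =
      OSC q (gXm i m) (gXm b n) (gXm j k) (gXm b u) := by
  rw [← XmF_eq, ← XmF_eq, ← XmF_eq, ← XmF_eq, h3, h4, h5]; rfl
theorem oscP_eq (i b j : Idx M N) (h3 : i.1 = M - 1) (h4 : b.1 = M) (h5 : j.1 = M + 1)
    (m n k u : ℤ) : oscOf q M (XpF M N false) m n k u + oscOf q M (XpF M N false) m u k n =
      OSC q (gXp i m) (gXp b n) (gXp j k) (gXp b u) := by
  rw [← XpF_eq, ← XpF_eq, ← XpF_eq, ← XpF_eq, h3, h4, h5]; rfl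

theorem mk3_T2m (r : FA M N false) (hr : r ∈ T2 q (-1) (gXm (M := M) (N := N))) :
    mk3 q M N r = 0 := by
  rcases hr with ⟨i, j, m, n, hc, rfl⟩ | ⟨i, j, m, n, hc, rfl⟩
  · rw [← map_zero (mk3 q M N)]
    exact mk3_rel (rel.XX0m i j m n (by norm_num) hc)
  · rw [R5, map_sub, sub_eq_zero, neg_one_mul]
    exact mk3_rel (rel.XXm i j m n (by norm_num) hc)

theorem mk3_T2p (r : FA M N false) (hr : r ∈ T2 q 1 (gXp (M := M) (N := N))) :
    mk3 q M N r = 0 := by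
  rcases hr with ⟨i, j, m, n, hc, rfl⟩ | ⟨i, j, m, n, hc, rfl⟩
  · rw [← map_zero (mk3 q M N)]
    exact mk3_rel (rel.XX0p i j m n (by norm_num) hc)
  · rw [R5, map_sub, sub_eq_zero, one_mul]
    exact mk3_rel (rel.XXp i j m n (by norm_num) hc)

theorem mk3_T3m (r : FA M N false) (hr : r ∈ T3 q (gXm (M := M) (N := N))) :
    mk3 q M N r = 0 := by
  rw [← map_zero (mk3 q M N)]
  rcases hr with ⟨i, j, m, n, k, hc, hi, rfl⟩ | ⟨i, b, j, m, n, k, u, h1, h2, h3, h4, h5, rfl⟩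
  · exact mk3_rel (rel.serreM i j m n k (by norm_num) hc hi)
  · rw [← oscM_eq i b j h3 h4 h5]
    exact mk3_rel (rel.oscM m n k u (by norm_num) h1 h2)

theorem mk3_T3p (r : FA M N false) (hr : r ∈ T3 q (gXp (M := M) (N := N))) :
    mk3 q M N r = 0 := by
  rw [← map_zero (mk3 q M N)]
  rcases hr with ⟨i, j, m, n, k, hc, hi, rfl⟩ | ⟨i, b, j, m, n, k, u, h1, h2, h3, h4, h5, rfl⟩
  · exact mk3_rel (rel.serreP i j m n k (by norm_num) hc hi)
  · rw [← oscP_eq i b j h3 h4 h5]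
    exact mk3_rel (rel.oscP m n k u (by norm_num) h1 h2)

theorem rel_lvl {a b : FA M N false} (h : rel q M N false 1 a b) : rel q M N false 3 a b := by
  cases h with
  | KKi i => exact rel.KKi i
  | KiK i => exact rel.KiK i
  | KK i j => exact rel.KK i j
  | KKi2 i j => exact rel.KKi2 i j
  | KiKi i j => exact rel.KiKi i j
  | KH i j s => exact rel.KH i j s
  | KiH i j s => exact rel.KiH i j s
  | HH i j s t => exact rel.HH i j s t
  | KXp i j n => exact rel.KXp i j n
  | KXm i j n => exact rel.KXm i j n
  | HXp i j s n => exact rel.HXp i j s n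
  | HXm i j s n => exact rel.HXm i j s n
  | XpXm i j m n => exact rel.XpXm i j m n
  | XX0p i j m n h2 => omega
  | XX0m i j m n h2 => omega
  | XXp i j m n h2 => omega
  | XXm i j m n h2 => omega
  | serreP i j m n k h3 => omega
  | serreM i j m n k h3 => omega
  | oscP m n k u h3 => omega
  | oscM m n k u h3 => omega
  | K0K0i he => cases he
  | K0iK0 he => cases he
  | K0K he => cases he
  | K0Ki he => cases he
  | K0H he => cases he
  | K0Xp he => cases he
  | K0Xm he => cases he

theorem mk3_L1 : L1 q (mk3 q M N) := fun _ _ h => mk3_rel (rel_lvl h)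

theorem rel3_of {ρ : FA M N false →ₐ[ℂ] A} (h1 : L1 q ρ) (p2 : ∀ r ∈ T2 q 1 (xp ρ), r = 0)
    (p3 : ∀ r ∈ T3 q (xp ρ), r = 0) (m2 : ∀ r ∈ T2 q (-1) (xm ρ), r = 0)
    (m3 : ∀ r ∈ T3 q (xm ρ), r = 0) : ∀ {a b}, rel q M N false 3 a b → ρ a = ρ b := by
  intro a b h
  have P2 : ∀ r ∈ T2 q 1 (gXp (M := M) (N := N)), ρ r = 0 := by
    intro r hr; apply p2
    have : T2 q 1 (xp ρ) = Set.image ρ (T2 q 1 gXp) := T2_map ρ 1 gXp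
    rw [this]; exact ⟨r, hr, rfl⟩
  have P3 : ∀ r ∈ T3 q (gXp (M := M) (N := N)), ρ r = 0 := by
    intro r hr; apply p3
    have : T3 q (xp ρ) = Set.image ρ (T3 q gXp) := T3_map ρ gXp
    rw [this]; exact ⟨r, hr, rfl⟩
  have M2 : ∀ r ∈ T2 q (-1) (gXm (M := M) (N := N)), ρ r = 0 := by
    intro r hr; apply m2
    have : T2 q (-1) (xm ρ) = Set.image ρ (T2 q (-1) gXm) := T2_map ρ (-1) gXm
    rw [this]; exact ⟨r, hr, rfl⟩
  have M3 : ∀ r ∈ T3 q (gXm (M := M) (N := N)), ρ r = 0 := by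
    intro r hr; apply m3
    have : T3 q (xm ρ) = Set.image ρ (T3 q gXm) := T3_map ρ gXm
    rw [this]; exact ⟨r, hr, rfl⟩
  cases h with
  | KKi i => exact h1 _ _ (rel.KKi i)
  | KiK i => exact h1 _ _ (rel.KiK i)
  | KK i j => exact h1 _ _ (rel.KK i j)
  | KKi2 i j => exact h1 _ _ (rel.KKi2 i j)
  | KiKi i j => exact h1 _ _ (rel.KiKi i j)
  | KH i j s => exact h1 _ _ (rel.KH i j s)
  | KiH i j s => exact h1 _ _ (rel.KiH i j s)
  | HH i j s t => exact h1 _ _ (rel.HH i j s t)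
  | KXp i j n => exact h1 _ _ (rel.KXp i j n)
  | KXm i j n => exact h1 _ _ (rel.KXm i j n)
  | HXp i j s n => exact h1 _ _ (rel.HXp i j s n)
  | HXm i j s n => exact h1 _ _ (rel.HXm i j s n)
  | XpXm i j m n => exact h1 _ _ (rel.XpXm i j m n)
  | XX0p i j m n h2 hc => rw [map_zero]; exact P2 _ (Or.inl ⟨i, j, m, n, hc, rfl⟩)
  | XX0m i j m n h2 hc => rw [map_zero]; exact M2 _ (Or.inl ⟨i, j, m, n, hc, rfl⟩)
  | XXp i j m n h2 hc =>
    rw [← sub_eq_zero, ← map_sub]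
    exact P2 _ (Or.inr ⟨i, j, m, n, hc, by rw [one_mul]; rfl⟩)
  | XXm i j m n h2 hc =>
    rw [← sub_eq_zero, ← map_sub]
    exact M2 _ (Or.inr ⟨i, j, m, n, hc, by rw [neg_one_mul]; rfl⟩)
  | serreP i j m n k h3 hc hi => rw [map_zero]; exact P3 _ (Or.inl ⟨i, j, m, n, k, hc, hi, rfl⟩)
  | serreM i j m n k h3 hc hi => rw [map_zero]; exact M3 _ (Or.inl ⟨i, j, m, n, k, hc, hi, rfl⟩)
  | oscP m n k u h3 hM hN =>
    rw [map_zero]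
    have e := oscP_eq (q := q) (M := M) (N := N) ⟨M - 1, by omega⟩ ⟨M, by omega⟩ ⟨M + 1, by omega⟩
      rfl rfl rfl m n k u
    rw [e]
    exact P3 _ (Or.inr ⟨_, _, _, m, n, k, u, hM, hN, rfl, rfl, rfl, rfl⟩)
  | oscM m n k u h3 hM hN =>
    rw [map_zero]
    have e := oscM_eq (q := q) (M := M) (N := N) ⟨M - 1, by omega⟩ ⟨M, by omega⟩ ⟨M + 1, by omega⟩
      rfl rfl rfl m n k u
    rw [e]
    exact M3 _ (Or.inr ⟨_, _, _, m, n, k, u, hM, hN, rfl, rfl, rfl, rfl⟩)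
  | K0K0i he => cases he
  | K0iK0 he => cases he
  | K0K he => cases he
  | K0Ki he => cases he
  | K0H he => cases he
  | K0Xp he => cases he
  | K0Xm he => cases he

end rels

section steps
variable {q : ℂ} {M N : ℕ} {T : Type} [Ring T] [Algebra ℂ T] {iL iR : UU q M N →ₐ[ℂ] T}
variable {V : Type} [AddCommGroup V] [Module ℂ V] {ρ : FA M N false →ₐ[ℂ] Module.End ℂ V}
  {π : V →ₗ[ℂ] T} {e : UU q M N →ₗ[ℂ] V}

theorem two_steps (D : IsDat iL iR ρ π e) (hq0 : q ≠ 0) (hq1 : ∀ k : ℕ, k ≠ 0 → q ^ k ≠ 1) :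
    ∃ (V' : Type) (_ : AddCommGroup V') (_ : Module ℂ V')
      (ρ' : FA M N false →ₐ[ℂ] Module.End ℂ V') (π' : V' →ₗ[ℂ] T)
      (e' : UU q M N →ₗ[ℂ] V'), IsDat iL iR ρ' π' e' ∧ (∀ r ∈ T2 q (-1) (xm ρ'), r = 0) ∧
      ∀ r ∈ T3 q (xm ρ'), r = 0 := by
  have t2 : ∀ {V : Type} [AddCommGroup V] [Module ℂ V] (ρ : FA M N false →ₐ[ℂ] Module.End ℂ V),
      T2 q (-1) (xm ρ) = Set.image ρ (T2 q (-1) gXm) := fun ρ => T2_map ρ (-1) gXm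
  have t3 : ∀ {V : Type} [AddCommGroup V] [Module ℂ V] (ρ : FA M N false →ₐ[ℂ] Module.End ℂ V),
      T3 q (xm ρ) = Set.image ρ (T3 q gXm) := fun ρ => T3_map ρ gXm
  obtain ⟨V₂, _, _, ρ₂, π₂, e₂, D₂, h₂, -⟩ := quot_step D (T2 q (-1) gXm) (T2_adjoin (-1))
    (mk3_T2m) (by
      rw [← t2]
      exact NN_stab D.l1 hq0 hq1 (kact2 (-1)) (hact2 (-1)) (T2_minus D.l1 hq0 hq1))
  have h₂' : ∀ r ∈ T2 q (-1) (xm ρ₂), r = 0 := by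
    intro r hr; rw [t2] at hr; obtain ⟨a, ha, rfl⟩ := hr; exact h₂ a ha
  obtain ⟨V₃, _, _, ρ₃, π₃, e₃, D₃, h₃, k₃⟩ := quot_step D₂ (T3 q gXm) T3_adjoin
    (mk3_T3m) (by
      rw [← t3]
      exact NN_stab D₂.l1 hq0 hq1 kact3 hact3 (T3_minus D₂.l1 hq0 hq1 h₂'))
  refine ⟨V₃, _, _, ρ₃, π₃, e₃, D₃, ?_, ?_⟩
  · intro r hr; rw [t2] at hr; obtain ⟨a, ha, rfl⟩ := hr; exact k₃ _ (h₂ a ha)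
  · intro r hr; rw [t3] at hr; obtain ⟨a, ha, rfl⟩ := hr; exact h₃ a ha

/-- the functional detecting the triangular decomposition -/
theorem exists_theta (D : IsDat iL iR ρ π e) (hq0 : q ≠ 0) (hq1 : ∀ k : ℕ, k ≠ 0 → q ^ k ≠ 1) :
    ∃ Θ : UU q M N →ₗ[ℂ] T, ∀ a ∈ Aminus q M N false 3, ∀ z ∈ Azero q M N false 3,
      ∀ p ∈ Aplus q M N false 3, Θ (a * (z * p)) = iL a * iR (z * p) := by
  obtain ⟨V₃, _, _, ρ₃, π₃, e₃, D₃, h2, h3⟩ := two_steps D hq0 hq1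
  let ρU : UU q M N →ₐ[ℂ] Module.End ℂ V₃ :=
    RingQuot.liftAlgHom ℂ ⟨ρ₃, fun {a b} h => rel3_of D₃.l1 D₃.p2 D₃.p3 h2 h3 h⟩
  have hρ : ∀ a, ρU (mk3 q M N a) = ρ₃ a := fun a => RingQuot.liftAlgHom_mkAlgHom_apply ℂ _ _ _
  have hm : ∀ a ∈ Aminus q M N false 3, ∀ v, π₃ (ρU a v) = iL a * π₃ v := by
    intro a ha
    induction ha using Algebra.adjoin_induction with
    | mem x h =>
      obtain ⟨i, n, rfl⟩ := h
      intro v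
      by_cases hi : 1 ≤ i ∧ i ≤ M + N - 1
      · rw [XmA, show XmF M N false i n = gXm ⟨i, hi⟩ n by rw [← XmF_eq], hρ]
        exact D₃.pim _ _ _
      · rw [XmA, XmF, dif_neg hi]; simp
    | algebraMap r =>
      intro v
      rw [AlgHom.commutes, AlgHom.commutes, Module.algebraMap_end_apply, map_smul,
        Algebra.smul_def]
    | add x y _ _ hx hy =>
      intro v
      rw [map_add, LinearMap.add_apply, map_add, hx, hy, map_add, add_mul]
    | mul x y _ _ hx hy =>
      intro v
      rw [map_mul, Module.End.mul_apply, hx, hy, ← mul_assoc, map_mul]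
  let B : Subalgebra ℂ (UU q M N) :=
    { carrier := {b | ∀ c, ρU b (e₃ c) = e₃ (b * c)}
      mul_mem' := by
        intro a b ha hb c
        rw [map_mul, Module.End.mul_apply, hb, ha, mul_assoc]
      add_mem' := by
        intro a b ha hb c
        rw [map_add, LinearMap.add_apply, hb, ha, add_mul, map_add]
      algebraMap_mem' := by
        intro r c
        rw [AlgHom.commutes, Module.algebraMap_end_apply, ← map_smul, Algebra.smul_def] }
  have hg : ∀ g, nonM g → mk3 q M N (gi g) ∈ B := by
    intro g hg c; rw [hρ]; exact D₃.eg g hg c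
  have hz : Azero q M N false 3 ≤ B := by
    apply Algebra.adjoin_le
    rintro x (⟨i, rfl⟩ | ⟨i, rfl⟩ | ⟨i, s, rfl⟩)
    · show mk3 q M N _ ∈ B
      rw [KF]; split_ifs
      · exact hg _ trivial
      · rw [map_zero]; exact zero_mem _
    · show mk3 q M N _ ∈ B
      rw [KiF]; split_ifs
      · exact hg _ trivial
      · rw [map_zero]; exact zero_mem _
    · show mk3 q M N _ ∈ B
      rw [HF]; split_ifs
      · exact hg _ trivial
      · rw [map_zero]; exact zero_mem _
  have hp : Aplus q M N false 3 ≤ B := by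
    apply Algebra.adjoin_le
    rintro x ⟨i, n, rfl⟩
    show mk3 q M N _ ∈ B
    rw [XpF]; split_ifs
    · exact hg _ trivial
    · rw [map_zero]; exact zero_mem _
  refine ⟨π₃ ∘ₗ (LinearMap.applyₗ (e₃ 1)) ∘ₗ ρU.toLinearMap, ?_⟩
  intro a ha z hz' p hp'
  show π₃ (ρU (a * (z * p)) (e₃ 1)) = _
  have : z * p ∈ B := mul_mem (hz hz') (hp hp')
  rw [map_mul, Module.End.mul_apply, hm a ha, this 1, mul_one, D₃.pie]

end steps
end TD

namespace TD
open QAS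
open scoped TensorProduct

section W
variable {q : ℂ} {M N : ℕ}

/-- the space of finitely supported functions on words -/
def WG (X B : Type) [AddCommGroup B] : Type := List X →₀ B
instance (X B : Type) [AddCommGroup B] : AddCommGroup (WG X B) :=
  inferInstanceAs (AddCommGroup (List X →₀ B))
instance (X B : Type) [AddCommGroup B] [Module ℂ B] : Module ℂ (WG X B) :=
  inferInstanceAs (Module ℂ (List X →₀ B))

section G
variable {X B : Type} [AddCommGroup B] [Module ℂ B]

def Yo (x : X) : Module.End ℂ (WG X B) := Finsupp.lmapDomain B ℂ (List.cons x)

def sg (w : List X) : B →ₗ[ℂ] WG X B := Finsupp.lsingle w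

def eo : B →ₗ[ℂ] WG X B := sg []

def lf {V : Type} [AddCommGroup V] [Module ℂ V] (T : List X → B →ₗ[ℂ] V) : WG X B →ₗ[ℂ] V :=
  Finsupp.lsum ℂ T

theorem lf_sg {V : Type} [AddCommGroup V] [Module ℂ V] (T : List X → B →ₗ[ℂ] V) (w : List X)
    (b : B) : lf T (sg w b) = T w b := by
  have := Finsupp.lsum_single (S := ℂ) T w b
  exact this

theorem Yo_single (x : X) (w : List X) (b : B) : Yo x (sg w b) = sg (x :: w) b :=
  Finsupp.mapDomain_single

theorem WG_ind {p : WG X B → Prop} (h0 : ∀ b, p (eo b)) (hY : ∀ x v, p v → p (Yo x v))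
    (ha : ∀ u v, p u → p v → p (u + v)) (v : WG X B) : p v := by
  refine Finsupp.induction_linear (motive := p) v ?_ ha ?_
  · have := h0 0; rw [map_zero] at this; exact this
  · intro w b
    induction w with
    | nil => exact h0 b
    | cons x w ih =>
      have := hY x _ ih
      exact (congrArg p (Yo_single x w b)).mp this

theorem op_ext {V : Type} [AddCommGroup V] [Module ℂ V] {f g : WG X B →ₗ[ℂ] V}
    (h0 : ∀ b, f (eo b) = g (eo b))
    (h1 : ∀ x v, f v = g v → f (Yo x v) = g (Yo x v)) : f = g := by
  apply LinearMap.ext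
  intro v
  refine WG_ind h0 h1 (fun u v hu hv => ?_) v
  rw [map_add, map_add, hu, hv]

def wT (B0 : B →ₗ[ℂ] WG X B) (c : X → ℂ) (R : X → Module.End ℂ (WG X B)) :
    List X → B →ₗ[ℂ] WG X B
  | [] => B0
  | x :: w => c x • (Yo x ∘ₗ wT B0 c R w) + R x ∘ₗ sg w

def wordOp (B0 : B →ₗ[ℂ] WG X B) (c : X → ℂ) (R : X → Module.End ℂ (WG X B)) :
    Module.End ℂ (WG X B) := lf (wT B0 c R)

theorem wordOp_e (B0 : B →ₗ[ℂ] WG X B) (c : X → ℂ) (R : X → Module.End ℂ (WG X B)) (b : B) :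
    wordOp B0 c R (eo b) = B0 b := lf_sg _ _ _

theorem wordOp_Y (B0 : B →ₗ[ℂ] WG X B) (c : X → ℂ) (R : X → Module.End ℂ (WG X B)) (x : X)
    (v : WG X B) : wordOp B0 c R (Yo x v) = c x • Yo x (wordOp B0 c R v) + R x v := by
  refine Finsupp.induction_linear
    (motive := fun v : WG X B => wordOp B0 c R (Yo x v) = c x • Yo x (wordOp B0 c R v) + R x v) v
    ?_ ?_ ?_
  · have : ((0 : List X →₀ B) : WG X B) = (0 : WG X B) := rfl
    rw [this]; simp
  · intro f g hf hg
    have := congrArg₂ (· + ·) hf hg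
    refine Eq.trans ?_ (this.trans ?_)
    · exact (congrArg _ (map_add (Yo x) (f : WG X B) g)).trans (map_add (wordOp B0 c R) _ _)
    · have e1 := map_add (wordOp B0 c R) (f : WG X B) g
      have e2 := map_add (R x) (f : WG X B) g
      refine Eq.trans ?_ (congrArg₂ (· + ·)
        (congrArg (fun z => c x • Yo x z) e1.symm) e2.symm)
      simp only [map_add, smul_add]
      exact add_add_add_comm _ _ _ _
  · intro w b
    change wordOp B0 c R (Yo x (sg w b)) = c x • Yo x (wordOp B0 c R (sg w b)) + R x (sg w b)
    rw [Yo_single]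
    simp [wordOp, wT, lf_sg]
end G

/-- the free left module on words in the negative generators -/
abbrev WW (q : ℂ) (M N : ℕ) := WG (Idx M N × ℤ) (UU q M N)

/-- base operator -/
def bas (g : Gen M N false) : UU q M N →ₗ[ℂ] WW q M N :=
  eo ∘ₗ LinearMap.mulLeft ℂ (mk3 q M N (gi g))

theorem bas_apply (g : Gen M N false) (b : UU q M N) : bas g b = eo (mk3 q M N (gi g) * b) := rfl

def oK (i : Idx M N) : Module.End ℂ (WW q M N) :=
  wordOp (bas (Gen.K i)) (fun x => q ^ (-cc M i.1 x.1.1)) 0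
def oKi (i : Idx M N) : Module.End ℂ (WW q M N) :=
  wordOp (bas (Gen.Ki i)) (fun x => q ^ (cc M i.1 x.1.1)) 0
def oH (i : Idx M N) (s : {s : ℤ // s ≠ 0}) : Module.End ℂ (WW q M N) :=
  wordOp (bas (Gen.H i s)) 1 (fun x => -gam q M i.1 x.1.1 s.1 • Yo (x.1, x.2 + s.1))
def oHF (i : Idx M N) (s : ℤ) : Module.End ℂ (WW q M N) :=
  if h : s ≠ 0 then oH i ⟨s, h⟩ else 0
def oPsi (i : Idx M N) (n : ℤ) : Module.End ℂ (WW q M N) :=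
  psi (kap q M i) (fP (oK i) (tt q M i.1) (oHF i)) (fM (oKi i) (tt q M i.1) (oHF i)) n
def oXp (i : Idx M N) (m : ℤ) : Module.End ℂ (WW q M N) :=
  wordOp (bas (Gen.Xp i m)) (fun x => sgn M i.1 x.1.1)
    (fun x => if i = x.1 then oPsi i (m + x.2) else 0)

def oG : Gen M N false → Module.End ℂ (WW q M N)
  | .Xp i m => oXp i m
  | .Xm i m => Yo (i, m)
  | .K i => oK i
  | .Ki i => oKi i
  | .H i s => oH i s
  | .K0 he => by cases he
  | .K0i he => by cases he

def oρ : FA M N false →ₐ[ℂ] Module.End ℂ (WW q M N) := FreeAlgebra.lift ℂ oG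

theorem oρ_gi (g : Gen M N false) : oρ (q := q) (gi g) = oG g := by simp [oρ, gi]

theorem oρ_HF (i : Idx M N) (s : ℤ) : oρ (q := q) (HF M N false i.1 s) = oHF i s := by
  unfold HF oHF
  by_cases h : s ≠ 0
  · rw [dif_pos ⟨i.2, h⟩, dif_pos h, oρ_gi]; rfl
  · rw [dif_neg (fun h' => h h'.2), dif_neg h, map_zero]

theorem oG_e (g : Gen M N false) (h : nonM g) (b : UU q M N) :
    oG g (eo b) = eo (mk3 q M N (gi g) * b) := by
  cases g with
  | Xp i m => exact wordOp_e _ _ _ _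
  | Xm i m => exact h.elim
  | K i => exact wordOp_e _ _ _ _
  | Ki i => exact wordOp_e _ _ _ _
  | H i s => exact wordOp_e _ _ _ _
  | K0 he => cases he
  | K0i he => cases he

theorem oK_Y (i : Idx M N) (x v) :
    oK (q := q) i (Yo x v) = q ^ (-cc M i.1 x.1.1) • Yo x (oK i v) := by
  rw [oK, wordOp_Y]; simp
theorem oKi_Y (i : Idx M N) (x v) :
    oKi (q := q) i (Yo x v) = q ^ (cc M i.1 x.1.1) • Yo x (oKi i v) := by
  rw [oKi, wordOp_Y]; simp
theorem oH_Y (i : Idx M N) (s) (x v) :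
    oH (q := q) i s (Yo x v) = Yo x (oH i s v) - gam q M i.1 x.1.1 s.1 • Yo (x.1, x.2 + s.1) v := by
  rw [oH, wordOp_Y]; simp only [Pi.one_apply, one_smul, LinearMap.smul_apply, neg_smul, sub_eq_add_neg]; rfl
theorem oXp_Y (i : Idx M N) (m) (x v) :
    oXp (q := q) i m (Yo x v) = sgn M i.1 x.1.1 • Yo x (oXp i m v) +
      if i = x.1 then oPsi i (m + x.2) v else 0 := by
  rw [oXp, wordOp_Y]; split_ifs <;> simp

theorem oK_e (i : Idx M N) (b : UU q M N) : oK i (eo b) = eo (mk3 q M N (gi (.K i)) * b) :=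
  wordOp_e _ _ _ _
theorem oKi_e (i : Idx M N) (b : UU q M N) : oKi i (eo b) = eo (mk3 q M N (gi (.Ki i)) * b) :=
  wordOp_e _ _ _ _
theorem oH_e (i : Idx M N) (s) (b : UU q M N) : oH i s (eo b) = eo (mk3 q M N (gi (.H i s)) * b) :=
  wordOp_e _ _ _ _
theorem oXp_e (i : Idx M N) (s) (b : UU q M N) :
    oXp i s (eo b) = eo (mk3 q M N (gi (.Xp i s)) * b) :=
  wordOp_e _ _ _ _

theorem mk3_m {a b c d : FA M N false} (h : rel q M N false 1 (a * b) (c * d)) (u : UU q M N) :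
    mk3 q M N a * (mk3 q M N b * u) = mk3 q M N c * (mk3 q M N d * u) := by
  rw [← mul_assoc, ← mul_assoc, ← map_mul, ← map_mul, mk3_L1 _ _ h]

theorem o_KKi (hq0 : q ≠ 0) (i : Idx M N) : oK (q := q) i * oKi i = 1 := by
  apply op_ext
  · intro b
    rw [Module.End.mul_apply, oKi_e, oK_e, ← mul_assoc, ← map_mul, mk3_L1 _ _ (rel.KKi i)]; simp
  · intro x v h
    simp only [Module.End.mul_apply, Module.End.one_apply] at h ⊢
    rw [oKi_Y, map_smul, oK_Y, smul_smul, ← zpow_add₀ hq0, h]; simp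

theorem o_KiK (hq0 : q ≠ 0) (i : Idx M N) : oKi (q := q) i * oK i = 1 := by
  apply op_ext
  · intro b
    rw [Module.End.mul_apply, oK_e, oKi_e, ← mul_assoc, ← map_mul, mk3_L1 _ _ (rel.KiK i)]; simp
  · intro x v h
    simp only [Module.End.mul_apply, Module.End.one_apply] at h ⊢
    rw [oK_Y, map_smul, oKi_Y, smul_smul, ← zpow_add₀ hq0, h]; simp

theorem o_KK (i j : Idx M N) : oK (q := q) i * oK j = oK j * oK i := by
  apply op_ext
  · intro b
    simp only [Module.End.mul_apply, oK_e]; rw [mk3_m (rel.KK i j)]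
  · intro x v h
    simp only [Module.End.mul_apply, oK_Y, map_smul] at h ⊢
    rw [h, smul_comm]

theorem o_KKi2 (i j : Idx M N) : oK (q := q) i * oKi j = oKi j * oK i := by
  apply op_ext
  · intro b
    simp only [Module.End.mul_apply, oK_e, oKi_e]; rw [mk3_m (rel.KKi2 i j)]
  · intro x v h
    simp only [Module.End.mul_apply, oK_Y, oKi_Y, map_smul] at h ⊢
    rw [h, smul_comm]

theorem o_KiKi (i j : Idx M N) : oKi (q := q) i * oKi j = oKi j * oKi i := by
  apply op_ext
  · intro b
    simp only [Module.End.mul_apply, oKi_e]; rw [mk3_m (rel.KiKi i j)]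
  · intro x v h
    simp only [Module.End.mul_apply, oKi_Y, map_smul] at h ⊢
    rw [h, smul_comm]

theorem o_KH (i j : Idx M N) (s) : oK (q := q) i * oH j s = oH j s * oK i := by
  apply op_ext
  · intro b
    simp only [Module.End.mul_apply, oK_e, oH_e]; rw [mk3_m (rel.KH i j s)]
  · intro x v h
    simp only [Module.End.mul_apply, oK_Y, oH_Y, map_smul, map_sub] at h ⊢
    rw [h]; module

theorem o_KiH (i j : Idx M N) (s) : oKi (q := q) i * oH j s = oH j s * oKi i := by
  apply op_ext
  · intro b
    simp only [Module.End.mul_apply, oKi_e, oH_e]; rw [mk3_m (rel.KiH i j s)]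
  · intro x v h
    simp only [Module.End.mul_apply, oKi_Y, oH_Y, map_smul, map_sub] at h ⊢
    rw [h]; module

theorem o_HH (i j : Idx M N) (s t) : oH (q := q) i s * oH j t = oH j t * oH i s := by
  apply op_ext
  · intro b
    simp only [Module.End.mul_apply, oH_e]; rw [mk3_m (rel.HH i j s t)]
  · intro x v h
    simp only [Module.End.mul_apply, oH_Y, map_smul, map_sub] at h ⊢
    rw [h, show x.2 + t.1 + s.1 = x.2 + s.1 + t.1 by ring]; module

theorem oHF_comm (i : Idx M N) (s : ℤ) (g : Module.End ℂ (WW q M N))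
    (h : ∀ s, g * oH i s = oH i s * g) : oHF i s * g = g * oHF i s := by
  unfold oHF
  split_ifs
  · exact (h _).symm
  · simp

theorem oPsi_comm (i : Idx M N) (n : ℤ) (g : Module.End ℂ (WW q M N)) (hK : g * oK i = oK i * g)
    (hKi : g * oKi i = oKi i * g)
    (h : ∀ s, g * oH i s = oH i s * g) : g * oPsi i n = oPsi i n * g := by
  unfold oPsi psi
  rw [mul_smul_comm, smul_mul_assoc, mul_sub, sub_mul]
  congr 2
  · unfold fP
    split_ifs
    · rw [← mul_assoc, hK, mul_assoc, mul_assoc, expC_comm _ _ _ (fun s => oHF_comm i _ g h)]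
    · simp
  · unfold fM
    split_ifs
    · rw [← mul_assoc, hKi, mul_assoc, mul_assoc, expC_comm _ _ _ (fun s => oHF_comm i _ g h)]
    · simp

theorem oK_Psi (i j : Idx M N) (n : ℤ) : oK (q := q) i * oPsi j n = oPsi j n * oK i :=
  oPsi_comm _ _ _ (o_KK i j) (o_KKi2 i j) (o_KH i j)
theorem oH_Psi (i j : Idx M N) (s) (n : ℤ) : oH (q := q) i s * oPsi j n = oPsi j n * oH i s :=
  oPsi_comm _ _ _ (o_KH j i s).symm (o_KiH j i s).symm (o_HH i j s)

theorem o_KXp (hq0 : q ≠ 0) (i j : Idx M N) (m : ℤ) :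
    oK (q := q) i * oXp j m = q ^ cc M i.1 j.1 • (oXp j m * oK i) := by
  apply op_ext
  · intro b
    have := mk3_L1 _ _ (rel.KXp (q := q) i j m)
    simp only [map_mul, map_smul] at this
    simp only [LinearMap.smul_apply, Module.End.mul_apply, oK_e, oXp_e]
    rw [← mul_assoc, this, smul_mul_assoc, map_smul, mul_assoc]
  · intro x v h
    have h2 := LinearMap.congr_fun (oK_Psi (q := q) i j (m + x.2)) v
    simp only [LinearMap.smul_apply, Module.End.mul_apply, oK_Y, oXp_Y, map_smul, map_add] at h h2 ⊢
    rw [h]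
    have hz := mul_inv_cancel₀ (zpow_ne_zero (cc M i.1 x.1.1) hq0)
    by_cases hx : j = x.1
    · rw [if_pos hx, if_pos hx, h2, hx, zpow_neg, map_smul]
      linear_combination (norm := module) -(hz • (oPsi x.1 (m + x.2)) ((oK i) v))
    · rw [if_neg hx, if_neg hx]; simp only [map_zero, smul_zero, add_zero, map_smul]; module

theorem o_HXp (i j : Idx M N) (s : {s : ℤ // s ≠ 0}) (m : ℤ) :
    oH (q := q) i s * oXp j m - oXp j m * oH i s = gam q M i.1 j.1 s.1 • oXp j (m + s.1) := by
  apply op_ext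
  · intro b
    have := mk3_L1 _ _ (rel.HXp (q := q) i j s m)
    simp only [map_mul, map_smul, map_sub] at this
    simp only [LinearMap.smul_apply, LinearMap.sub_apply, Module.End.mul_apply, oH_e, oXp_e]
    rw [← mul_assoc, ← mul_assoc, ← map_sub, ← sub_mul, this, smul_mul_assoc, map_smul]; rfl
  · intro x v h
    have h2 := LinearMap.congr_fun (oH_Psi (q := q) i j s (m + x.2)) v
    simp only [LinearMap.smul_apply, LinearMap.sub_apply, Module.End.mul_apply, oH_Y, oXp_Y,
      map_smul, map_add, map_sub] at h h2 ⊢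
    rw [sub_eq_iff_eq_add] at h
    rw [h, map_add, map_smul]
    by_cases hx : j = x.1
    · simp only [if_pos hx]
      rw [h2, ← hx, show m + (x.2 + s.1) = m + s.1 + x.2 by ring]; module
    · simp only [if_neg hx]; simp only [map_zero, smul_zero, add_zero]; module

theorem o_L1 (hq0 : q ≠ 0) : L1 q (oρ (q := q) (M := M) (N := N)) := by
  intro a b h
  cases h with
  | KKi i => rw [map_mul, oρ_gi, oρ_gi, map_one]; exact o_KKi hq0 i
  | KiK i => rw [map_mul, oρ_gi, oρ_gi, map_one]; exact o_KiK hq0 i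
  | KK i j => rw [map_mul, map_mul, oρ_gi, oρ_gi]; exact o_KK i j
  | KKi2 i j => rw [map_mul, map_mul, oρ_gi, oρ_gi]; exact o_KKi2 i j
  | KiKi i j => rw [map_mul, map_mul, oρ_gi, oρ_gi]; exact o_KiKi i j
  | KH i j s => rw [map_mul, map_mul, oρ_gi, oρ_gi]; exact o_KH i j s
  | KiH i j s => rw [map_mul, map_mul, oρ_gi, oρ_gi]; exact o_KiH i j s
  | HH i j s t => rw [map_mul, map_mul, oρ_gi, oρ_gi]; exact o_HH i j s t
  | KXp i j n => rw [map_smul, map_mul, map_mul, oρ_gi, oρ_gi]; exact o_KXp hq0 i j n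
  | KXm i j n =>
    rw [map_smul, map_mul, map_mul, oρ_gi, oρ_gi]
    ext1 v
    exact oK_Y i (j, n) v
  | HXp i j s n =>
    rw [map_smul, map_sub, map_mul, map_mul, oρ_gi, oρ_gi, oρ_gi]; exact o_HXp i j s n
  | HXm i j s n =>
    rw [map_neg, map_smul, map_sub, map_mul, map_mul, oρ_gi, oρ_gi, oρ_gi]
    ext1 v
    have := oH_Y i s (j, n) v
    simp only [LinearMap.sub_apply, Module.End.mul_apply, LinearMap.neg_apply,
      LinearMap.smul_apply]
    rw [oG, oG, oG, this, sub_sub_cancel_left]; rfl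
  | XpXm i j m n =>
    rw [map_sub, map_smul, map_mul, map_mul, oρ_gi, oρ_gi]
    have hp : oρ (q := q) (if i = j then (qpar q M i.1 - (qpar q M i.1)⁻¹)⁻¹ •
              (phiPF q M N false i.1 (m + n) - phiMF q M N false i.1 (m + n))
          else 0) = if i = j then oPsi i (m + n) else 0 := by
      split_ifs
      · rw [map_smul, map_sub]
        have h1 := PP_eq (q := q) (oρ (q := q)) i (m + n)
        have h2 := QQ_eq (q := q) (oρ (q := q)) i (m + n)
        rw [PP] at h1; rw [QQ] at h2
        rw [h1, h2, oρ_gi, oρ_gi]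
        simp only [oρ_HF]
        rfl
      · simp
    rw [hp]
    ext1 v
    have := oXp_Y i m (j, n) v
    simp only [LinearMap.sub_apply, Module.End.mul_apply, LinearMap.smul_apply]
    rw [oG, oG, this, add_sub_cancel_left]
    split_ifs <;> rfl
  | XX0p i j m n h2 => omega
  | XX0m i j m n h2 => omega
  | XXp i j m n h2 => omega
  | XXm i j m n h2 => omega
  | serreP i j m n k h3 => omega
  | serreM i j m n k h3 => omega
  | oscP m n k u h3 => omega
  | oscM m n k u h3 => omega
  | K0K0i he => cases he
  | K0iK0 he => cases he
  | K0K he => cases he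
  | K0Ki he => cases he
  | K0H he => cases he
  | K0Xp he => cases he
  | K0Xm he => cases he

theorem o_adj (r : FA M N false) (hr : r ∈ Algebra.adjoin ℂ {x | ∃ i n, x = gXp (M := M) (N := N) i n})
    (b : UU q M N) : oρ r (eo b) = eo (mk3 q M N r * b) := by
  induction hr using Algebra.adjoin_induction generalizing b with
  | mem x hx =>
    obtain ⟨i, n, rfl⟩ := hx
    rw [gXp, oρ_gi]; exact oG_e (Gen.Xp i n) trivial b
  | algebraMap c => simp [Algebra.algebraMap_eq_smul_one]
  | add x y _ _ hx hy => rw [map_add, LinearMap.add_apply, hx, hy, map_add, add_mul, map_add]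
  | mul x y _ _ hx hy => rw [map_mul, Module.End.mul_apply, hy, hx, map_mul (mk3 q M N), mul_assoc]

theorem o_zero (r : Module.End ℂ (WW q M N)) (h0 : ∀ b, r (eo b) = 0)
    (h : ∀ i n, QC r (xm oρ i n)) : r = 0 := by
  apply op_ext
  · simpa using h0
  · intro x v hv
    obtain ⟨s, hs⟩ := h x.1 x.2
    have := LinearMap.congr_fun hs v
    rw [xm, gXm, oρ_gi, LinearMap.smul_apply, Module.End.mul_apply, Module.End.mul_apply, hv] at this
    simpa [oG] using this

theorem T2_mem {A : Type} [Ring A] [Algebra ℂ A] (S : Subalgebra ℂ A) (e : ℤ)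
    (X : Idx M N → ℤ → A) (m : ∀ i n, X i n ∈ S) (r : A) (hr : r ∈ T2 q e X) : r ∈ S := by
  have br : ∀ (u : ℂ) x y, x ∈ S → y ∈ S → x * y - u • (y * x) ∈ S :=
    fun u x y hx hy => sub_mem (mul_mem hx hy) (Subalgebra.smul_mem _ (mul_mem hy hx) _)
  rcases hr with ⟨i, j, m', n, hc, rfl⟩ | ⟨i, j, m', n, hc, rfl⟩
  · exact br _ _ _ (m _ _) (m _ _)
  · exact sub_mem (br _ _ _ (m _ _) (m _ _))
      (sub_mem (Subalgebra.smul_mem _ (mul_mem (m _ _) (m _ _)) _) (mul_mem (m _ _) (m _ _)))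

theorem T3_mem {A : Type} [Ring A] [Algebra ℂ A] (S : Subalgebra ℂ A)
    (X : Idx M N → ℤ → A) (m : ∀ i n, X i n ∈ S) (r : A) (hr : r ∈ T3 q X) : r ∈ S := by
  have br : ∀ (u : ℂ) x y, x ∈ S → y ∈ S → brF u x y ∈ S :=
    fun u x y hx hy => sub_mem (mul_mem hx hy) (Subalgebra.smul_mem _ (mul_mem hy hx) _)
  have os : ∀ a b c d, a ∈ S → b ∈ S → c ∈ S → d ∈ S → osc4 q a b c d ∈ S :=
    fun a b c d ha hb hc hd => add_mem (mul_mem (br _ _ _ (br _ _ _ ha hb) hc) hd)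
      (mul_mem hd (br _ _ _ (br _ _ _ ha hb) hc))
  rcases hr with ⟨i, j, m', n, u, hc, hi, rfl⟩ | ⟨i, b, j, m', n, u, v, h1, hN, h3, h4, h5, rfl⟩
  · exact add_mem (br _ _ _ (m _ _) (br _ _ _ (m _ _) (m _ _)))
      (br _ _ _ (m _ _) (br _ _ _ (m _ _) (m _ _)))
  · exact add_mem (os _ _ _ _ (m _ _) (m _ _) (m _ _) (m _ _))
      (os _ _ _ _ (m _ _) (m _ _) (m _ _) (m _ _))

theorem o_p2 (hq0 : q ≠ 0) (hq1 : ∀ k : ℕ, k ≠ 0 → q ^ k ≠ 1) :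
    ∀ r ∈ T2 q 1 (xp (oρ (q := q) (M := M) (N := N))), r = 0 := by
  intro r hr
  refine o_zero r ?_ (T2_plus (o_L1 hq0) hq0 hq1 r hr)
  have e : T2 q 1 (xp (oρ (q := q) (M := M) (N := N))) = _ := T2_map oρ 1 gXp
  rw [e] at hr
  obtain ⟨r, hr, rfl⟩ := hr
  have hm := T2_mem (Algebra.adjoin ℂ {x | ∃ i n, x = gXp (M := M) (N := N) i n}) 1 gXp
    (fun i n => Algebra.subset_adjoin ⟨i, n, rfl⟩) r hr
  intro b
  rw [o_adj r hm, mk3_T2p r hr,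
    zero_mul, map_zero]

theorem o_p3 (hq0 : q ≠ 0) (hq1 : ∀ k : ℕ, k ≠ 0 → q ^ k ≠ 1) :
    ∀ r ∈ T3 q (xp (oρ (q := q) (M := M) (N := N))), r = 0 := by
  intro r hr
  refine o_zero r ?_ (T3_plus (o_L1 hq0) hq0 hq1 (o_p2 hq0 hq1) r hr)
  have e : T3 q (xp (oρ (q := q) (M := M) (N := N))) = _ := T3_map oρ gXp
  rw [e] at hr
  obtain ⟨r, hr, rfl⟩ := hr
  have hm := T3_mem (Algebra.adjoin ℂ {x | ∃ i n, x = gXp (M := M) (N := N) i n}) gXp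
    (fun i n => Algebra.subset_adjoin ⟨i, n, rfl⟩) r hr
  intro b
  rw [o_adj r hm, mk3_T3p r hr,
    zero_mul, map_zero]

variable {T : Type} [Ring T] [Algebra ℂ T]

def oπ (iL iR : UU q M N →ₐ[ℂ] T) : WW q M N →ₗ[ℂ] T :=
  lf fun w => (LinearMap.mulLeft ℂ ((w.map fun x => iL (mk3 q M N (gXm x.1 x.2))).prod)) ∘ₗ
    iR.toLinearMap

theorem o_dat (iL iR : UU q M N →ₐ[ℂ] T) (hq0 : q ≠ 0) (hq1 : ∀ k : ℕ, k ≠ 0 → q ^ k ≠ 1) :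
    IsDat iL iR oρ (oπ iL iR) eo where
  l1 := o_L1 hq0
  p2 := o_p2 hq0 hq1
  p3 := o_p3 hq0 hq1
  pim i n v := by
    have : (oπ iL iR) ∘ₗ Yo (i, n) =
        (LinearMap.mulLeft ℂ (iL (mk3 q M N (gXm i n)))) ∘ₗ oπ iL iR := by
      apply LinearMap.ext
      intro v
      refine Finsupp.induction_linear (motive := fun v : WW q M N =>
        ((oπ iL iR) ∘ₗ Yo (i, n)) v = ((LinearMap.mulLeft ℂ (iL (mk3 q M N (gXm i n)))) ∘ₗ oπ iL iR) v)
        v ?_ ?_ ?_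
      · exact (map_zero _).trans (map_zero _).symm
      · intro f g hf hg
        exact (map_add _ _ _).trans ((congrArg₂ (· + ·) hf hg).trans (map_add _ _ _).symm)
      · intro w b
        change (oπ iL iR) (Yo (i, n) (sg w b)) = iL (mk3 q M N (gXm i n)) * (oπ iL iR (sg w b))
        rw [Yo_single, oπ, lf_sg, lf_sg]
        simp [mul_assoc]
    rw [xm, gXm, oρ_gi]
    exact LinearMap.congr_fun this v
  pie b := by
    rw [oπ, eo, lf_sg]; simp
  eg g hg b := by rw [oρ_gi]; exact oG_e g hg b

end W
end TD

namespace TD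
open QAS
open scoped TensorProduct

section op
variable {q : ℂ} {M N : ℕ} {A : Type} [Ring A] [Algebra ℂ A]
open MulOpposite

theorem T2_opz (hq0 : q ≠ 0) (e : ℤ) {X : Idx M N → ℤ → A} (h : ∀ r ∈ T2 q e X, r = 0) :
    ∀ r ∈ T2 q (-e) (fun i n => op (X i n)), r = 0 := by
  rintro r (⟨i, j, m, n, hc, rfl⟩ | ⟨i, j, m, n, hc, rfl⟩)
  · rw [R4_op, T2_R4 h j i (by rw [cc_symm, hc])]; simp
  · rw [R5_op _ (zpow_ne_zero _ hq0), ← zpow_neg, neg_mul, neg_neg,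
      h _ (Or.inr ⟨i, j, m, n, hc, rfl⟩)]
    simp

theorem T3_opz (hq0 : q ≠ 0) (e : ℤ) {X : Idx M N → ℤ → A} (h2 : ∀ r ∈ T2 q e X, r = 0)
    (h : ∀ r ∈ T3 q X, r = 0) : ∀ r ∈ T3 q (fun i n => op (X i n)), r = 0 := by
  rintro r (⟨i, j, m, n, u, hc, hi, rfl⟩ | ⟨i, b, j, m, n, u, v, h1, hN, h3, h4, h5, rfl⟩)
  · rw [SER_op hq0, h _ (Or.inl ⟨i, j, m, n, u, hc, hi, rfl⟩)]; simp
  · rw [OSC_op hq0]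
    · rw [h _ (Or.inr ⟨i, b, j, m, n, u, v, h1, hN, h3, h4, h5, rfl⟩)]; simp
    · have := T2_R4 h2 i j (by rw [h3, h5]; exact cc_M3 M h1) m u
      rw [R4, sgn, if_neg (by omega), one_smul, sub_eq_zero] at this
      exact this
    · have := T2_R4 h2 b b (by rw [h4]; exact cc_M M) n v
      rw [R4, sgn, if_pos ⟨h4, h4⟩, sub_eq_zero] at this
      simpa using this

theorem mk3_p2 : ∀ r ∈ T2 q 1 (xp (mk3 q M N)), r = 0 := by
  intro r hr
  have e : T2 q 1 (xp (mk3 q M N)) = _ := T2_map (mk3 q M N) 1 gXp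
  rw [e] at hr
  obtain ⟨r, hr, rfl⟩ := hr
  exact mk3_T2p r hr
theorem mk3_m2 : ∀ r ∈ T2 q (-1) (xm (mk3 q M N)), r = 0 := by
  intro r hr
  have e : T2 q (-1) (xm (mk3 q M N)) = _ := T2_map (mk3 q M N) (-1) gXm
  rw [e] at hr
  obtain ⟨r, hr, rfl⟩ := hr
  exact mk3_T2m r hr
theorem mk3_p3 : ∀ r ∈ T3 q (xp (mk3 q M N)), r = 0 := by
  intro r hr
  have e : T3 q (xp (mk3 q M N)) = _ := T3_map (mk3 q M N) gXp
  rw [e] at hr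
  obtain ⟨r, hr, rfl⟩ := hr
  exact mk3_T3p r hr
theorem mk3_m3 : ∀ r ∈ T3 q (xm (mk3 q M N)), r = 0 := by
  intro r hr
  have e : T3 q (xm (mk3 q M N)) = _ := T3_map (mk3 q M N) gXm
  rw [e] at hr
  obtain ⟨r, hr, rfl⟩ := hr
  exact mk3_T3m r hr

def fl : Gen M N false → Gen M N false
  | .Xp i m => .Xm i m
  | .Xm i m => .Xp i m
  | .K i => .K i
  | .Ki i => .Ki i
  | .H i s => .H i s
  | .K0 he => .K0 he
  | .K0i he => .K0i he

/-- the anti-homomorphism on the free algebra -/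
def tau0 : FA M N false →ₐ[ℂ] (UU q M N)ᵐᵒᵖ :=
  FreeAlgebra.lift ℂ fun g => op (mk3 q M N (gi (fl g)))

theorem tau0_gi (g : Gen M N false) : tau0 (q := q) (gi g) = op (mk3 q M N (gi (fl g))) := by
  simp [tau0, gi]

theorem tau0_HF (i : Idx M N) (s : ℤ) :
    tau0 (q := q) (HF M N false i.1 s) = op (mk3 q M N (HF M N false i.1 s)) := by
  unfold HF
  split_ifs
  · rw [tau0_gi]; rfl
  · simp

theorem mk3_HFc (i j : Idx M N) (s t : ℤ) :
    mk3 q M N (HF M N false i.1 s) * mk3 q M N (HF M N false j.1 t) =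
    mk3 q M N (HF M N false j.1 t) * mk3 q M N (HF M N false i.1 s) := by
  by_cases hs : s ≠ 0
  · by_cases ht : t ≠ 0
    · have := mk3_L1 _ _ (rel.HH (q := q) i j ⟨s, hs⟩ ⟨t, ht⟩)
      rw [← HF_eq, ← HF_eq, map_mul, map_mul] at this
      exact this
    · have : HF M N false j.1 t = 0 := by rw [HF, dif_neg (fun h => ht h.2)]
      simp [this]
  · have : HF M N false i.1 s = 0 := by rw [HF, dif_neg (fun h => hs h.2)]
    simp [this]

theorem mk3_KHF (i j : Idx M N) (t : ℤ) :
    mk3 q M N (HF M N false j.1 t) * mk3 q M N (gi (Gen.K i)) =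
    mk3 q M N (gi (Gen.K i)) * mk3 q M N (HF M N false j.1 t) := by
  by_cases ht : t ≠ 0
  · have := mk3_L1 _ _ (rel.KH (q := q) i j ⟨t, ht⟩)
    rw [← HF_eq, map_mul, map_mul] at this
    exact this.symm
  · have : HF M N false j.1 t = 0 := by rw [HF, dif_neg (fun h => ht h.2)]
    simp [this]

theorem mk3_KiHF (i j : Idx M N) (t : ℤ) :
    mk3 q M N (HF M N false j.1 t) * mk3 q M N (gi (Gen.Ki i)) =
    mk3 q M N (gi (Gen.Ki i)) * mk3 q M N (HF M N false j.1 t) := by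
  by_cases ht : t ≠ 0
  · have := mk3_L1 _ _ (rel.KiH (q := q) i j ⟨t, ht⟩)
    rw [← HF_eq, map_mul, map_mul] at this
    exact this.symm
  · have : HF M N false j.1 t = 0 := by rw [HF, dif_neg (fun h => ht h.2)]
    simp [this]

theorem tau0_P (i : Idx M N) (n : ℤ) :
    tau0 (q := q) (phiPF q M N false i.1 n) = op (mk3 q M N (phiPF q M N false i.1 n)) := by
  have h1 := PP_eq (q := q) (tau0 (q := q)) i n
  have h2 := PP_eq (q := q) (mk3 q M N) i n
  rw [PP] at h1 h2
  rw [h1, h2, tau0_gi]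
  simp only [tau0_HF]
  unfold fP
  split_ifs
  · rw [expC_op _ _ (fun r s => mk3_HFc _ _ _ _), ← op_mul]
    exact congrArg op (expC_comm _ _ _ (fun s => mk3_KHF _ _ _) _)
  · simp

theorem tau0_M (i : Idx M N) (n : ℤ) :
    tau0 (q := q) (phiMF q M N false i.1 n) = op (mk3 q M N (phiMF q M N false i.1 n)) := by
  have h1 := QQ_eq (q := q) (tau0 (q := q)) i n
  have h2 := QQ_eq (q := q) (mk3 q M N) i n
  rw [QQ] at h1 h2
  rw [h1, h2, tau0_gi]
  simp only [tau0_HF]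
  unfold fM
  split_ifs
  · rw [expC_op _ _ (fun r s => mk3_HFc _ _ _ _), ← op_mul]
    exact congrArg op (expC_comm _ _ _ (fun s => mk3_KiHF _ _ _) _)
  · simp

theorem tau0_L1 (hq0 : q ≠ 0) : L1 q (tau0 (q := q) (M := M) (N := N)) := by
  have H := mk3_L1 (q := q) (M := M) (N := N)
  have sw : ∀ a b c d : Gen M N false, rel q M N false 1 (gi (fl b) * gi (fl a)) (gi (fl d) * gi (fl c)) →
      tau0 (q := q) (gi a * gi b) = tau0 (gi c * gi d) := by
    intro a b c d h
    have := H _ _ h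
    rw [map_mul, map_mul] at this
    simp only [map_mul, tau0_gi, ← op_mul, this]
  intro a b h
  cases h with
  | KKi i =>
    rw [map_mul, tau0_gi, tau0_gi, map_one, ← op_mul]
    exact congrArg op (H.KiK i)
  | KiK i =>
    rw [map_mul, tau0_gi, tau0_gi, map_one, ← op_mul]
    exact congrArg op (H.KKi i)
  | KK i j => exact sw _ _ _ _ (rel.KK j i)
  | KKi2 i j =>
    have := sw (.Ki j) (.K i) (.K i) (.Ki j) (rel.KKi2 i j)
    exact this.symm
  | KiKi i j => exact sw _ _ _ _ (rel.KiKi j i)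
  | KH i j s =>
    have := sw (.H j s) (.K i) (.K i) (.H j s) (rel.KH i j s)
    exact this.symm
  | KiH i j s =>
    have := sw (.H j s) (.Ki i) (.Ki i) (.H j s) (rel.KiH i j s)
    exact this.symm
  | HH i j s t => exact sw _ _ _ _ (rel.HH j i t s)
  | KXp i j n =>
    have := H.KXm i j n
    rw [map_smul, map_mul, map_mul, tau0_gi, tau0_gi, ← op_mul, ← op_mul, ← op_smul]
    congr 1
    change xm (mk3 q M N) j n * mk3 q M N (gi (.K i)) =
      q ^ cc M i.1 j.1 • (mk3 q M N (gi (.K i)) * xm (mk3 q M N) j n)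
    rw [this, smul_smul, mul_inv_cancel₀ (zpow_ne_zero _ hq0), one_smul]
  | KXm i j n =>
    have := H.KXp i j n
    rw [map_smul, map_mul, map_mul, tau0_gi, tau0_gi, ← op_mul, ← op_mul, ← op_smul]
    congr 1
    change xp (mk3 q M N) j n * mk3 q M N (gi (.K i)) =
      q ^ (-cc M i.1 j.1) • (mk3 q M N (gi (.K i)) * xp (mk3 q M N) j n)
    rw [this, smul_smul, zpow_neg, inv_mul_cancel₀ (zpow_ne_zero _ hq0), one_smul]
  | HXp i j s n =>
    have := H.HXm i j s.1 n s.2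
    rw [HF_eq] at this
    rw [map_smul, map_sub, map_mul, map_mul, tau0_gi, tau0_gi, tau0_gi, ← op_mul, ← op_mul,
      ← op_smul, ← op_sub]
    congr 1
    change xm (mk3 q M N) j n * mk3 q M N (gi (.H i s)) -
      mk3 q M N (gi (.H i s)) * xm (mk3 q M N) j n =
      gam q M i.1 j.1 s.1 • xm (mk3 q M N) j (n + s.1)
    rw [this, sub_sub_cancel]
  | HXm i j s n =>
    have := H.HXp i j s.1 n s.2
    rw [HF_eq] at this
    rw [map_neg, map_smul, map_sub, map_mul, map_mul, tau0_gi, tau0_gi, tau0_gi, ← op_mul, ← op_mul,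
      ← op_smul, ← op_sub, ← op_neg]
    congr 1
    change xp (mk3 q M N) j n * mk3 q M N (gi (.H i s)) -
      mk3 q M N (gi (.H i s)) * xp (mk3 q M N) j n =
      -(gam q M i.1 j.1 s.1 • xp (mk3 q M N) j (n + s.1))
    rw [this, sub_add_cancel_left]
  | XpXm i j m n =>
    have := H _ _ (rel.XpXm j i n m)
    rw [map_sub, map_smul, map_mul, map_mul] at this
    rw [map_sub, map_smul, map_mul, map_mul, tau0_gi, tau0_gi, ← op_mul, ← op_mul,
      ← op_smul, ← op_sub, sgn_symm]
    refine (congrArg op this).trans ?_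
    by_cases hij : i = j
    · subst hij
      rw [if_pos rfl, if_pos rfl, map_smul, map_smul, map_sub, map_sub, tau0_P, tau0_M, op_smul,
        op_sub, add_comm n m]
    · rw [if_neg hij, if_neg (Ne.symm hij)]; simp
  | XX0p i j m n h2 => omega
  | XX0m i j m n h2 => omega
  | XXp i j m n h2 => omega
  | XXm i j m n h2 => omega
  | serreP i j m n k h3 => omega
  | serreM i j m n k h3 => omega
  | oscP m n k u h3 => omega
  | oscM m n k u h3 => omega
  | K0K0i he => cases he
  | K0iK0 he => cases he
  | K0K he => cases he
  | K0Ki he => cases he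
  | K0H he => cases he
  | K0Xp he => cases he
  | K0Xm he => cases he

theorem tau0_xp : xp (tau0 (q := q) (M := M) (N := N)) = fun i n => op (xm (mk3 q M N) i n) := by
  funext i n
  rw [xp, gXp, tau0_gi]; rfl
theorem tau0_xm : xm (tau0 (q := q) (M := M) (N := N)) = fun i n => op (xp (mk3 q M N) i n) := by
  funext i n
  rw [xm, gXm, tau0_gi]; rfl

theorem tau0_rel (hq0 : q ≠ 0) {a b : FA M N false} (h : rel q M N false 3 a b) :
    tau0 (q := q) a = tau0 b := by
  refine rel3_of (tau0_L1 hq0) ?_ ?_ ?_ ?_ h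
  · rw [tau0_xp]
    have := T2_opz hq0 (-1) (mk3_m2 (q := q) (M := M) (N := N))
    rwa [neg_neg] at this
  · rw [tau0_xp]; exact T3_opz hq0 (-1) mk3_m2 mk3_m3
  · rw [tau0_xm]; exact T2_opz hq0 1 mk3_p2
  · rw [tau0_xm]; exact T3_opz hq0 1 mk3_p2 mk3_p3

def tauO (hq0 : q ≠ 0) : UU q M N →ₐ[ℂ] (UU q M N)ᵐᵒᵖ :=
  RingQuot.liftAlgHom ℂ ⟨tau0, fun {_ _} h => tau0_rel hq0 h⟩

def tau (hq0 : q ≠ 0) : UU q M N →ₗ[ℂ] UU q M N :=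
  (opLinearEquiv ℂ).symm.toLinearMap ∘ₗ (tauO hq0).toLinearMap

theorem tau_mul (hq0 : q ≠ 0) (a b : UU q M N) : tau hq0 (a * b) = tau hq0 b * tau hq0 a := by
  simp [tau]
theorem tau_c (hq0 : q ≠ 0) (c : ℂ) :
    tau (M := M) (N := N) hq0 (algebraMap ℂ _ c) = algebraMap ℂ _ c := by
  simp [tau]
theorem tau_gi (hq0 : q ≠ 0) (g : Gen M N false) :
    tau hq0 (mk3 q M N (gi g)) = mk3 q M N (gi (fl g)) := by
  have : tauO hq0 (mk3 q M N (gi g)) = tau0 (gi g) := RingQuot.liftAlgHom_mkAlgHom_apply ℂ _ _ _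
  simp only [tau, LinearMap.comp_apply, AlgHom.toLinearMap_apply, this, tau0_gi]
  rfl

theorem mk3_ind {p : UU q M N → Prop} (hc : ∀ c : ℂ, p (algebraMap ℂ _ c))
    (hg : ∀ g, p (mk3 q M N (gi g))) (ha : ∀ a b, p a → p b → p (a + b))
    (hm : ∀ a b, p a → p b → p (a * b)) (x : UU q M N) : p x := by
  obtain ⟨x, rfl⟩ := RingQuot.mkAlgHom_surjective ℂ (rel q M N false 3) x
  change p (mk3 q M N x)
  induction x using FreeAlgebra.induction with
  | grade0 c => rw [AlgHom.commutes]; exact hc c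
  | grade1 g => exact hg g
  | mul a b ha hb => rw [map_mul]; exact hm _ _ ha hb
  | add a b h1 h2 => rw [map_add]; exact ha _ _ h1 h2

theorem tau_tau (hq0 : q ≠ 0) (x : UU q M N) : tau hq0 (tau hq0 x) = x := by
  refine mk3_ind (p := fun x => tau hq0 (tau hq0 x) = x) ?_ ?_ ?_ ?_ x
  · intro c; rw [tau_c, tau_c]
  · intro g
    rw [tau_gi, tau_gi]
    congr 2
    cases g <;> rfl
  · intro a b h1 h2; rw [map_add, map_add, h1, h2]
  · intro a b h1 h2; rw [tau_mul, tau_mul, h1, h2]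

theorem tau_inj (hq0 : q ≠ 0) : Function.Injective (tau (M := M) (N := N) hq0) :=
  Function.LeftInverse.injective (tau_tau hq0)

theorem tau_adj (hq0 : q ≠ 0) (s : Set (UU q M N)) (S : Subalgebra ℂ (UU q M N))
    (h : ∀ x ∈ s, tau hq0 x ∈ S) (a : UU q M N) (ha : a ∈ Algebra.adjoin ℂ s) :
    tau hq0 a ∈ S := by
  induction ha using Algebra.adjoin_induction with
  | mem x hx => exact h x hx
  | algebraMap r => rw [tau_c]; exact S.algebraMap_mem r
  | add x y _ _ hx hy => rw [map_add]; exact add_mem hx hy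
  | mul x y _ _ hx hy => rw [tau_mul]; exact mul_mem hy hx

theorem mem_minus (i : Idx M N) (n : ℤ) : mk3 q M N (gi (.Xm i n)) ∈ Aminus q M N false 3 :=
  Algebra.subset_adjoin ⟨i.1, n, by rw [XmA, XmF_eq]; rfl⟩
theorem mem_plus (i : Idx M N) (n : ℤ) : mk3 q M N (gi (.Xp i n)) ∈ Aplus q M N false 3 :=
  Algebra.subset_adjoin ⟨i.1, n, by rw [XpA, XpF_eq]; rfl⟩
theorem mem_K (i : Idx M N) : mk3 q M N (gi (.K i)) ∈ Azero q M N false 3 :=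
  Algebra.subset_adjoin (Or.inl ⟨i.1, by rw [KA, KF, dif_pos i.2]⟩)
theorem mem_Ki (i : Idx M N) : mk3 q M N (gi (.Ki i)) ∈ Azero q M N false 3 :=
  Algebra.subset_adjoin (Or.inr (Or.inl ⟨i.1, by rw [KiA, KiF, dif_pos i.2]⟩))
theorem mem_H (i : Idx M N) (s) : mk3 q M N (gi (.H i s)) ∈ Azero q M N false 3 :=
  Algebra.subset_adjoin (Or.inr (Or.inr ⟨i.1, s.1, by rw [HA, HF_eq]⟩))

theorem minus_gen {S : UU q M N → Prop} (h0 : S 0) (h : ∀ i n, S (mk3 q M N (gi (.Xm i n)))) :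
    ∀ x ∈ {x | ∃ i : ℕ, ∃ n : ℤ, x = XmA q M N false 3 i n}, S x := by
  rintro x ⟨i, n, rfl⟩
  rw [XmA, XmF]; split_ifs
  · exact h _ _
  · rwa [map_zero]
theorem plus_gen {S : UU q M N → Prop} (h0 : S 0) (h : ∀ i n, S (mk3 q M N (gi (.Xp i n)))) :
    ∀ x ∈ {x | ∃ i : ℕ, ∃ n : ℤ, x = XpA q M N false 3 i n}, S x := by
  rintro x ⟨i, n, rfl⟩
  rw [XpA, XpF]; split_ifs
  · exact h _ _
  · rwa [map_zero]
theorem zero_gen {S : UU q M N → Prop} (h0 : S 0) (h1 : ∀ i, S (mk3 q M N (gi (.K i))))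
    (h2 : ∀ i, S (mk3 q M N (gi (.Ki i)))) (h3 : ∀ i s, S (mk3 q M N (gi (.H i s)))) :
    ∀ x ∈ {x | (∃ i : ℕ, x = KA q M N false 3 i) ∨ (∃ i : ℕ, x = KiA q M N false 3 i) ∨
    ∃ i : ℕ, ∃ s : ℤ, x = HA q M N false 3 i s}, S x := by
  rintro x (⟨i, rfl⟩ | ⟨i, rfl⟩ | ⟨i, s, rfl⟩)
  · rw [KA, KF]; split_ifs
    · exact h1 _
    · rwa [map_zero]
  · rw [KiA, KiF]; split_ifs
    · exact h2 _
    · rwa [map_zero]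
  · rw [HA, HF]; split_ifs
    · exact h3 _ _
    · rwa [map_zero]

theorem tau_plus (hq0 : q ≠ 0) (a : UU q M N) (ha : a ∈ Aplus q M N false 3) :
    tau hq0 a ∈ Aminus q M N false 3 := by
  refine tau_adj hq0 _ _ (plus_gen (by rw [map_zero]; exact zero_mem _) ?_) a ha
  intro i n; rw [tau_gi]; exact mem_minus i n

theorem tau_zero (hq0 : q ≠ 0) (a : UU q M N) (ha : a ∈ Azero q M N false 3) :
    tau hq0 a ∈ Azero q M N false 3 := by
  refine tau_adj hq0 _ _ (zero_gen (by rw [map_zero]; exact zero_mem _) ?_ ?_ ?_) a ha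
  · intro i; rw [tau_gi]; exact mem_K i
  · intro i; rw [tau_gi]; exact mem_Ki i
  · intro i s; rw [tau_gi]; exact mem_H i s

end op
end TD

namespace TD
open QAS
open scoped TensorProduct

section fin
variable {q : ℂ} {M N : ℕ}

theorem flat' (V : Type) [AddCommMonoid V] [Module ℂ V] : Module.Flat ℂ V := by
  letI i := Module.addCommMonoidToAddCommGroup ℂ (M := V)
  have : @Module.Flat ℂ V _ i.toAddCommMonoid _ := inferInstance
  exact this

theorem map_inj' {V V' W W' : Type} [AddCommMonoid V] [Module ℂ V] [AddCommMonoid V'] [Module ℂ V']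
    [AddCommMonoid W] [Module ℂ W] [AddCommMonoid W'] [Module ℂ W'] (f : V →ₗ[ℂ] V')
    (g : W →ₗ[ℂ] W') (hf : Function.Injective f) (hg : Function.Injective g) :
    Function.Injective (TensorProduct.map f g) := by
  haveI := flat' V
  haveI := flat' V'
  haveI := flat' W
  haveI := flat' W'
  exact TensorProduct.map_injective_of_flat_flat _ _ hf hg

section gen
variable {A : Type} [Semiring A] [Algebra ℂ A] (S T R : Subalgebra ℂ A)

/-- multiplication of two subalgebras -/
def mul0 : T ⊗[ℂ] R →ₗ[ℂ] A :=
  TensorProduct.lift (((LinearMap.mul ℂ A).comp T.val.toLinearMap).compl₂ R.val.toLinearMap)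

/-- multiplication of three subalgebras -/
def mul1 : S ⊗[ℂ] (T ⊗[ℂ] R) →ₗ[ℂ] A :=
  TensorProduct.lift (((LinearMap.mul ℂ A).comp S.val.toLinearMap).compl₂ (mul0 T R))

theorem mul0_tmul (z : T) (p : R) : mul0 T R (z ⊗ₜ p) = z.1 * p.1 := by
  simp [mul0]

theorem mul1_tmul (a : S) (z : T) (p : R) : mul1 S T R (a ⊗ₜ (z ⊗ₜ p)) = a.1 * (z.1 * p.1) := by
  simp [mul1, mul0_tmul]

variable (Θ : A →ₗ[ℂ] A ⊗[ℂ] A)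

theorem mul0_inj
    (h : ∀ a ∈ S, ∀ z ∈ T, ∀ p ∈ R, Θ (a * (z * p)) = a ⊗ₜ (z * p))
    (t : A →ₗ[ℂ] A) (tm : ∀ a b, t (a * b) = t b * t a) (ti : Function.Injective t)
    (tp : ∀ a ∈ R, t a ∈ S) (tz : ∀ a ∈ T, t a ∈ T) :
    Function.Injective (mul0 T R) := by
  have hz : Function.Injective (t ∘ₗ T.val.toLinearMap) := ti.comp Subtype.val_injective
  have hp : Function.Injective (t ∘ₗ R.val.toLinearMap) := ti.comp Subtype.val_injective
  have key : (Θ ∘ₗ t) ∘ₗ mul0 T R =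
      (TensorProduct.map (t ∘ₗ R.val.toLinearMap) (t ∘ₗ T.val.toLinearMap)) ∘ₗ
        (TensorProduct.comm ℂ T R).toLinearMap := by
    apply TensorProduct.ext'
    intro z p
    have := h _ (tp p.1 p.2) _ (tz z.1 z.2) 1 (one_mem _)
    rw [mul_one] at this
    rw [LinearMap.comp_apply, mul0_tmul, LinearMap.comp_apply, tm, this]
    rfl
  have hi : Function.Injective ((Θ ∘ₗ t) ∘ₗ mul0 T R) := by
    rw [key, LinearMap.coe_comp]
    exact (map_inj' _ _ hp hz).comp (TensorProduct.comm ℂ T R).injective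
  rw [LinearMap.coe_comp] at hi
  exact hi.of_comp

theorem mul1_inj
    (h : ∀ a ∈ S, ∀ z ∈ T, ∀ p ∈ R, Θ (a * (z * p)) = a ⊗ₜ (z * p))
    (h0 : Function.Injective (mul0 T R)) : Function.Injective (mul1 S T R) := by
  have key : Θ ∘ₗ mul1 S T R = TensorProduct.map S.val.toLinearMap (mul0 T R) := by
    apply TensorProduct.ext_threefold'
    intro a z p
    rw [LinearMap.comp_apply, mul1_tmul, h _ a.2 _ z.2 _ p.2, TensorProduct.map_tmul, mul0_tmul]
    rfl
  have hi : Function.Injective (Θ ∘ₗ mul1 S T R) := by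
    rw [key]
    exact map_inj' _ _ Subtype.val_injective h0
  rw [LinearMap.coe_comp] at hi
  exact hi.of_comp
end gen

theorem ex_incl (B : Type) [Ring B] [Algebra ℂ B] :
    ∃ iL iR : B →ₐ[ℂ] B ⊗[ℂ] B, ∀ a b : B, iL a * iR b = a ⊗ₜ b :=
  ⟨Algebra.TensorProduct.includeLeft, Algebra.TensorProduct.includeRight, fun a b => by simp⟩

theorem ex_theta (hq0 : q ≠ 0) (hq1 : ∀ k : ℕ, k ≠ 0 → q ^ k ≠ 1) :
    ∃ Θ : UU q M N →ₗ[ℂ] (UU q M N) ⊗[ℂ] (UU q M N), ∀ a ∈ Aminus q M N false 3,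
      ∀ z ∈ Azero q M N false 3, ∀ p ∈ Aplus q M N false 3, Θ (a * (z * p)) = a ⊗ₜ (z * p) := by
  obtain ⟨iL, iR, hi⟩ := ex_incl (UU q M N)
  obtain ⟨Θ, h⟩ := exists_theta (o_dat (q := q) (M := M) (N := N)
    (T := UU q M N ⊗[ℂ] UU q M N) iL iR hq0 hq1) hq0 hq1
  refine ⟨Θ, fun a ha z hz p hp => ?_⟩
  rw [h a ha z hz p hp]
  exact hi _ _

theorem tri_tmul (a : Aminus q M N false 3) (z : Azero q M N false 3) (p : Aplus q M N false 3) :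
    triMul q M N false 3 (Aminus q M N false 3) (Azero q M N false 3) (Aplus q M N false 3)
      (a ⊗ₜ (z ⊗ₜ p)) = a.1 * (z.1 * p.1) := by
  simp [triMul]

theorem tri_inj (hq0 : q ≠ 0) (hq1 : ∀ k : ℕ, k ≠ 0 → q ^ k ≠ 1) :
    Function.Injective (triMul q M N false 3 (Aminus q M N false 3) (Azero q M N false 3)
      (Aplus q M N false 3)) := by
  obtain ⟨Θ, h⟩ := ex_theta (q := q) (M := M) (N := N) hq0 hq1
  exact mul1_inj _ _ _ Θ h (mul0_inj _ _ _ Θ h (tau hq0) (tau_mul hq0) (tau_inj hq0)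
    (tau_plus hq0) (tau_zero hq0))

theorem adj_stab {A : Type} [Ring A] [Algebra ℂ A] (s : Set A) (Q : Submodule ℂ A)
    (h : ∀ x ∈ s, ∀ v ∈ Q, x * v ∈ Q) (a : A) (ha : a ∈ Algebra.adjoin ℂ s) :
    ∀ v ∈ Q, a * v ∈ Q := by
  induction ha using Algebra.adjoin_induction with
  | mem x hx => exact h x hx
  | algebraMap r => intro v hv; rw [← Algebra.smul_def]; exact Q.smul_mem _ hv
  | add x y _ _ hx hy => intro v hv; rw [add_mul]; exact add_mem (hx v hv) (hy v hv)
  | mul x y _ _ hx hy => intro v hv; rw [mul_assoc]; exact hx _ (hy v hv)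

/-- left translation preimage -/
def pre {A : Type} [Ring A] [Algebra ℂ A] (x : A) (Q : Submodule ℂ A) : Submodule ℂ A :=
  Q.comap (LinearMap.mulLeft ℂ x)

theorem mem_pre {A : Type} [Ring A] [Algebra ℂ A] (x v : A) (Q : Submodule ℂ A) :
    v ∈ pre x Q ↔ x * v ∈ Q := Iff.rfl

def S0 (q : ℂ) (M N : ℕ) : Submodule ℂ (UU q M N) :=
  Submodule.span ℂ {v | ∃ z ∈ Azero q M N false 3, ∃ p ∈ Aplus q M N false 3, v = z * p}

def S1 (q : ℂ) (M N : ℕ) : Submodule ℂ (UU q M N) :=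
  Submodule.span ℂ {v | ∃ a ∈ Aminus q M N false 3, ∃ w ∈ S0 q M N, v = a * w}

theorem S0_stab (z : UU q M N) (hz : z ∈ Azero q M N false 3) (v : UU q M N)
    (hv : v ∈ S0 q M N) : z * v ∈ S0 q M N := by
  have : S0 q M N ≤ pre z (S0 q M N) := by
    apply Submodule.span_le.mpr
    rintro v ⟨z', hz', p, hp, rfl⟩
    exact Submodule.subset_span ⟨z * z', mul_mem hz hz', p, hp, (mul_assoc _ _ _).symm⟩
  exact this hv

theorem S1_stab (z : UU q M N) (hz : z ∈ Aminus q M N false 3) (v : UU q M N)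
    (hv : v ∈ S1 q M N) : z * v ∈ S1 q M N := by
  have : S1 q M N ≤ pre z (S1 q M N) := by
    apply Submodule.span_le.mpr
    rintro v ⟨z', hz', p, hp, rfl⟩
    exact Submodule.subset_span ⟨z * z', mul_mem hz hz', p, hp, (mul_assoc _ _ _).symm⟩
  exact this hv

theorem S0_le (Q : Submodule ℂ (UU q M N)) (hp : ∀ p ∈ Aplus q M N false 3, p ∈ Q)
    (h1 : ∀ i, ∀ v ∈ Q, mk3 q M N (gi (.K i)) * v ∈ Q)
    (h2 : ∀ i, ∀ v ∈ Q, mk3 q M N (gi (.Ki i)) * v ∈ Q)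
    (h3 : ∀ i s, ∀ v ∈ Q, mk3 q M N (gi (.H i s)) * v ∈ Q) : S0 q M N ≤ Q := by
  apply Submodule.span_le.mpr
  rintro v ⟨z, hz, p, hp', rfl⟩
  exact adj_stab _ Q (zero_gen (S := fun x => ∀ v ∈ Q, x * v ∈ Q) (by simp) h1 h2 h3) z hz p
    (hp p hp')

theorem S1_le (Q : Submodule ℂ (UU q M N)) (h0 : S0 q M N ≤ Q)
    (h1 : ∀ i n, ∀ v ∈ Q, mk3 q M N (gi (.Xm i n)) * v ∈ Q) : S1 q M N ≤ Q := by
  apply Submodule.span_le.mpr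
  rintro v ⟨z, hz, p, hp', rfl⟩
  exact adj_stab _ Q (minus_gen (S := fun x => ∀ v ∈ Q, x * v ∈ Q) (by simp) h1) z hz p
    (h0 hp')

theorem S0_le_S1 : S0 q M N ≤ S1 q M N := fun v hv =>
  Submodule.subset_span ⟨1, one_mem _, v, hv, (one_mul v).symm⟩

theorem S0_Xp (hq0 : q ≠ 0) (j : Idx M N) (n : ℤ) (v : UU q M N) (hv : v ∈ S0 q M N) :
    xp (mk3 q M N) j n * v ∈ S0 q M N := by
  have H := mk3_L1 (q := q) (M := M) (N := N)
  have : S0 q M N ≤ ⨅ (n : ℤ), pre (xp (mk3 q M N) j n) (S0 q M N) := by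
    apply S0_le
    · intro p hp
      rw [Submodule.mem_iInf]
      intro n
      exact Submodule.subset_span ⟨1, one_mem _, _, mul_mem (mem_plus j n) hp, (one_mul _).symm⟩
    · intro i v hv
      rw [Submodule.mem_iInf] at hv ⊢
      intro n
      have := H.KXp i j n
      rw [mem_pre, ← mul_assoc, show xp (mk3 q M N) j n * mk3 q M N (gi (.K i)) =
        (q ^ cc M i.1 j.1)⁻¹ • (mk3 q M N (gi (.K i)) * xp (mk3 q M N) j n) by
          rw [this, smul_smul, inv_mul_cancel₀ (zpow_ne_zero _ hq0), one_smul], smul_mul_assoc,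
          mul_assoc]
      exact Submodule.smul_mem _ _ (S0_stab _ (mem_K i) _ (hv n))
    · intro i v hv
      rw [Submodule.mem_iInf] at hv ⊢
      intro n
      have := H.KiXp hq0 i j n
      rw [mem_pre, ← mul_assoc, show xp (mk3 q M N) j n * mk3 q M N (gi (.Ki i)) =
        (q ^ cc M i.1 j.1) • (mk3 q M N (gi (.Ki i)) * xp (mk3 q M N) j n) by
          rw [this, smul_smul, mul_inv_cancel₀ (zpow_ne_zero _ hq0), one_smul], smul_mul_assoc,
          mul_assoc]
      exact Submodule.smul_mem _ _ (S0_stab _ (mem_Ki i) _ (hv n))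
    · intro i s v hv
      rw [Submodule.mem_iInf] at hv ⊢
      intro n
      have := H.HXp i j s.1 n s.2
      rw [HF_eq] at this
      rw [mem_pre, ← mul_assoc, eq_sub_of_add_eq this.symm, sub_mul, smul_mul_assoc, mul_assoc]
      exact sub_mem (S0_stab _ (mem_H i s) _ (hv n)) (Submodule.smul_mem _ _ (hv _))
  have := this hv
  rw [Submodule.mem_iInf] at this
  exact this n

theorem S1_K (i : Idx M N) (v : UU q M N) (hv : v ∈ S1 q M N) :
    mk3 q M N (gi (.K i)) * v ∈ S1 q M N := by
  have : S1 q M N ≤ pre (mk3 q M N (gi (.K i))) (S1 q M N) := by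
    apply S1_le
    · intro v hv; exact S0_le_S1 (S0_stab _ (mem_K i) _ hv)
    · intro j n v hv
      have := mk3_L1.KXm (q := q) i j n
      rw [mem_pre, ← mul_assoc]
      change mk3 q M N (gi (.K i)) * xm (mk3 q M N) j n * v ∈ _
      rw [this, smul_mul_assoc, mul_assoc]
      exact Submodule.smul_mem _ _ (S1_stab _ (mem_minus j n) _ hv)
  exact this hv

theorem S1_Ki (hq0 : q ≠ 0) (i : Idx M N) (v : UU q M N) (hv : v ∈ S1 q M N) :
    mk3 q M N (gi (.Ki i)) * v ∈ S1 q M N := by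
  have : S1 q M N ≤ pre (mk3 q M N (gi (.Ki i))) (S1 q M N) := by
    apply S1_le
    · intro v hv; exact S0_le_S1 (S0_stab _ (mem_Ki i) _ hv)
    · intro j n v hv
      have := mk3_L1.KiXm (q := q) hq0 i j n
      rw [mem_pre, ← mul_assoc]
      change mk3 q M N (gi (.Ki i)) * xm (mk3 q M N) j n * v ∈ _
      rw [this, smul_mul_assoc, mul_assoc]
      exact Submodule.smul_mem _ _ (S1_stab _ (mem_minus j n) _ hv)
  exact this hv

theorem S1_H (i : Idx M N) (s : {s : ℤ // s ≠ 0}) (v : UU q M N) (hv : v ∈ S1 q M N) :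
    mk3 q M N (gi (.H i s)) * v ∈ S1 q M N := by
  have : S1 q M N ≤ S1 q M N ⊓ pre (mk3 q M N (gi (.H i s))) (S1 q M N) := by
    apply S1_le
    · intro v hv; exact ⟨S0_le_S1 hv, S0_le_S1 (S0_stab _ (mem_H i s) _ hv)⟩
    · intro j n v hv
      refine ⟨S1_stab _ (mem_minus j n) _ hv.1, ?_⟩
      have := mk3_L1.HXm (q := q) i j s.1 n s.2
      rw [HF_eq] at this
      change mk3 q M N (gi (.H i s)) * (xm (mk3 q M N) j n * v) ∈ S1 q M N
      rw [← mul_assoc, this, sub_mul, smul_mul_assoc, mul_assoc]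
      exact sub_mem (S1_stab _ (mem_minus j n) _ hv.2)
        (Submodule.smul_mem _ _ (S1_stab _ (mem_minus j _) _ hv.1))
  exact (this hv).2

def stabS (q : ℂ) (M N : ℕ) : Subalgebra ℂ (UU q M N) where
  carrier := {x | ∀ v ∈ S1 q M N, x * v ∈ S1 q M N}
  mul_mem' := by
    intro a b ha hb v hv
    rw [mul_assoc]; exact ha _ (hb v hv)
  add_mem' := by
    intro a b ha hb v hv
    rw [add_mul]; exact add_mem (ha v hv) (hb v hv)
  algebraMap_mem' := by
    intro r v hv
    rw [← Algebra.smul_def]; exact Submodule.smul_mem _ _ hv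

theorem phi_stab (hq0 : q ≠ 0) (i : Idx M N) (n : ℤ) :
    mk3 q M N (phiPF q M N false i.1 n) ∈ stabS q M N ∧
    mk3 q M N (phiMF q M N false i.1 n) ∈ stabS q M N := by
  have hH : ∀ s, mk3 q M N (HF M N false i.1 s) ∈ stabS q M N := by
    intro s
    rw [HF]; split_ifs
    · exact S1_H _ _
    · rw [map_zero]; exact zero_mem _
  have h1 := PP_eq (q := q) (mk3 q M N) i n
  have h2 := QQ_eq (q := q) (mk3 q M N) i n
  rw [PP] at h1
  rw [QQ] at h2
  rw [h1, h2, fP, fM]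
  constructor
  · split_ifs
    · exact mul_mem (S1_K i) (expC_mem _ _ _ (fun s => hH _) _)
    · exact zero_mem _
  · split_ifs
    · exact mul_mem (S1_Ki hq0 i) (expC_mem _ _ _ (fun s => hH _) _)
    · exact zero_mem _

theorem S1_Xp (hq0 : q ≠ 0) (hq1 : ∀ k : ℕ, k ≠ 0 → q ^ k ≠ 1) (i : Idx M N) (m : ℤ)
    (v : UU q M N) (hv : v ∈ S1 q M N) :
    mk3 q M N (gi (.Xp i m)) * v ∈ S1 q M N := by
  have : S1 q M N ≤ S1 q M N ⊓ pre (mk3 q M N (gi (.Xp i m))) (S1 q M N) := by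
    apply S1_le
    · intro v hv; exact ⟨S0_le_S1 hv, S0_le_S1 (S0_Xp hq0 i m _ hv)⟩
    · intro j n v hv
      refine ⟨S1_stab _ (mem_minus j n) _ hv.1, ?_⟩
      have := (mk3_L1.half (q := q) (M := M) (N := N) hq0 hq1).xy i j m n
      change xp (mk3 q M N) i m * (xm (mk3 q M N) j n * v) ∈ S1 q M N
      rw [← mul_assoc, this, add_mul, smul_mul_assoc, mul_assoc]
      refine add_mem (Submodule.smul_mem _ _ (S1_stab _ (mem_minus j n) _ hv.2)) ?_
      split_ifs
      · have hh := phi_stab hq0 i (m + n)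
        have : psi (kap q M i) (PP q (mk3 q M N) i) (QQ q (mk3 q M N) i) (m + n) ∈ stabS q M N :=
          Subalgebra.smul_mem _ (sub_mem hh.1 hh.2) _
        exact this v hv.1
      · rw [zero_mul]; exact zero_mem _
  exact (this hv).2

theorem S1_top (hq0 : q ≠ 0) (hq1 : ∀ k : ℕ, k ≠ 0 → q ^ k ≠ 1) (x : UU q M N) :
    x ∈ S1 q M N := by
  have h : x ∈ stabS q M N := by
    refine mk3_ind (p := fun x => x ∈ stabS q M N) (fun c => (stabS q M N).algebraMap_mem c) ?_
      (fun a b => add_mem) (fun a b => mul_mem) x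
    intro g
    cases g with
    | Xp i m => exact S1_Xp hq0 hq1 i m
    | Xm i m => exact S1_stab _ (mem_minus i m)
    | K i => exact S1_K i
    | Ki i => exact S1_Ki hq0 i
    | H i s => exact S1_H i s
    | K0 he => cases he
    | K0i he => cases he
  have h1 : (1 : UU q M N) ∈ S1 q M N := S0_le_S1
    (Submodule.subset_span ⟨1, one_mem _, 1, one_mem _, (one_mul 1).symm⟩)
  have := h 1 h1
  rwa [mul_one] at this

theorem tri_surj (hq0 : q ≠ 0) (hq1 : ∀ k : ℕ, k ≠ 0 → q ^ k ≠ 1) :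
    Function.Surjective (triMul q M N false 3 (Aminus q M N false 3) (Azero q M N false 3)
      (Aplus q M N false 3)) := by
  rw [← LinearMap.range_eq_top, eq_top_iff]
  intro x _
  have : S1 q M N ≤ LinearMap.range (triMul q M N false 3 (Aminus q M N false 3)
      (Azero q M N false 3) (Aplus q M N false 3)) := by
    apply Submodule.span_le.mpr
    rintro v ⟨a, ha, w, hw, rfl⟩
    have : S0 q M N ≤ pre a (LinearMap.range (triMul q M N false 3 (Aminus q M N false 3)
      (Azero q M N false 3) (Aplus q M N false 3))) := by
      apply Submodule.span_le.mpr
      rintro v ⟨z, hz, p, hp, rfl⟩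
      exact ⟨⟨a, ha⟩ ⊗ₜ (⟨z, hz⟩ ⊗ₜ ⟨p, hp⟩), tri_tmul _ _ _⟩
    exact this hw
  exact this (S1_top hq0 hq1 x)

end fin
end TD

open QAS in
/-- the multiplication map `U⁻ ⊗ U⁰ ⊗ U⁺ → U` is bijective
(Drinfel'd-type triangular decomposition of `U_q(Lsl(M,N))`). -/
theorem triangular_decomposition (q : ℂ) (hq0 : q ≠ 0)
    (hq1 : ∀ k : ℕ, k ≠ 0 → q ^ k ≠ 1) (M N : ℕ) (hM : 1 ≤ M) (hN : 1 ≤ N) :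
    Function.Bijective
      (triMul q M N false 3 (Aminus q M N false 3) (Azero q M N false 3)
        (Aplus q M N false 3)) := by
  exact ⟨TD.tri_inj hq0 hq1, TD.tri_surj hq0 hq1⟩
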